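/- Let p ∈ {2, 3, 5, 7, 13} be prime, and let c_n^{(p*)} denote the n-th Fourier coefficient of the hauptmodul j_p*(τ) of the Fricke group Γ₀*(p). Then for every integer n ≥ -1, one has 2n·c_n^{(p*)} = Σ_{r∈ℤ} { t₂^{(p*)}(4n - r²) - t₂^{(p*)}(4pn - r²) }, where the sum over r is finite. -/

import Mathlib

open Complex Matrix

noncomputable section

/-- `SL(2, ℝ)`. -/
abbrev SL2R := Matrix.SpecialLinearGroup (Fin 2) ℝ

/-- `q = e^{2πiz}` (also used as `ζ = e^{2πiz}`). -/
def qc (z : ℂ) : ℂ := Complex.exp (2 * Real.pi * Complex.I * z)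

/-- The Dedekind eta function `η(z) = q^{1/24} ∏_{n ≥ 1} (1 - q^n)` (intended for `Im z > 0`). -/
def dedekindEta (z : ℂ) : ℂ :=
  Complex.exp (Real.pi * Complex.I * z / 12) *
    ∏' n : ℕ, (1 - Complex.exp (2 * Real.pi * Complex.I * ((n : ℂ) + 1) * z))

/-- The hauptmodul `j_N` of `Γ₀(N)` for `N ∈ {2, 3, 5, 7, 13, 6, 10}`. -/
def jn (N : ℕ) (z : ℂ) : ℂ :=
  if N = 6 then (dedekindEta (2 * z) * dedekindEta (3 * z) ^ 3 / (dedekindEta z * dedekindEta (6 * z) ^ 3)) ^ 3 - 3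
  else if N = 10 then dedekindEta (2 * z) * dedekindEta (5 * z) ^ 5 / (dedekindEta z * dedekindEta (10 * z) ^ 5) - 1
  else (dedekindEta z / dedekindEta ((N : ℂ) * z)) ^ (24 / (N - 1)) + 24 / ((N : ℂ) - 1)

/-- The hauptmodul `j_N^*` of the Fricke group `Γ₀^*(N)` for `N ∈ {2, 3, 5, 7, 13, 6, 10}`. -/
def jnStar (N : ℕ) (z : ℂ) : ℂ :=
  if N = 6 then
    (dedekindEta z * dedekindEta (3 * z) / (dedekindEta (2 * z) * dedekindEta (6 * z))) ^ 6 + 6 +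
      2 ^ 6 * (dedekindEta (2 * z) * dedekindEta (6 * z) / (dedekindEta z * dedekindEta (3 * z))) ^ 6
  else if N = 10 then
    (dedekindEta z * dedekindEta (5 * z) / (dedekindEta (2 * z) * dedekindEta (10 * z))) ^ 4 + 4 +
      2 ^ 4 * (dedekindEta (2 * z) * dedekindEta (10 * z) / (dedekindEta z * dedekindEta (5 * z))) ^ 4
  else
    (dedekindEta z / dedekindEta ((N : ℂ) * z)) ^ (24 / (N - 1)) + 24 / ((N : ℂ) - 1) +
      (N : ℂ) ^ (12 / (N - 1)) * (dedekindEta ((N : ℂ) * z) / dedekindEta z) ^ (24 / (N - 1))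

/-- `f` has the `q`-expansion `f(τ) = Σ_{n ≥ n₀} (a n) q^n` on the upper half-plane. -/
def HasQExp (f : ℂ → ℂ) (a : ℤ → ℂ) (n₀ : ℤ) : Prop :=
  (∀ n < n₀, a n = 0) ∧
    ∀ τ : ℂ, 0 < τ.im →
      HasSum (fun m : ℕ => a (n₀ + m) * qc τ ^ (n₀ + (m : ℤ))) (f τ)

/-- `Γ₀(N)` viewed as a subgroup of `SL(2, ℝ)`. -/
def Gamma0SL2R (N : ℕ) : Subgroup SL2R :=
  (CongruenceSubgroup.Gamma0 N).map
    (Matrix.SpecialLinearGroup.map (Int.castRingHom ℝ))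

/-- The set of Atkin–Lehner matrices `W_e` of level `N`:
`W_e = e^{-1/2} [[xe, y], [zN, we]]`, `x, y, z, w ∈ ℤ` (determinant `1` being automatic). -/
def atkinLehnerSet (N e : ℕ) : Set SL2R :=
  { g | ∃ x y z w : ℤ,
      g.1 = (Real.sqrt e)⁻¹ • !![(x : ℝ) * e, (y : ℝ); (z : ℝ) * N, (w : ℝ) * e] }

/-- The Fricke group `Γ₀^*(N)`, generated by `Γ₀(N)` and all Atkin–Lehner involutions `W_e`
for `e ∣ N` with `gcd(e, N/e) = 1`. -/
def FrickeGroup (N : ℕ) : Subgroup SL2R :=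
  Subgroup.closure
    ((Gamma0SL2R N : Set SL2R) ∪
      ⋃ e ∈ {e : ℕ | e ∣ N ∧ Nat.Coprime e (N / e)}, atkinLehnerSet N e)

/-- The Gram matrix of the integral binary quadratic form `[a, b, c]`. -/
def formMat (a b c : ℤ) : Matrix (Fin 2) (Fin 2) ℝ :=
  !![(a : ℝ), (b : ℝ) / 2; (b : ℝ) / 2, (c : ℝ)]

/-- `𝒬_{d,N}`: positive definite integral binary quadratic forms `[a, b, c]` of
discriminant `-d` with `N ∣ a`. -/
def QdN (d : ℤ) (N : ℕ) : Set (Matrix (Fin 2) (Fin 2) ℝ) :=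
  { M | ∃ a b c : ℤ, M = formMat a b c ∧ 0 < a ∧ b ^ 2 - 4 * a * c = -d ∧ (N : ℤ) ∣ a }

/-- `𝒬_{d,N,h}`: members of `𝒬_{d,N}` with `b ≡ h (mod 2N)`. -/
def QdNh (d : ℤ) (N : ℕ) (h : ℤ) : Set (Matrix (Fin 2) (Fin 2) ℝ) :=
  { M | ∃ a b c : ℤ, M = formMat a b c ∧ 0 < a ∧ b ^ 2 - 4 * a * c = -d ∧ (N : ℤ) ∣ a ∧
      (b : ZMod (2 * N)) = (h : ZMod (2 * N)) }

/-- Orbit relation of the (right) action `Q ↦ Q ∘ g`, i.e. `M ↦ gᵀ M g`, of `Γ ≤ SL(2, ℝ)`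
on a set `S` of Gram matrices of quadratic forms. -/
def formRel (Γ : Subgroup SL2R) (S : Set (Matrix (Fin 2) (Fin 2) ℝ)) (Q Q' : S) : Prop :=
  ∃ g ∈ Γ, Q'.1 = (g.1)ᵀ * Q.1 * g.1

/-- The CM point `α_Q` of a positive definite form (as a point of `ℂ`; it lies in the upper
half-plane): `α_Q = (-b + i √d) / (2a) = (-(b/2) + i √(det M)) / a`. -/
def cmPointC (M : Matrix (Fin 2) (Fin 2) ℝ) : ℂ :=
  ((-(M 0 1) : ℝ) + Complex.I * Real.sqrt M.det) / ((M 0 0 : ℝ) : ℂ)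

/-- The order of the stabilizer of the form `M` in `Γ/{±1}` (the stabilizer in `Γ` contains
`±1` and has twice the cardinality). -/
def stabOrder (Γ : Subgroup SL2R) (M : Matrix (Fin 2) (Fin 2) ℝ) : ℕ :=
  Nat.card { g : SL2R // g ∈ Γ ∧ (g.1)ᵀ * M * g.1 = M } / 2

/-- The modular trace `Σ_{Q ∈ S/Γ} f(α_Q) / |Γ̄_Q|`. -/
def classTrace (Γ : Subgroup SL2R) (f : ℂ → ℂ)
    (S : Set (Matrix (Fin 2) (Fin 2) ℝ)) : ℂ :=
  ∑ᶠ O : Quot (formRel Γ S),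
    f (cmPointC (Quot.out O).1) / (stabOrder Γ (Quot.out O).1 : ℂ)

/-- `t₂^{(N*)}(d)`, where `P` is the polynomial with `φ₂(j_N^*) = P(j_N^*)`;
includes the paper's conventions at nonpositive indices. -/
def t2Star (N : ℕ) (P : Polynomial ℂ) (d : ℤ) : ℂ :=
  if 0 < d then
    classTrace (FrickeGroup N) (fun z => Polynomial.eval (jnStar N z) P) (QdN d N)
  else if d = 0 then (if N = 2 then 5 else if N = 6 ∨ N = 10 then 5 / 2 else 3)
  else if d = -1 then -1
  else if d = -4 then -2
  else 0

/-- `σ₁^{(N)}(x) = Σ_{d ∣ x, N ∤ d} d` for `x ∈ ℤ_{>0}`, `(N-1)/24` at `x = 0`, and `0`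
off `ℤ_{≥0}`. -/
def sigmaN (N : ℕ) (x : ℚ) : ℂ :=
  if x = 0 then ((N : ℂ) - 1) / 24
  else if 0 < x ∧ x.den = 1 then
    ∑ d ∈ (Nat.divisors x.num.toNat).filter (fun d => ¬ N ∣ d), (d : ℂ)
  else 0

/-- `σ₁(x) = Σ_{d ∣ x} d` for `x ∈ ℤ_{>0}` and `0` otherwise. -/
def sigmaQ (x : ℚ) : ℂ :=
  if 0 < x ∧ x.den = 1 then ∑ d ∈ Nat.divisors x.num.toNat, (d : ℂ) else 0

/-- A weakly holomorphic Jacobi form of weight `k` and index `m`. -/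
structure WeakJacobiForm (k : ℤ) (m : ℕ) where
  toFun : ℂ → ℂ → ℂ
  holo : DifferentiableOn ℂ (fun p : ℂ × ℂ => toFun p.1 p.2)
      ({τ : ℂ | 0 < τ.im} ×ˢ (Set.univ : Set ℂ))
  slash_inv : ∀ a b c d : ℤ, a * d - b * c = 1 → ∀ τ z : ℂ, 0 < τ.im →
    ((c : ℂ) * τ + d) ^ (-k) *
        Complex.exp (-(2 * Real.pi * Complex.I * m * c * z ^ 2) / ((c : ℂ) * τ + d)) *
        toFun (((a : ℂ) * τ + b) / ((c : ℂ) * τ + d)) (z / ((c : ℂ) * τ + d)) =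
      toFun τ z
  elliptic : ∀ lm mu : ℤ, ∀ τ z : ℂ, 0 < τ.im →
    Complex.exp (2 * Real.pi * Complex.I * m * ((lm : ℂ) ^ 2 * τ + 2 * lm * z)) *
        toFun τ (z + lm * τ + mu) = toFun τ z
  coeff : ℤ → ℤ → ℂ
  coeff_neg_finite : {n : ℤ | n < 0 ∧ ∃ r : ℤ, coeff n r ≠ 0}.Finite
  expansion : ∀ τ z : ℂ, 0 < τ.im →
    HasSum (fun p : ℤ × ℤ => coeff p.1 p.2 * qc τ ^ p.1 * qc z ^ p.2) (toFun τ z)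

/-- Meromorphy of weight `k` at all cusps: at each cusp `γ∞`, the function `F|_k γ` has a
Fourier expansion in fractional powers of `q` with only finitely many negative terms. -/
def MeromAtCusps (k : ℤ) (F : ℂ → ℂ) : Prop :=
  ∀ a b c d : ℤ, a * d - b * c = 1 →
    ∃ (M : ℕ) (cs : ℤ → ℂ) (n₀ : ℤ), 0 < M ∧
      ∀ τ : ℂ, 0 < τ.im →
        HasSum
          (fun j : ℕ => cs (n₀ + j) *
            Complex.exp (2 * Real.pi * Complex.I * τ / M) ^ (n₀ + (j : ℤ)))
          (((c : ℂ) * τ + d) ^ (-k) * F (((a : ℂ) * τ + b) / ((c : ℂ) * τ + d)))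

/-- The Möbius action of an element of `SL(2, ℝ)` on `ℂ`. -/
def moebius (g : SL2R) (z : ℂ) : ℂ :=
  ((g.1 0 0 : ℝ) * z + ((g.1 0 1 : ℝ) : ℂ)) / ((g.1 1 0 : ℝ) * z + ((g.1 1 1 : ℝ) : ℂ))

/-- A weakly holomorphic modular function on `Γ`: holomorphic on the upper half-plane,
`Γ`-invariant, with poles only at the cusps. -/
def IsWeaklyHolModularFn (Γ : Subgroup SL2R) (f : ℂ → ℂ) : Prop :=
  DifferentiableOn ℂ f {z : ℂ | 0 < z.im} ∧
    (∀ g ∈ Γ, ∀ z : ℂ, 0 < z.im → f (moebius g z) = f z) ∧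
    MeromAtCusps 0 f

/-- The set `L_{h, d/4N}` of vectors
`X = [[b + h/2N, c/N], [-a, -(b + h/2N)]]`, `a, b, c ∈ ℤ`, of norm `q(X) = d/4N`. -/
def LhSet (N : ℕ) (h d : ℤ) : Set (Matrix (Fin 2) (Fin 2) ℝ) :=
  { X | ∃ a b c : ℤ,
      X = !![(b : ℝ) + (h : ℝ) / (2 * N), (c : ℝ) / N;
             -(a : ℝ), -((b : ℝ) + (h : ℝ) / (2 * N))] ∧
      (2 * b * N + h) ^ 2 - 4 * a * c * N = -d }

/-- The map `X ↦ N ⬝ [[0,-1],[1,0]] ⬝ X` from vectors to Gram matrices of quadratic forms. -/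
def vecToForm (N : ℕ) (X : Matrix (Fin 2) (Fin 2) ℝ) : Matrix (Fin 2) (Fin 2) ℝ :=
  (N : ℝ) • (!![(0 : ℝ), -1; 1, 0] * X)

/-- Orbit relation of `Γ` acting by conjugation `g.X = g X g⁻¹` on a set `S` of vectors. -/
def vecRel (Γ : Subgroup SL2R) (S : Set (Matrix (Fin 2) (Fin 2) ℝ)) (X X' : S) : Prop :=
  ∃ g ∈ Γ, X'.1 = g.1 * X.1 * (g⁻¹).1

/-- The Heegner point `D_X ∈ ℍ` of a vector `X` of positive norm. -/
def heegnerC (X : Matrix (Fin 2) (Fin 2) ℝ) : ℂ :=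
  ((X 0 0 / X 1 0 : ℝ) : ℂ) + Complex.I * Real.sqrt (X.det / (X 1 0) ^ 2)

/-- The order of the stabilizer of the vector `X` in `Γ/{±1}`. -/
def vecStabOrder (Γ : Subgroup SL2R) (X : Matrix (Fin 2) (Fin 2) ℝ) : ℕ :=
  Nat.card { g : SL2R // g ∈ Γ ∧ g.1 * X * (g⁻¹).1 = X } / 2

/-- The modular trace `t_f(h, m) = Σ_{X ∈ Γ\L_{h,m}} f(D_X) / |Γ̄_X|`. -/
def vecTrace (Γ : Subgroup SL2R) (f : ℂ → ℂ) (S : Set (Matrix (Fin 2) (Fin 2) ℝ)) : ℂ :=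
  ∑ᶠ O : Quot (vecRel Γ S), f (heegnerC (Quot.out O).1) / (vecStabOrder Γ (Quot.out O).1 : ℂ)

/-- The weight-2 Eisenstein series `E₂(z) = 1 - 24 Σ_{n ≥ 1} σ₁(n) qⁿ`. -/
def E2 (z : ℂ) : ℂ :=
  1 - 24 * ∑' n : ℕ, (∑ d ∈ Nat.divisors (n + 1), (d : ℂ)) * qc z ^ (n + 1)

/-- `E₂^{(N)}(z) = N E₂(Nz) - E₂(z)`. -/
def E2N (N : ℕ) (z : ℂ) : ℂ := (N : ℂ) * E2 ((N : ℂ) * z) - E2 z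

end

namespace FrickeTrace

/-- The upper half-plane as a subset of `ℂ`. -/
def UH : Set ℂ := {z | 0 < z.im}

/-- The automorphy denominator `c z + d`. -/
noncomputable def den (g : SL2R) (z : ℂ) : ℂ := (g.1 1 0 : ℝ) * z + ((g.1 1 1 : ℝ) : ℂ)

/-- The numerator `a z + b`. -/
noncomputable def num (g : SL2R) (z : ℂ) : ℂ := (g.1 0 0 : ℝ) * z + ((g.1 0 1 : ℝ) : ℂ)

lemma moebius_eq (g : SL2R) (z : ℂ) : moebius g z = num g z / den g z := rfl

lemma mem_UH {z : ℂ} : z ∈ UH ↔ 0 < z.im := Iff.rfl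

lemma isOpen_UH : IsOpen UH := isOpen_lt continuous_const Complex.continuous_im

lemma isPreconnected_UH : IsPreconnected UH := (convex_halfSpace_im_gt 0).isPreconnected

lemma det_entries (g : SL2R) : g.1 0 0 * g.1 1 1 - g.1 0 1 * g.1 1 0 = 1 := by
  have := g.2
  rwa [Matrix.det_fin_two] at this

lemma den_ne_zero (g : SL2R) {z : ℂ} (hz : z ∈ UH) : den g z ≠ 0 := by
  intro h
  have hz : 0 < z.im := hz
  have h1 := congrArg Complex.im h
  have h2 := congrArg Complex.re h
  simp [den] at h1 h2
  have hd := det_entries g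
  rcases h1 with h1 | h1
  · rw [h1] at h2 hd; simp at h2; rw [h2] at hd; simp at hd
  · exact hz.ne' h1

lemma im_moebius (g : SL2R) (z : ℂ) : (moebius g z).im = z.im / Complex.normSq (den g z) := by
  have hd := det_entries g
  rw [moebius_eq, Complex.div_im]
  simp only [num, den, add_re, add_im, mul_re, mul_im, ofReal_re, ofReal_im]
  rw [← sub_div]
  congr 1
  linear_combination z.im * hd

lemma moebius_mem (g : SL2R) {z : ℂ} (hz : z ∈ UH) : moebius g z ∈ UH := by
  rw [mem_UH, im_moebius]
  exact div_pos hz (Complex.normSq_pos.2 (den_ne_zero g hz))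

lemma den_mul (g h : SL2R) {z : ℂ} (hz : z ∈ UH) :
    den (g * h) z = den g (moebius h z) * den h z := by
  have := den_ne_zero h hz
  have e : den g (moebius h z) * den h z = (g.1 1 0 : ℝ) * num h z + (g.1 1 1 : ℝ) * den h z := by
    rw [moebius_eq, den]; field_simp
  rw [e]
  simp [num, den, Matrix.mul_apply, Fin.sum_univ_two]
  ring

lemma num_mul (g h : SL2R) {z : ℂ} (hz : z ∈ UH) :
    num (g * h) z = num g (moebius h z) * den h z := by
  have := den_ne_zero h hz
  have e : num g (moebius h z) * den h z = (g.1 0 0 : ℝ) * num h z + (g.1 0 1 : ℝ) * den h z := by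
    rw [moebius_eq, num]; field_simp
  rw [e]
  simp [num, den, Matrix.mul_apply, Fin.sum_univ_two]
  ring

lemma moebius_mul (g h : SL2R) {z : ℂ} (hz : z ∈ UH) :
    moebius (g * h) z = moebius g (moebius h z) := by
  rw [moebius_eq, num_mul g h hz, den_mul g h hz, mul_div_mul_right _ _ (den_ne_zero h hz),
    moebius_eq g]

@[simp] lemma moebius_one (z : ℂ) : moebius 1 z = z := by simp [moebius]

@[simp] lemma den_neg (g : SL2R) (z : ℂ) : den (-g) z = -den g z := by simp [den]; ring

@[simp] lemma moebius_neg (g : SL2R) (z : ℂ) : moebius (-g) z = moebius g z := by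
  have : num (-g) z = - num g z := by simp [num]; ring
  rw [moebius_eq, this, den_neg, neg_div_neg_eq, moebius_eq]

lemma moebius_inv_eq (g : SL2R) {z w : ℂ} (hz : z ∈ UH) (h : moebius g z = w) :
    moebius g⁻¹ w = z := by
  rw [← h, ← moebius_mul _ _ hz]; simp

lemma hasDerivAt_moebius (g : SL2R) {z : ℂ} (hz : z ∈ UH) :
    HasDerivAt (moebius g) (1 / den g z ^ 2) z := by
  have hd := den_ne_zero g hz
  have h1 : HasDerivAt (num g) (g.1 0 0 : ℝ) z := by
    have := ((hasDerivAt_id z).const_mul ((g.1 0 0 : ℝ) : ℂ)).add_const ((g.1 0 1 : ℝ) : ℂ)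
    rw [mul_one] at this
    exact this
  have h2 : HasDerivAt (den g) (g.1 1 0 : ℝ) z := by
    have := ((hasDerivAt_id z).const_mul ((g.1 1 0 : ℝ) : ℂ)).add_const ((g.1 1 1 : ℝ) : ℂ)
    rw [mul_one] at this
    exact this
  have h3 := h1.div h2 hd
  have e : (1 : ℂ) = ((g.1 0 0 : ℝ) : ℂ) * (g.1 1 1 : ℝ) - ((g.1 0 1 : ℝ) : ℂ) * (g.1 1 0 : ℝ) := by
    exact_mod_cast (det_entries g).symm
  have e2 : 1 / den g z ^ 2 =
      (((g.1 0 0 : ℝ) : ℂ) * den g z - num g z * (g.1 1 0 : ℝ)) / den g z ^ 2 := by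
    congr 1; rw [e]; simp only [num, den]; ring
  rw [e2]; exact h3

lemma differentiableOn_moebius (g : SL2R) : DifferentiableOn ℂ (moebius g) UH :=
  fun _ hz => (hasDerivAt_moebius g hz).differentiableAt.differentiableWithinAt

lemma continuousAt_moebius (g : SL2R) {z : ℂ} (hz : z ∈ UH) : ContinuousAt (moebius g) z :=
  (hasDerivAt_moebius g hz).continuousAt

/-- Two elements of `SL(2,ℝ)` with the same value and the same denominator at a point agree. -/
lemma eq_of_moebius_den {g h : SL2R} {z : ℂ} (hz : z ∈ UH)
    (h1 : moebius g z = moebius h z) (h2 : den g z = den h z) : g = h := by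
  have hz' : 0 < z.im := hz
  have hn : num g z = num h z := by
    rw [moebius_eq, moebius_eq, h2] at h1
    exact (div_left_inj' (den_ne_zero h hz)).1 h1
  have key : ∀ a b c d : ℝ, (a : ℂ) * z + b = c * z + d → a = c ∧ b = d := by
    intro a b c d he
    have hi := congrArg Complex.im he
    have hr := congrArg Complex.re he
    simp at hi hr
    have : a = c := by
      rcases hi with hi | hi
      · exact hi
      · exact absurd hi hz'.ne'
    subst this
    exact ⟨rfl, by linarith⟩
  obtain ⟨a1, a2⟩ := key _ _ _ _ hn
  obtain ⟨a3, a4⟩ := key _ _ _ _ h2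
  ext i j
  fin_cases i <;> fin_cases j <;> assumption

lemma eq_or_neg_of_moebius_den_sq {g h : SL2R} {z : ℂ} (hz : z ∈ UH)
    (h1 : moebius g z = moebius h z) (h2 : den g z ^ 2 = den h z ^ 2) : g = h ∨ g = -h := by
  rcases sq_eq_sq_iff_eq_or_eq_neg.1 h2 with h2 | h2
  · exact Or.inl (eq_of_moebius_den hz h1 h2)
  · exact Or.inr (eq_of_moebius_den hz (by simpa using h1) (by simpa using h2))

/-- The translation `z ↦ z + k`. -/
noncomputable def transl (k : ℤ) : SL2R := ⟨!![1, (k : ℝ); 0, 1], by simp [Matrix.det_fin_two]⟩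

@[simp] lemma moebius_transl (k : ℤ) (z : ℂ) : moebius (transl k) z = z + k := by
  simp [moebius, transl]

lemma transl_add (a b : ℤ) : transl (a + b) = transl a * transl b := by
  apply Subtype.ext
  rw [Matrix.SpecialLinearGroup.coe_mul]
  simp [transl, add_comm]

lemma transl_zero : transl 0 = 1 := by
  apply Subtype.ext
  ext i j
  fin_cases i <;> fin_cases j <;> simp [transl]

lemma transl_int_mem {Γ : Subgroup SL2R} (h : transl 1 ∈ Γ) (k : ℤ) : transl k ∈ Γ := by
  induction k using Int.induction_on with
  | zero => rw [transl_zero]; exact Γ.one_mem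
  | succ i ih => rw [transl_add]; exact Γ.mul_mem ih h
  | pred i ih =>
    rw [← Γ.mul_mem_cancel_right h, ← transl_add]
    simpa using ih

end FrickeTrace

namespace FrickeTrace

/-- A discrete group commensurable in shape with `SL(2,ℤ)` having one cusp, together with a
Hauptmodul `J = q⁻¹ + g(q)`. -/
structure IsHaupt (Γ : Subgroup SL2R) (J g : ℂ → ℂ) : Prop where
  transl_mem : transl 1 ∈ Γ
  neg_one_mem : (-1 : SL2R) ∈ Γ
  discrete : ∃ s : ℝ, 0 < s ∧ ∀ γ ∈ Γ, ∀ i j, ∃ m : ℤ, s * γ.1 i j ^ 2 = m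
  fund : ∃ c : ℝ, 0 < c ∧ ∀ z ∈ UH, ∃ γ ∈ Γ, c ≤ (moebius γ z).im
  diff : DifferentiableOn ℂ J UH
  inv : ∀ γ ∈ Γ, ∀ z ∈ UH, J (moebius γ z) = J z
  gdiff : DifferentiableOn ℂ g (Metric.ball 0 1)
  g_zero : g 0 = 0
  qexp : ∀ z ∈ UH, J z = (qc z)⁻¹ + g (qc z)

lemma finite_bounded_scaled_sq (s R : ℝ) (hs : 0 < s) :
    {x : ℝ | |x| ≤ R ∧ ∃ m : ℤ, s * x ^ 2 = m}.Finite := by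
  refine Set.Finite.subset (((Set.finite_Icc (0 : ℤ) ⌈s * R ^ 2⌉).image
    (fun m : ℤ => Real.sqrt (m / s))).union ((Set.finite_Icc (0 : ℤ) ⌈s * R ^ 2⌉).image
    (fun m : ℤ => -Real.sqrt (m / s)))) ?_
  rintro x ⟨hx, m, hm⟩
  have hx2 : x ^ 2 = m / s := by rw [← hm]; field_simp
  have hR : x ^ 2 ≤ R ^ 2 := sq_le_sq' (by linarith [abs_le.1 hx]) (abs_le.1 hx).2
  have hm0 : 0 ≤ m := by
    have : (0 : ℝ) ≤ m := by rw [← hm]; positivity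
    exact_mod_cast this
  have hm1 : m ≤ ⌈s * R ^ 2⌉ := by
    have : (m : ℝ) ≤ s * R ^ 2 := by rw [← hm]; gcongr
    exact_mod_cast this.trans (Int.le_ceil _)
  rcases le_total 0 x with h | h
  · left
    exact ⟨m, ⟨hm0, hm1⟩, by simp only; rw [← hx2, Real.sqrt_sq h]⟩
  · right
    exact ⟨m, ⟨hm0, hm1⟩, by
      simp only; rw [← hx2, ← neg_sq, Real.sqrt_sq (by linarith), neg_neg]⟩

lemma finite_bounded_entries (Γ : Subgroup SL2R) {s : ℝ} (hs : 0 < s)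
    (h : ∀ γ ∈ Γ, ∀ i j, ∃ m : ℤ, s * γ.1 i j ^ 2 = m) (R : ℝ) :
    {γ : SL2R | γ ∈ Γ ∧ ∀ i j, |γ.1 i j| ≤ R}.Finite := by
  have hf : (Set.univ.pi fun _ : Fin 2 => Set.univ.pi fun _ : Fin 2 =>
      {x : ℝ | |x| ≤ R ∧ ∃ m : ℤ, s * x ^ 2 = m}).Finite :=
    Set.Finite.pi fun _ => Set.Finite.pi fun _ => finite_bounded_scaled_sq s R hs
  refine Set.Finite.of_finite_image (f := fun γ : SL2R => (γ.1 : Fin 2 → Fin 2 → ℝ))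
    (hf.subset ?_) (fun a _ b _ hab => Subtype.ext hab)
  rintro _ ⟨γ, ⟨hγ, hb⟩, rfl⟩ i _ j _
  exact ⟨hb i j, h γ hγ i j⟩

/-- A linear form `a z + b` bounded at a point of a bounded region has bounded coefficients. -/
lemma coeff_bound {a b r R B : ℝ} {z : ℂ} (hr : 0 < r) (hz : r ≤ z.im) (hzR : ‖z‖ ≤ R)
    (h : ‖(a : ℂ) * z + b‖ ≤ B) : |a| ≤ B / r + (B + B / r * R) ∧ |b| ≤ B / r + (B + B / r * R) := by
  have hB : 0 ≤ B := (norm_nonneg _).trans h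
  have hR : 0 ≤ R := (norm_nonneg _).trans hzR
  have h1 : |a| ≤ B / r := by
    rw [le_div_iff₀ hr]
    have h2 := (Complex.abs_im_le_norm ((a : ℂ) * z + b)).trans h
    simp only [add_im, mul_im, ofReal_re, ofReal_im, zero_mul, add_zero, abs_mul] at h2
    have h3 : |z.im| = z.im := abs_of_pos (hr.trans_le hz)
    rw [h3] at h2
    exact (mul_le_mul_of_nonneg_left hz (abs_nonneg a)).trans h2
  have h2 : |b| ≤ B + B / r * R := by
    have e : (b : ℂ) = ((a : ℂ) * z + b) - a * z := by ring
    have : ‖(b : ℂ)‖ ≤ ‖(a : ℂ) * z + b‖ + ‖(a : ℂ) * z‖ := by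
      conv_lhs => rw [e]
      exact norm_sub_le _ _
    rw [norm_mul, Complex.norm_real, Complex.norm_real, Real.norm_eq_abs, Real.norm_eq_abs] at this
    have h4 : |a| * ‖z‖ ≤ B / r * R := mul_le_mul h1 hzR (norm_nonneg _) (by positivity)
    linarith
  have : 0 ≤ B / r := by positivity
  have : 0 ≤ B / r * R := by positivity
  constructor <;> linarith

lemma finite_returns {Γ : Subgroup SL2R} {s : ℝ} (hs : 0 < s)
    (h : ∀ γ ∈ Γ, ∀ i j, ∃ m : ℤ, s * γ.1 i j ^ 2 = m) {r R : ℝ} (hr : 0 < r) :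
    {γ : SL2R | γ ∈ Γ ∧ ∃ z : ℂ, r ≤ z.im ∧ ‖z‖ ≤ R ∧ r ≤ (moebius γ z).im ∧
      ‖moebius γ z‖ ≤ R}.Finite := by
  set D := Real.sqrt (R / r) with hD
  set B := max D (R * D)
  refine (finite_bounded_entries Γ hs h (B / r + (B + B / r * R))).subset ?_
  rintro γ ⟨hγ, z, hz, hzR, hw, hwR⟩
  have hzU : z ∈ UH := hr.trans_le hz
  have hR : 0 ≤ R := (norm_nonneg _).trans hzR
  have hden : ‖den γ z‖ ≤ D := by
    apply Real.le_sqrt_of_sq_le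
    have h1 := im_moebius γ z
    have hpos : 0 < Complex.normSq (den γ z) := Complex.normSq_pos.2 (den_ne_zero γ hzU)
    rw [← Complex.normSq_eq_norm_sq, le_div_iff₀ hr]
    rw [h1, le_div_iff₀ hpos] at hw
    have : z.im ≤ R := (Complex.abs_im_le_norm z |>.trans hzR |> abs_le.1).2
    linarith
  have hnum : ‖num γ z‖ ≤ R * D := by
    have : num γ z = moebius γ z * den γ z := by
      rw [moebius_eq, div_mul_cancel₀ _ (den_ne_zero γ hzU)]
    rw [this, norm_mul]
    gcongr
  have h1 := coeff_bound hr hz hzR (hden.trans (le_max_left D (R * D)))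
  have h2 := coeff_bound hr hz hzR (hnum.trans (le_max_right D (R * D)))
  refine ⟨hγ, fun i j => ?_⟩
  fin_cases i <;> fin_cases j
  exacts [h2.1, h2.2, h1.1, h1.2]

/-- Proper discontinuity, in the form of a limiting statement along a filter. -/
lemma exists_frequently_eq {Γ : Subgroup SL2R} {s : ℝ} (hs : 0 < s)
    (h : ∀ γ ∈ Γ, ∀ i j, ∃ m : ℤ, s * γ.1 i j ^ 2 = m) {ι : Type*} {l : Filter ι} [l.NeBot]
    {z : ι → ℂ} {γ : ι → SL2R} {z₀ w₀ : ℂ} (hz₀ : z₀ ∈ UH) (hw₀ : w₀ ∈ UH)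
    (hγ : ∀ i, γ i ∈ Γ) (hz : Filter.Tendsto z l (nhds z₀))
    (hw : Filter.Tendsto (fun i => moebius (γ i) (z i)) l (nhds w₀)) :
    ∃ δ ∈ Γ, moebius δ z₀ = w₀ ∧ ∃ᶠ i in l, γ i = δ := by
  have hz0 : 0 < z₀.im := hz₀
  have hw0 : 0 < w₀.im := hw₀
  set r := min (z₀.im) (w₀.im) / 2
  have hr : 0 < r := by positivity
  set R := max ‖z₀‖ ‖w₀‖ + 1
  have near : ∀ (x : ι → ℂ) (x₀ : ℂ), Filter.Tendsto x l (nhds x₀) → r < x₀.im → ‖x₀‖ < R →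
      ∀ᶠ i in l, r ≤ (x i).im ∧ ‖x i‖ ≤ R := by
    intro x x₀ hx h1 h2
    have e1 := ((Complex.continuous_im.tendsto x₀).comp hx).eventually (lt_mem_nhds h1)
    have e2 := ((continuous_norm.tendsto x₀).comp hx).eventually (gt_mem_nhds h2)
    filter_upwards [e1, e2] with i h3 h4
    exact ⟨le_of_lt h3, le_of_lt h4⟩
  have hrz : r < z₀.im := by
    have := min_le_left z₀.im w₀.im
    have : 0 < min z₀.im w₀.im := by positivity
    simp only [r]; linarith
  have hrw : r < w₀.im := by
    have := min_le_right z₀.im w₀.im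
    have : 0 < min z₀.im w₀.im := by positivity
    simp only [r]; linarith
  have e1 := near z z₀ hz hrz (by have := le_max_left ‖z₀‖ ‖w₀‖; simp only [R]; linarith)
  have e2 := near _ w₀ hw hrw (by have := le_max_right ‖z₀‖ ‖w₀‖; simp only [R]; linarith)
  have hfin := finite_returns hs h hr (R := R)
  obtain ⟨δ, hδ, hfreq⟩ : ∃ δ ∈ {γ : SL2R | γ ∈ Γ ∧ ∃ z : ℂ, r ≤ z.im ∧ ‖z‖ ≤ R ∧
      r ≤ (moebius γ z).im ∧ ‖moebius γ z‖ ≤ R}, ∃ᶠ i in l, γ i = δ := by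
    by_contra hcon
    push Not at hcon
    have := (hfin.eventually_all).2 hcon
    obtain ⟨i, h1, h2, h3⟩ := (this.and (e1.and e2)).exists
    exact h1 (γ i) ⟨hγ i, z i, h2.1, h2.2, h3.1, h3.2⟩ rfl
  refine ⟨δ, hδ.1, ?_, hfreq⟩
  have t1 := (continuousAt_moebius δ hz₀).tendsto.comp hz
  refine tendsto_nhds_unique_of_frequently_eq t1 hw ?_
  exact hfreq.mono fun i hi => by simp [hi]

end FrickeTrace

namespace FrickeTrace

open Filter Topology

/-- The filter of neighbourhoods of the cusp `i∞`. -/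
def imInf : Filter ℂ := comap Complex.im atTop

instance : imInf.NeBot := by
  refine Filter.comap_neBot_iff.2 fun s hs => ?_
  obtain ⟨a, ha⟩ := Filter.mem_atTop_sets.1 hs
  exact ⟨⟨0, a⟩, ha a le_rfl⟩

lemma eventually_imInf_lt (c : ℝ) : ∀ᶠ z in imInf, c < z.im :=
  (tendsto_comap (f := Complex.im)).eventually (eventually_gt_atTop c)

lemma eventually_imInf_UH : ∀ᶠ z in imInf, z ∈ UH := eventually_imInf_lt 0

lemma qc_eq_qParam (z : ℂ) : qc z = Function.Periodic.qParam 1 z := by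
  simp [qc, Function.Periodic.qParam]

lemma qc_ne_zero (z : ℂ) : qc z ≠ 0 := Complex.exp_ne_zero _

lemma norm_qc (z : ℂ) : ‖qc z‖ = Real.exp (-2 * Real.pi * z.im) := by
  rw [qc_eq_qParam, Function.Periodic.norm_qParam]; simp

lemma qc_mem_ball {z : ℂ} (hz : z ∈ UH) : qc z ∈ Metric.ball (0 : ℂ) 1 := by
  rw [qc_eq_qParam, mem_ball_zero_iff]
  exact Function.Periodic.norm_qParam_lt_one one_pos hz

lemma norm_qc_lt_one {z : ℂ} (hz : z ∈ UH) : ‖qc z‖ < 1 := by simpa using qc_mem_ball hz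

lemma qc_tendsto : Tendsto qc imInf (𝓝[≠] 0) := by
  have := Function.Periodic.qParam_tendsto (h := 1) one_pos
  simpa only [imInf, funext qc_eq_qParam] using this

lemma qc_tendsto_zero : Tendsto qc imInf (𝓝 0) := qc_tendsto.mono_right nhdsWithin_le_nhds

lemma qc_add (z w : ℂ) : qc (z + w) = qc z * qc w := by
  simp only [qc, ← Complex.exp_add]; ring_nf

lemma qc_nat_mul (n : ℕ) (z : ℂ) : qc (n * z) = qc z ^ n := by
  simp only [qc, ← Complex.exp_nat_mul]; ring_nf

lemma qc_int (k : ℤ) : qc k = 1 := by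
  rw [qc, Complex.exp_eq_one_iff]; exact ⟨k, by ring⟩

lemma qc_add_int (z : ℂ) (k : ℤ) : qc (z + k) = qc z := by
  rw [qc_add, qc_int, mul_one]

lemma exists_qc_eq {q : ℂ} (hq : q ≠ 0) (hq1 : ‖q‖ < 1) : ∃ z ∈ UH, qc z = q := by
  have h := Function.Periodic.qParam_right_inv (h := 1) one_ne_zero hq
  refine ⟨_, ?_, (qc_eq_qParam _).trans h⟩
  have := Function.Periodic.norm_qParam_lt_iff (h := 1) one_pos 0 (Function.Periodic.invQParam 1 q)
  rw [h] at this
  exact this.1 (by simpa using hq1)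

lemma differentiable_qc : Differentiable ℂ qc := by unfold qc; fun_prop

lemma hasDerivAt_qc (z : ℂ) : HasDerivAt qc (2 * Real.pi * I * qc z) z := by
  have h : HasDerivAt (fun z : ℂ => 2 * Real.pi * I * z) (2 * Real.pi * I) z := by
    have := (hasDerivAt_id z).const_mul (2 * Real.pi * I : ℂ)
    rw [mul_one] at this
    exact this
  have := h.cexp
  rw [mul_comm _ (qc z)]
  exact this

/-- A holomorphic `1`-periodic function on the upper half-plane, bounded near `i∞`, is a
holomorphic function of `q` on the unit disc. -/
lemma exists_cusp_function {G : ℂ → ℂ} (hd : DifferentiableOn ℂ G UH)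
    (hper : ∀ z ∈ UH, G (z + 1) = G z) (hb : ∃ K : ℝ, ∀ᶠ z in imInf, ‖G z‖ ≤ K) :
    ∃ h : ℂ → ℂ, DifferentiableOn ℂ h (Metric.ball 0 1) ∧ ∀ z ∈ UH, G z = h (qc z) := by
  classical
  set G' : ℂ → ℂ := UH.indicator G with hG'
  have hper' : Function.Periodic G' ((1 : ℝ) : ℂ) := by
    intro z
    by_cases hz : z ∈ UH
    · have : z + ((1 : ℝ) : ℂ) ∈ UH := by rw [mem_UH] at *; simpa using hz
      rw [hG', Set.indicator_of_mem this, Set.indicator_of_mem hz]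
      simpa using hper z hz
    · have : z + ((1 : ℝ) : ℂ) ∉ UH := by rw [mem_UH] at *; simpa using hz
      rw [hG', Set.indicator_of_notMem this, Set.indicator_of_notMem hz]
  have heq : ∀ z ∈ UH, G' z = G z := fun z hz => Set.indicator_of_mem hz G
  have hdiff : ∀ z ∈ UH, DifferentiableAt ℂ G' z := fun z hz => by
    have h1 := (hd z hz).differentiableAt (isOpen_UH.mem_nhds hz)
    refine h1.congr_of_eventuallyEq ?_
    filter_upwards [isOpen_UH.mem_nhds hz] with w hw using heq w hw
  refine ⟨Function.Periodic.cuspFunction 1 G', ?_, ?_⟩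
  · intro q hq
    apply DifferentiableAt.differentiableWithinAt
    rcases eq_or_ne q 0 with rfl | hq0
    · apply Function.Periodic.differentiableAt_cuspFunction_zero one_pos hper'
      · exact eventually_imInf_UH.mono hdiff
      · obtain ⟨K, hK⟩ := hb
        refine Asymptotics.IsBigO.of_bound K ?_
        have : ∀ᶠ z in imInf, ‖G' z‖ ≤ K * ‖(1 : ℂ → ℝ) z‖ := by
          filter_upwards [hK, eventually_imInf_UH] with z h1 h2
          rw [heq z h2]; simpa using h1
        exact this
    · obtain ⟨z, hz, rfl⟩ := exists_qc_eq hq0 (by simpa using hq)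
      rw [qc_eq_qParam]
      exact Function.Periodic.differentiableAt_cuspFunction one_ne_zero hper' (hdiff z hz)
  · intro z hz
    rw [qc_eq_qParam, Function.Periodic.eq_cuspFunction one_ne_zero hper', heq z hz]

section
variable {Γ : Subgroup SL2R} {J g : ℂ → ℂ}

lemma add_one_mem_UH {z : ℂ} (hz : z ∈ UH) : z + 1 ∈ UH := by
  rw [mem_UH] at *; simpa using hz

lemma IsHaupt.eq_const (H : IsHaupt Γ J g) {G : ℂ → ℂ} (hd : DifferentiableOn ℂ G UH)
    (hinv : ∀ γ ∈ Γ, ∀ z ∈ UH, G (moebius γ z) = G z)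
    (hb : ∃ K : ℝ, ∀ᶠ z in imInf, ‖G z‖ ≤ K) : ∃ C, ∀ z ∈ UH, G z = C := by
  have hper : ∀ z ∈ UH, G (z + 1) = G z := fun z hz => by
    simpa using hinv _ H.transl_mem z hz
  obtain ⟨h, hh, hG⟩ := exists_cusp_function hd hper hb
  obtain ⟨c, hc, hfund⟩ := H.fund
  set ρ := Real.exp (-2 * Real.pi * c)
  have hρ : ρ < 1 := by
    rw [Real.exp_lt_one_iff]
    have := Real.pi_pos
    have := mul_pos this hc
    linarith
  have hsub : Metric.closedBall (0 : ℂ) ρ ⊆ Metric.ball 0 1 := Metric.closedBall_subset_ball hρ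
  obtain ⟨q₀, hq₀, hmax⟩ := (isCompact_closedBall (0 : ℂ) ρ).exists_isMaxOn
    ⟨0, Metric.mem_closedBall_self (Real.exp_pos _).le⟩ ((hh.continuousOn.mono hsub).norm)
  have hmax' : IsMaxOn (norm ∘ h) (Metric.ball 0 1) q₀ := by
    intro q hq
    change ‖h q‖ ≤ ‖h q₀‖
    rcases eq_or_ne q 0 with rfl | hq0
    · exact hmax (Metric.mem_closedBall_self (Real.exp_pos _).le)
    · obtain ⟨z, hz, rfl⟩ := exists_qc_eq hq0 (by simpa using hq)
      obtain ⟨γ, hγ, him⟩ := hfund z hz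
      rw [← hG z hz, ← hinv γ hγ z hz, hG _ (moebius_mem γ hz)]
      apply hmax
      rw [mem_closedBall_zero_iff, norm_qc]
      apply Real.exp_le_exp.2
      have := Real.pi_pos
      nlinarith
  have := Complex.eqOn_of_isPreconnected_of_isMaxOn_norm
    (convex_ball (0 : ℂ) 1).isPreconnected Metric.isOpen_ball hh (hsub hq₀) hmax'
  exact ⟨h q₀, fun z hz => by rw [hG z hz]; exact this (qc_mem_ball hz)⟩

lemma IsHaupt.continuousAt_g_zero (H : IsHaupt Γ J g) : ContinuousAt g 0 :=
  (H.gdiff.differentiableAt (Metric.ball_mem_nhds 0 one_pos)).continuousAt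

lemma IsHaupt.differentiableAt (H : IsHaupt Γ J g) {z : ℂ} (hz : z ∈ UH) :
    DifferentiableAt ℂ J z := H.diff.differentiableAt (isOpen_UH.mem_nhds hz)

lemma IsHaupt.exists_polynomial (H : IsHaupt Γ J g) (D : ℕ) : ∀ {F : ℂ → ℂ},
    DifferentiableOn ℂ F UH → (∀ γ ∈ Γ, ∀ z ∈ UH, F (moebius γ z) = F z) →
    (∃ K : ℝ, ∀ᶠ z in imInf, ‖F z * qc z ^ D‖ ≤ K) →
    ∃ Q : Polynomial ℂ, ∀ z ∈ UH, F z = Q.eval (J z) := by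
  induction D with
  | zero =>
    intro F hd hinv hb
    obtain ⟨C, hC⟩ := H.eq_const hd hinv (by simpa using hb)
    exact ⟨Polynomial.C C, fun z hz => by simpa using hC z hz⟩
  | succ D ih =>
    intro F hd hinv hb
    obtain ⟨h, hh, hF⟩ := exists_cusp_function (G := fun z => F z * qc z ^ (D + 1))
      (hd.mul (differentiable_qc.differentiableOn.pow _)) (fun z hz => by
        have h1 := hinv _ H.transl_mem z hz
        have h2 := qc_add_int z 1
        simp only [moebius_transl, Int.cast_one] at h1 h2
        rw [h1, h2]) hb
    set k : ℂ → ℂ := fun q => h q - h 0 * (1 + q * g q) ^ (D + 1) with hk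
    have hkd : DifferentiableOn ℂ k (Metric.ball 0 1) := by
      have := H.gdiff
      fun_prop
    have hk0 : k 0 = 0 := by simp [hk]
    have hkd' : DifferentiableOn ℂ (dslope k 0) (Metric.ball 0 1) :=
      (Complex.differentiableOn_dslope (Metric.ball_mem_nhds 0 one_pos)).2 hkd
    have hcont : ContinuousAt (dslope k 0) 0 :=
      (hkd'.differentiableAt (Metric.ball_mem_nhds 0 one_pos)).continuousAt
    obtain ⟨Q, hQ⟩ := ih (F := fun z => F z - h 0 * J z ^ (D + 1))
      (hd.sub ((H.diff.pow _).const_mul _))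
      (fun γ hγ z hz => by simp only [hinv γ hγ z hz, H.inv γ hγ z hz])
      (by
        refine ⟨‖dslope k 0 0‖ + 1, ?_⟩
        have h1 := (hcont.tendsto.comp qc_tendsto_zero).norm.eventually
          (gt_mem_nhds (lt_add_one ‖dslope k 0 0‖))
        filter_upwards [h1, eventually_imInf_UH] with z hz hzU
        have hq := qc_ne_zero z
        have e : (F z - h 0 * J z ^ (D + 1)) * qc z ^ D = dslope k 0 (qc z) := by
          rw [dslope_of_ne _ hq, slope_def_field, hk0, sub_zero, sub_zero, eq_div_iff hq]
          simp only [hk]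
          rw [← hF z hzU, H.qexp z hzU]
          have : (1 + qc z * g (qc z)) = qc z * ((qc z)⁻¹ + g (qc z)) := by field_simp
          rw [this, mul_pow]; ring
        rw [e]; exact hz.le)
    refine ⟨Q + Polynomial.C (h 0) * Polynomial.X ^ (D + 1), fun z hz => ?_⟩
    have := hQ z hz
    simp only [Polynomial.eval_add, Polynomial.eval_mul, Polynomial.eval_C, Polynomial.eval_pow,
      Polynomial.eval_X, ← this]
    ring

lemma IsHaupt.tendsto_mul_qc (H : IsHaupt Γ J g) :
    Tendsto (fun z => J z * qc z) imInf (𝓝 1) := by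
  have h1 : Tendsto (fun q => 1 + q * g q) (𝓝 0) (𝓝 (1 + 0 * g 0)) :=
    tendsto_const_nhds.add (tendsto_id.mul H.continuousAt_g_zero.tendsto)
  have h2 := h1.comp qc_tendsto_zero
  simp only [zero_mul, add_zero] at h2
  refine h2.congr' ?_
  filter_upwards [eventually_imInf_UH] with z hz
  have := qc_ne_zero z
  simp only [Function.comp, H.qexp z hz]; field_simp

lemma IsHaupt.tendsto_norm (H : IsHaupt Γ J g) : Tendsto (fun z => ‖J z‖) imInf atTop := by
  have h1 : Tendsto (fun z => ‖qc z‖⁻¹) imInf atTop :=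
    (tendsto_inv_nhdsGT_zero).comp ((tendsto_norm_nhdsNE_zero).comp qc_tendsto)
  have h2 := H.tendsto_mul_qc.norm.pos_mul_atTop (by simp) h1
  refine h2.congr fun z => ?_
  have := qc_ne_zero z
  rw [norm_mul]; field_simp

lemma IsHaupt.surjective (H : IsHaupt Γ J g) (x : ℂ) : ∃ z ∈ UH, J z = x := by
  by_contra hcon
  push Not at hcon
  have hne : ∀ z ∈ UH, J z - x ≠ 0 := fun z hz => sub_ne_zero.2 (hcon z hz)
  have ht : Tendsto (fun z => (J z - x)⁻¹) imInf (𝓝 0) := by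
    have h1 : Tendsto (fun z => ‖J z - x‖) imInf atTop := by
      refine tendsto_atTop_mono (fun z => norm_sub_norm_le (J z) x) ?_
      exact tendsto_atTop_add_const_right _ (-‖x‖) H.tendsto_norm
    exact tendsto_inv₀_cobounded.comp (tendsto_norm_atTop_iff_cobounded.1 h1)
  obtain ⟨C, hC⟩ := H.eq_const (G := fun z => (J z - x)⁻¹)
    ((H.diff.sub_const x).inv hne)
    (fun γ hγ z hz => by rw [H.inv γ hγ z hz])
    ⟨1, by
      have := ht.norm.eventually (gt_mem_nhds (show ‖(0 : ℂ)‖ < 1 by simp))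
      exact this.mono fun z hz => le_of_lt hz⟩
  have hC0 : C = 0 := by
    refine tendsto_nhds_unique (tendsto_const_nhds.congr' ?_) ht
    filter_upwards [eventually_imInf_UH] with z hz using (hC z hz).symm
  have h1 : (I : ℂ) ∈ UH := by simp [mem_UH]
  exact inv_ne_zero (hne I h1) ((hC I h1).trans hC0)

end

end FrickeTrace

namespace FrickeTrace

open Filter Topology

/-- `Γ`-equivalence of two points. -/
def OrbitEquiv (Γ : Subgroup SL2R) (z w : ℂ) : Prop := ∃ γ ∈ Γ, moebius γ z = w

lemma OrbitEquiv.symm {Γ : Subgroup SL2R} {z w : ℂ} (hz : z ∈ UH) (h : OrbitEquiv Γ z w) :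
    OrbitEquiv Γ w z := by
  obtain ⟨γ, hγ, rfl⟩ := h
  exact ⟨γ⁻¹, Γ.inv_mem hγ, moebius_inv_eq γ hz rfl⟩

lemma OrbitEquiv.trans {Γ : Subgroup SL2R} {z w v : ℂ} (hz : z ∈ UH) (h : OrbitEquiv Γ z w)
    (h' : OrbitEquiv Γ w v) : OrbitEquiv Γ z v := by
  obtain ⟨γ, hγ, rfl⟩ := h
  obtain ⟨δ, hδ, rfl⟩ := h'
  exact ⟨δ * γ, Γ.mul_mem hδ hγ, moebius_mul δ γ hz⟩

lemma analyticOnNhd_UH {f : ℂ → ℂ} (hf : DifferentiableOn ℂ f UH) : AnalyticOnNhd ℂ f UH :=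
  hf.analyticOnNhd isOpen_UH

lemma countable_zeros {f : ℂ → ℂ} (hf : DifferentiableOn ℂ f UH) (hne : ∃ z ∈ UH, f z ≠ 0) :
    {z | z ∈ UH ∧ f z = 0}.Countable := by
  apply (HereditarilyLindelofSpace.isLindelof _).countable
  rw [discreteTopology_subtype_iff]
  rintro z ⟨hz, -⟩
  have han := analyticOnNhd_UH hf
  rcases (han z hz).eventually_eq_zero_or_eventually_ne_zero with h | h
  · obtain ⟨w, hw, hw0⟩ := hne
    exact absurd (han.eqOn_zero_of_preconnected_of_eventuallyEq_zero isPreconnected_UH hz h hw) hw0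
  · rw [← _root_.disjoint_iff, Filter.disjoint_principal_right]
    filter_upwards [h] with w hw hw'
    exact hw hw'.2

section
variable {Γ : Subgroup SL2R} {J g : ℂ → ℂ}

lemma IsHaupt.not_const (H : IsHaupt Γ J g) : ¬ ∃ C, ∀ z ∈ UH, J z = C := by
  rintro ⟨C, hC⟩
  obtain ⟨z, hz, h⟩ := H.surjective (C + 1)
  rw [hC z hz] at h
  simp at h

lemma IsHaupt.isOpen_image (H : IsHaupt Γ J g) : ∀ s ⊆ UH, IsOpen s → IsOpen (J '' s) :=
  ((analyticOnNhd_UH H.diff).is_constant_or_isOpen isPreconnected_UH).resolve_left H.not_const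

lemma IsHaupt.exists_deriv_ne_zero (H : IsHaupt Γ J g) : ∃ z ∈ UH, deriv J z ≠ 0 := by
  by_contra hcon
  push Not at hcon
  apply H.not_const
  have h1 : (I : ℂ) ∈ UH := by simp [mem_UH]
  exact ⟨J I, fun z hz =>
    isOpen_UH.is_const_of_deriv_eq_zero isPreconnected_UH H.diff hcon hz h1⟩

/-- Values of `J` taken at two inequivalent points. -/
def badValues (Γ : Subgroup SL2R) (J : ℂ → ℂ) : Set ℂ :=
  {x | ∃ z ∈ UH, ∃ w ∈ UH, J z = x ∧ J w = x ∧ ¬ OrbitEquiv Γ z w}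

lemma IsHaupt.eventually_not_orbitEquiv (H : IsHaupt Γ J g) {z w : ℂ} (hz : z ∈ UH) (hw : w ∈ UH)
    (h : ¬ OrbitEquiv Γ z w) : ∀ᶠ u in 𝓝 (z, w), ¬ OrbitEquiv Γ u.1 u.2 := by
  classical
  obtain ⟨s, hs, hdisc⟩ := H.discrete
  by_contra hcon
  have hfreq : ∃ᶠ u in 𝓝 (z, w), OrbitEquiv Γ u.1 u.2 := hcon
  set l := 𝓝 (z, w) ⊓ 𝓟 {u : ℂ × ℂ | OrbitEquiv Γ u.1 u.2}
  have : l.NeBot := Filter.frequently_mem_iff_neBot.1 hfreq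
  set γ : ℂ × ℂ → SL2R := fun u => if h : OrbitEquiv Γ u.1 u.2 then h.choose else 1 with hγdef
  have hγ : ∀ u, γ u ∈ Γ := by
    intro u
    simp only [hγdef]
    split_ifs with h
    · exact h.choose_spec.1
    · exact Γ.one_mem
  have h1 : Tendsto (fun u : ℂ × ℂ => u.1) l (𝓝 z) :=
    (continuous_fst.tendsto (z, w)).mono_left inf_le_left
  have h2 : Tendsto (fun u : ℂ × ℂ => moebius (γ u) u.1) l (𝓝 w) := by
    have h3 : Tendsto (fun u : ℂ × ℂ => u.2) l (𝓝 w) :=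
      (continuous_snd.tendsto (z, w)).mono_left inf_le_left
    refine h3.congr' ?_
    have : ∀ᶠ u in l, u ∈ {u : ℂ × ℂ | OrbitEquiv Γ u.1 u.2} :=
      Filter.mem_inf_of_right (Filter.mem_principal_self _)
    filter_upwards [this] with u hu
    have hu' : OrbitEquiv Γ u.1 u.2 := hu
    simp only [hγdef, dif_pos hu']
    exact hu'.choose_spec.2.symm
  obtain ⟨δ, hδ, hδz, -⟩ := exists_frequently_eq hs hdisc hz hw hγ h1 h2
  exact h ⟨δ, hδ, hδz⟩

lemma IsHaupt.isOpen_badValues (H : IsHaupt Γ J g) : IsOpen (badValues Γ J) := by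
  rw [isOpen_iff_mem_nhds]
  rintro x ⟨z, hz, w, hw, hzx, hwx, hne⟩
  have h := H.eventually_not_orbitEquiv hz hw hne
  rw [nhds_prod_eq] at h
  obtain ⟨U, hU, V, hV, hUV⟩ := Filter.mem_prod_iff.1 h
  obtain ⟨U', hU', hU'o, hzU'⟩ := mem_nhds_iff.1 (Filter.inter_mem hU (isOpen_UH.mem_nhds hz))
  obtain ⟨V', hV', hV'o, hwV'⟩ := mem_nhds_iff.1 (Filter.inter_mem hV (isOpen_UH.mem_nhds hw))
  have o1 := H.isOpen_image U' (fun u hu => (hU' hu).2) hU'o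
  have o2 := H.isOpen_image V' (fun u hu => (hV' hu).2) hV'o
  filter_upwards [o1.mem_nhds ⟨z, hzU', hzx⟩, o2.mem_nhds ⟨w, hwV', hwx⟩]
  rintro y ⟨u, hu, rfl⟩ ⟨v, hv, hvu⟩
  exact ⟨u, (hU' hu).2, v, (hV' hv).2, rfl, hvu,
    hUV (show (u, v) ∈ U ×ˢ V from ⟨(hU' hu).1, (hV' hv).1⟩)⟩

/-- Every point is equivalent to one with `|Re| ≤ 1/2` and `Im ≥ c`. -/
lemma IsHaupt.exists_reduced (H : IsHaupt Γ J g) :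
    ∃ c : ℝ, 0 < c ∧ ∀ z ∈ UH, ∃ w, OrbitEquiv Γ z w ∧ c ≤ w.im ∧ |w.re| ≤ 1 / 2 := by
  obtain ⟨c, hc, h⟩ := H.fund
  refine ⟨c, hc, fun z hz => ?_⟩
  obtain ⟨γ, hγ, him⟩ := h z hz
  have hT := transl_int_mem H.transl_mem
  set v := moebius γ z
  refine ⟨v + ((-round v.re : ℤ) : ℂ), ?_, ?_, ?_⟩
  · exact OrbitEquiv.trans hz ⟨γ, hγ, rfl⟩ ⟨transl _, hT _, moebius_transl _ _⟩
  · simpa using him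
  · have := abs_sub_round v.re
    simpa [sub_eq_add_neg] using this

lemma isCompact_strip (c C : ℝ) : IsCompact {z : ℂ | |z.re| ≤ 1 / 2 ∧ c ≤ z.im ∧ z.im ≤ C} := by
  have : {z : ℂ | |z.re| ≤ 1 / 2 ∧ c ≤ z.im ∧ z.im ≤ C} =
      Set.Icc (-(1 / 2) : ℝ) (1 / 2) ×ℂ Set.Icc c C := by
    ext z
    simp [Complex.mem_reProdIm, abs_le]
  rw [this]
  exact isCompact_Icc.reProdIm isCompact_Icc

lemma OrbitEquiv.apply_eq (H : IsHaupt Γ J g) {z w : ℂ} (hz : z ∈ UH) (h : OrbitEquiv Γ z w) :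
    J w = J z := by
  obtain ⟨γ, hγ, rfl⟩ := h
  exact H.inv γ hγ z hz

lemma OrbitEquiv.mem_UH {z w : ℂ} (hz : z ∈ UH) (h : OrbitEquiv Γ z w) : w ∈ UH := by
  obtain ⟨γ, hγ, rfl⟩ := h
  exact moebius_mem γ hz

lemma IsHaupt.hasStrictDerivAt (H : IsHaupt Γ J g) {z : ℂ} (hz : z ∈ UH) :
    HasStrictDerivAt J (deriv J z) z :=
  (analyticOnNhd_UH H.diff z hz).hasStrictDerivAt

lemma IsHaupt.mem_badValues_of_closure (H : IsHaupt Γ J g) {x : ℂ}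
    (hx : x ∈ closure (badValues Γ J)) (hV : ∀ z ∈ UH, J z = x → deriv J z ≠ 0) :
    x ∈ badValues Γ J := by
  classical
  obtain ⟨c, hc, hred⟩ := H.exists_reduced
  obtain ⟨C, hC⟩ : ∃ C : ℝ, ∀ z : ℂ, C < z.im → ‖x‖ + 1 < ‖J z‖ := by
    have := H.tendsto_norm.eventually (eventually_gt_atTop (‖x‖ + 1))
    obtain ⟨s, hs, hsub⟩ := Filter.mem_comap.1 this
    obtain ⟨C, hC⟩ := Filter.mem_atTop_sets.1 hs
    exact ⟨C, fun z hz => hsub (hC _ hz.le)⟩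
  set K := {z : ℂ | |z.re| ≤ 1 / 2 ∧ c ≤ z.im ∧ z.im ≤ C} with hK
  have hKU : ∀ z ∈ K, z ∈ UH := fun z hz => hc.trans_le hz.2.1
  have hpick : ∀ y ∈ badValues Γ J ∩ Metric.ball x 1, ∃ u : ℂ × ℂ, u.1 ∈ K ∧ u.2 ∈ K ∧
      J u.1 = y ∧ J u.2 = y ∧ ¬ OrbitEquiv Γ u.1 u.2 := by
    rintro y ⟨⟨z, hz, w, hw, hzy, hwy, hne⟩, hy⟩
    obtain ⟨z', e1, i1, r1⟩ := hred z hz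
    obtain ⟨w', e2, i2, r2⟩ := hred w hw
    have hy' : ‖y‖ ≤ ‖x‖ + 1 := by
      have h1 : ‖y - x‖ < 1 := by simpa [dist_eq_norm] using hy
      have h2 := norm_sub_norm_le y x
      linarith
    have a1 := OrbitEquiv.apply_eq H hz e1
    have a2 := OrbitEquiv.apply_eq H hw e2
    have bound : ∀ v : ℂ, J v = y → v.im ≤ C := by
      intro v hv
      by_contra hcon
      have := hC v (not_le.1 hcon)
      rw [hv] at this
      linarith
    refine ⟨(z', w'), ⟨r1, i1, bound _ (a1.trans hzy)⟩, ⟨r2, i2, bound _ (a2.trans hwy)⟩,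
      a1.trans hzy, a2.trans hwy, fun he => hne ?_⟩
    exact OrbitEquiv.trans hz e1
      (OrbitEquiv.trans (e1.mem_UH hz) he (e2.symm hw))
  have : (𝓝 x ⊓ 𝓟 (badValues Γ J)).NeBot := mem_closure_iff_clusterPt.1 hx
  set l := Ultrafilter.of (𝓝 x ⊓ 𝓟 (badValues Γ J))
  have hl : (l : Filter ℂ) ≤ 𝓝 x ⊓ 𝓟 (badValues Γ J) := Ultrafilter.of_le _
  have hmem : ∀ᶠ y in (l : Filter ℂ), y ∈ badValues Γ J ∩ Metric.ball x 1 := by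
    refine hl (Filter.inter_mem (Filter.mem_inf_of_right (Filter.mem_principal_self _))
      (Filter.mem_inf_of_left (Metric.ball_mem_nhds x one_pos)))
  set u : ℂ → ℂ × ℂ := fun y => if h : y ∈ badValues Γ J ∩ Metric.ball x 1 then
    (hpick y h).choose else (0, 0) with hu
  have hspec : ∀ᶠ y in (l : Filter ℂ), (u y).1 ∈ K ∧ (u y).2 ∈ K ∧
      J (u y).1 = y ∧ J (u y).2 = y ∧ ¬ OrbitEquiv Γ (u y).1 (u y).2 := by
    filter_upwards [hmem] with y hy
    simp only [hu, dif_pos hy]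
    exact (hpick y hy).choose_spec
  have hcpt := isCompact_strip c C
  obtain ⟨z, hzK, hz⟩ := hcpt.ultrafilter_le_nhds (l.map fun y => (u y).1)
    (Filter.le_principal_iff.2 (hspec.mono fun y hy => hy.1))
  obtain ⟨w, hwK, hw⟩ := hcpt.ultrafilter_le_nhds (l.map fun y => (u y).2)
    (Filter.le_principal_iff.2 (hspec.mono fun y hy => hy.2.1))
  have tz : Tendsto (fun y => (u y).1) l (𝓝 z) := hz
  have tw : Tendsto (fun y => (u y).2) l (𝓝 w) := hw
  have tx : Tendsto (fun y : ℂ => y) l (𝓝 x) := hl.trans inf_le_left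
  have hzU := hKU z hzK
  have hwU := hKU w hwK
  have hJz : J z = x := tendsto_nhds_unique
    (((H.differentiableAt hzU).continuousAt.tendsto.comp tz).congr'
      (hspec.mono fun y hy => hy.2.2.1)) tx
  have hJw : J w = x := tendsto_nhds_unique
    (((H.differentiableAt hwU).continuousAt.tendsto.comp tw).congr'
      (hspec.mono fun y hy => hy.2.2.2.1)) tx
  refine ⟨z, hzU, w, hwU, hJz, hJw, ?_⟩
  rintro ⟨γ, hγ, hγz⟩
  have hz' : moebius γ⁻¹ w = z := moebius_inv_eq γ hzU hγz
  have tw' : Tendsto (fun y => moebius γ⁻¹ (u y).2) l (𝓝 z) := by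
    have := (continuousAt_moebius γ⁻¹ hwU).tendsto.comp tw
    rwa [hz'] at this
  have hli := (H.hasStrictDerivAt hzU).eventually_left_inverse (hV z hzU hJz)
  obtain ⟨y, hy, h1, h2⟩ := (hspec.and ((tz.eventually hli).and (tw'.eventually hli))).exists
  obtain ⟨y1, y2, y3, y4, y5⟩ := hy
  have e : moebius γ⁻¹ (u y).2 = (u y).1 := by
    rw [← h1, ← h2, H.inv _ (Γ.inv_mem hγ) _ (hKU _ y2), y3, y4]
  apply y5
  exact ⟨γ, hγ, by simpa using moebius_inv_eq γ⁻¹ (hKU _ y2) e⟩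

lemma IsHaupt.exists_norm_bound (H : IsHaupt Γ J g) :
    ∃ R : ℝ, ∀ x ∈ badValues Γ J, ‖x‖ ≤ R := by
  obtain ⟨c, hc, hred⟩ := H.exists_reduced
  set k : ℂ → ℂ := fun q => q / (1 + q * g q) with hk
  have hgan : AnalyticAt ℂ g 0 :=
    H.gdiff.analyticAt (Metric.ball_mem_nhds 0 one_pos)
  have hk' : HasStrictDerivAt k 1 0 := by
    have han : AnalyticAt ℂ k 0 := by
      refine analyticAt_id.div (analyticAt_const.add (analyticAt_id.mul hgan)) (by simp)
    have hd : HasDerivAt k 1 0 := by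
      have h1 : HasDerivAt (fun q : ℂ => 1 + q * g q) (1 * g 0 + 0 * deriv g 0) 0 :=
        ((hasDerivAt_id (0 : ℂ)).mul hgan.differentiableAt.hasDerivAt).const_add 1
      have h2 := (hasDerivAt_id (0 : ℂ)).div h1 (by simp)
      have e : (1 * (1 + (0 : ℂ) * g 0) - id 0 * (1 * g 0 + 0 * deriv g 0)) /
          (1 + (0 : ℂ) * g 0) ^ 2 = 1 := by simp
      rw [e] at h2
      exact h2
    have := han.hasStrictDerivAt
    rwa [hd.deriv] at this
  have hinj := hk'.eventually_left_inverse one_ne_zero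
  obtain ⟨s, hs, hsub⟩ := Filter.mem_comap.1 (qc_tendsto_zero.eventually hinj)
  obtain ⟨C, hC⟩ := Filter.mem_atTop_sets.1 hs
  have hinj' : ∀ z : ℂ, C ≤ z.im → hk'.localInverse k 1 0 one_ne_zero (k (qc z)) = qc z :=
    fun z hz => hsub (hC _ hz)
  obtain ⟨R, hR⟩ := ((isCompact_strip c C).image_of_continuousOn
    ((H.diff.continuousOn.mono fun z hz => hc.trans_le hz.2.1))).isBounded.exists_norm_le
  refine ⟨R, ?_⟩
  rintro x ⟨z, hz, w, hw, hzx, hwx, hne⟩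
  by_contra hcon
  obtain ⟨z', e1, i1, r1⟩ := hred z hz
  obtain ⟨w', e2, i2, r2⟩ := hred w hw
  have a1 := (OrbitEquiv.apply_eq H hz e1).trans hzx
  have a2 := (OrbitEquiv.apply_eq H hw e2).trans hwx
  have him : ∀ v : ℂ, J v = x → c ≤ v.im → |v.re| ≤ 1 / 2 → C ≤ v.im := by
    intro v hv h1 h2
    by_contra h3
    exact hcon (hv ▸ hR _ ⟨v, ⟨h2, h1, (not_le.1 h3).le⟩, rfl⟩)
  have hkJ : ∀ v ∈ UH, k (qc v) = (J v)⁻¹ := by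
    intro v hv
    have := qc_ne_zero v
    rw [H.qexp v hv, hk]
    have e : (qc v)⁻¹ + g (qc v) = (1 + qc v * g (qc v)) / qc v := by field_simp
    rw [e, inv_div]
  have hzU' := e1.mem_UH hz
  have hwU' := e2.mem_UH hw
  have hqq : qc z' = qc w' := by
    rw [← hinj' z' (him z' a1 i1 r1), ← hinj' w' (him w' a2 i2 r2), hkJ z' hzU', hkJ w' hwU',
      a1, a2]
  obtain ⟨m, hm⟩ := Complex.exp_eq_exp_iff_exists_int.1 hqq
  have hzw : z' = w' + m := by
    have h2 : (2 * Real.pi * I : ℂ) ≠ 0 := Complex.two_pi_I_ne_zero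
    have : (2 * Real.pi * I) * z' = (2 * Real.pi * I) * (w' + m) := by rw [hm]; ring
    exact mul_left_cancel₀ h2 this
  have : OrbitEquiv Γ w' z' := 
    ⟨transl m, transl_int_mem H.transl_mem m, by rw [moebius_transl, hzw]⟩
  exact hne (e1.trans hz ((this.symm hwU').trans hzU' (e2.symm hw)))

/-- A Hauptmodul separates orbits. -/
lemma IsHaupt.orbitEquiv_of_eq (H : IsHaupt Γ J g) {z w : ℂ} (hz : z ∈ UH) (hw : w ∈ UH)
    (h : J z = J w) : OrbitEquiv Γ z w := by
  set V : Set ℂ := J '' {z | z ∈ UH ∧ deriv J z = 0} with hV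
  have hVc : V.Countable :=
    (countable_zeros (H.diff.deriv isOpen_UH) H.exists_deriv_ne_zero).image _
  have hdense : Dense Vᶜ := hVc.dense_compl ℂ
  have hconn : IsPreconnected Vᶜ :=
    (hVc.isConnected_compl_of_one_lt_rank (by simp [Complex.rank_real_complex])).isPreconnected
  have hempty : Vᶜ ⊆ (closure (badValues Γ J))ᶜ := by
    have hcov : Vᶜ ⊆ badValues Γ J ∪ (closure (badValues Γ J))ᶜ := by
      intro x hx
      by_cases hxc : x ∈ closure (badValues Γ J)
      · left
        exact H.mem_badValues_of_closure hxc fun z hz hzx h0 => hx ⟨z, ⟨hz, h0⟩, hzx⟩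
      · exact Or.inr hxc
    refine (hconn.subset_or_subset H.isOpen_badValues isClosed_closure.isOpen_compl
      ?_ hcov).resolve_left ?_
    · exact Set.disjoint_left.2 fun x h1 h2 => h2 (subset_closure h1)
    · intro hsub
      obtain ⟨R, hR⟩ := H.exists_norm_bound
      have hopen : IsOpen {x : ℂ | R < ‖x‖} := isOpen_lt continuous_const continuous_norm
      obtain ⟨x, hx, hxV⟩ := hdense.inter_open_nonempty _ hopen
        ⟨((|R| + 1 : ℝ) : ℂ), by
          have := le_abs_self R
          change R < ‖((|R| + 1 : ℝ) : ℂ)‖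
          rw [Complex.norm_real, Real.norm_eq_abs, abs_of_pos (by positivity)]; linarith⟩
      exact absurd (hR x (hsub hxV)) (not_le.2 hx)
  by_contra hne
  obtain ⟨x, hx, hxV⟩ := hdense.inter_open_nonempty _ H.isOpen_badValues
    ⟨J z, z, hz, w, hw, rfl, h.symm, hne⟩
  exact hempty hxV (subset_closure hx)

end

end FrickeTrace

namespace FrickeTrace

open Filter Topology

lemma exists_analytic_root {u : ℂ → ℂ} {z₀ : ℂ} (hu : AnalyticAt ℂ u z₀) (h0 : u z₀ ≠ 0) {e : ℕ}
    (he : e ≠ 0) : ∃ v : ℂ → ℂ, AnalyticAt ℂ v z₀ ∧ v z₀ ≠ 0 ∧ ∀ᶠ z in 𝓝 z₀, u z = v z ^ e := by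
  obtain ⟨c, hc⟩ := IsAlgClosed.exists_pow_nat_eq (u z₀) (Nat.pos_of_ne_zero he)
  have hc0 : c ≠ 0 := by
    rintro rfl
    rw [zero_pow he] at hc
    exact h0 hc.symm
  have hq : AnalyticAt ℂ (fun z => u z / u z₀) z₀ := hu.div_const
  have hslit : u z₀ / u z₀ ∈ Complex.slitPlane := by
    rw [div_self h0]; exact Complex.one_mem_slitPlane
  refine ⟨fun z => c * Complex.exp (Complex.log (u z / u z₀) / e), ?_, ?_, ?_⟩
  · exact analyticAt_const.mul ((hq.clog hslit).div_const.cexp)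
  · exact mul_ne_zero hc0 (Complex.exp_ne_zero _)
  · have : ∀ᶠ z in 𝓝 z₀, u z ≠ 0 := hu.continuousAt.eventually_ne h0
    filter_upwards [this] with z hz
    rw [mul_pow, hc, ← Complex.exp_nat_mul, mul_div_cancel₀ _ (Nat.cast_ne_zero.2 he),
      Complex.exp_log (div_ne_zero hz h0), mul_div_cancel₀ _ h0]

lemma exists_local_coordinate {f : ℂ → ℂ} {z₀ : ℂ} (hf : AnalyticAt ℂ f z₀) {e : ℕ} (he : e ≠ 0)
    (ho : analyticOrderAt f z₀ = e) :
    ∃ ψ : ℂ → ℂ, AnalyticAt ℂ ψ z₀ ∧ ψ z₀ = 0 ∧ deriv ψ z₀ ≠ 0 ∧ ∀ᶠ z in 𝓝 z₀, f z = ψ z ^ e := by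
  obtain ⟨u, hu, hu0, hfu⟩ := (hf.analyticOrderAt_eq_natCast).1 ho
  obtain ⟨v, hv, hv0, huv⟩ := exists_analytic_root hu hu0 he
  have hid : AnalyticAt ℂ (fun z : ℂ => z - z₀) z₀ := by fun_prop
  refine ⟨fun z => (z - z₀) * v z, hid.mul hv, by simp, ?_, ?_⟩
  · have h1 : HasDerivAt (fun z : ℂ => z - z₀) 1 z₀ := (hasDerivAt_id z₀).sub_const z₀
    have h2 := h1.mul hv.differentiableAt.hasDerivAt
    have h3 : deriv (fun z => (z - z₀) * v z) z₀ = v z₀ := by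
      have := h2.deriv
      simp only [sub_self, zero_mul, one_mul, add_zero] at this
      exact this
    rw [h3]
    exact hv0
  · filter_upwards [hfu, huv] with z h1 h2
    rw [h1, h2, mul_pow, smul_eq_mul]

lemma analyticAt_dslope {f : ℂ → ℂ} {z₀ : ℂ} (hf : AnalyticAt ℂ f z₀) :
    AnalyticAt ℂ (dslope f z₀) z₀ := by
  obtain ⟨p, hp⟩ := hf
  exact hp.has_fpower_series_dslope_fslope.analyticAt

lemma eq_mul_dslope {f : ℂ → ℂ} {z₀ : ℂ} (h : f z₀ = 0) (z : ℂ) :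
    f z = (z - z₀) * dslope f z₀ z := by
  have := sub_smul_dslope f z₀ z
  rw [smul_eq_mul, h, sub_zero] at this
  exact this.symm

section
variable {Γ : Subgroup SL2R} {J g : ℂ → ℂ}

/-- The ramification index of `J` at `z`. -/
noncomputable def ram (J : ℂ → ℂ) (z : ℂ) : ℕ := analyticOrderNatAt (fun w => J w - J z) z

lemma IsHaupt.analyticAt (H : IsHaupt Γ J g) {z : ℂ} (hz : z ∈ UH) : AnalyticAt ℂ J z :=
  analyticOnNhd_UH H.diff z hz

lemma IsHaupt.order_eq_ram (H : IsHaupt Γ J g) {z : ℂ} (hz : z ∈ UH) :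
    analyticOrderAt (fun w => J w - J z) z = ram J z := by
  refine (Nat.cast_analyticOrderNatAt ?_).symm
  rw [Ne, analyticOrderAt_eq_top]
  intro h
  apply H.not_const
  refine ⟨J z, fun w hw => ?_⟩
  have han : AnalyticOnNhd ℂ (fun w => J w - J z) UH :=
    fun w hw => (H.analyticAt hw).sub analyticAt_const
  exact sub_eq_zero.1 (han.eqOn_zero_of_preconnected_of_eventuallyEq_zero isPreconnected_UH hz h hw)

lemma IsHaupt.ram_ne_zero (H : IsHaupt Γ J g) {z : ℂ} (hz : z ∈ UH) : ram J z ≠ 0 := by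
  intro h
  have h1 := H.order_eq_ram hz
  have h2 : AnalyticAt ℂ (fun w => J w - J z) z := (H.analyticAt hz).sub analyticAt_const
  rw [h, Nat.cast_zero, h2.analyticOrderAt_eq_zero] at h1
  exact h1 (sub_self _)

lemma IsHaupt.exists_coordinate (H : IsHaupt Γ J g) {z₀ : ℂ} (hz : z₀ ∈ UH) :
    ∃ ψ : ℂ → ℂ, AnalyticAt ℂ ψ z₀ ∧ ψ z₀ = 0 ∧ deriv ψ z₀ ≠ 0 ∧
      ∀ᶠ z in 𝓝 z₀, J z - J z₀ = ψ z ^ ram J z₀ :=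
  exists_local_coordinate ((H.analyticAt hz).sub analyticAt_const) (H.ram_ne_zero hz)
    (H.order_eq_ram hz)

lemma analyticAt_moebius (γ : SL2R) {z : ℂ} (hz : z ∈ UH) : AnalyticAt ℂ (moebius γ) z :=
  analyticOnNhd_UH (differentiableOn_moebius γ) z hz

lemma IsHaupt.exists_stab_of_pow_eq_one (H : IsHaupt Γ J g) {z₀ : ℂ} (hz : z₀ ∈ UH) {ζ : ℂ}
    (hζ : ζ ^ ram J z₀ = 1) : ∃ γ ∈ Γ, moebius γ z₀ = z₀ ∧ 1 / den γ z₀ ^ 2 = ζ := by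
  classical
  obtain ⟨ψ, hψ, hψ0, hψ', hJ⟩ := H.exists_coordinate hz
  have hst := hψ.hasStrictDerivAt
  set φ := hst.localInverse ψ (deriv ψ z₀) z₀ hψ' with hφ
  have hφd : HasStrictDerivAt φ (deriv ψ z₀)⁻¹ 0 := by
    have := hst.to_localInverse hψ'
    rw [hψ0] at this
    exact this
  have hφr : ∀ᶠ y in 𝓝 (0 : ℂ), ψ (φ y) = y := by
    have := hst.hasStrictFDerivAt_equiv hψ'
    have := this.eventually_right_inverse
    rw [hψ0] at this
    exact this
  have hφ0 : φ 0 = z₀ := by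
    have := (hst.hasStrictFDerivAt_equiv hψ').localInverse_apply_image
    rw [hψ0] at this
    exact this
  set w : ℂ → ℂ := fun z => φ (ζ * ψ z) with hw
  have hwd : HasDerivAt w ζ z₀ := by
    have h1 : HasDerivAt (fun z => ζ * ψ z) (ζ * deriv ψ z₀) z₀ :=
      hψ.differentiableAt.hasDerivAt.const_mul ζ
    have h2 : HasDerivAt φ (deriv ψ z₀)⁻¹ (ζ * ψ z₀) := by
      rw [hψ0, mul_zero]; exact hφd.hasDerivAt
    have h3 := h2.comp z₀ h1
    have h4 : (deriv ψ z₀)⁻¹ * (ζ * deriv ψ z₀) = ζ := by field_simp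
    rw [h4] at h3
    exact h3
  have hw0 : w z₀ = z₀ := by simp only [hw, hψ0, mul_zero, hφ0]
  have hwt : Tendsto w (𝓝 z₀) (𝓝 z₀) := by
    have := hwd.continuousAt
    rw [ContinuousAt, hw0] at this
    exact this
  have hψw : ∀ᶠ z in 𝓝 z₀, ψ (w z) = ζ * ψ z := by
    have h1 : Tendsto (fun z => ζ * ψ z) (𝓝 z₀) (𝓝 0) := by
      have := (hψ.continuousAt.tendsto).const_mul ζ
      rw [hψ0, mul_zero] at this
      exact this
    exact h1.eventually hφr
  have horb : ∀ᶠ z in 𝓝 z₀, OrbitEquiv Γ z (w z) := by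
    filter_upwards [hJ, hwt.eventually hJ, hψw, isOpen_UH.mem_nhds hz,
      hwt.eventually (isOpen_UH.mem_nhds hz)] with z h1 h2 h3 h4 h5
    refine H.orbitEquiv_of_eq h4 h5 ?_
    have : J z - J z₀ = J (w z) - J z₀ := by rw [h1, h2, h3, mul_pow, hζ, one_mul]
    exact sub_left_injective this
  set γ : ℂ → SL2R := fun u => if h : OrbitEquiv Γ u (w u) then h.choose else 1 with hγdef
  have hγ : ∀ u, γ u ∈ Γ := by
    intro u
    simp only [hγdef]
    split_ifs with h
    · exact h.choose_spec.1
    · exact Γ.one_mem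
  have hγw : ∀ᶠ u in 𝓝[≠] z₀, moebius (γ u) u = w u := by
    filter_upwards [horb.filter_mono nhdsWithin_le_nhds] with u hu
    simp only [hγdef, dif_pos hu]
    exact hu.choose_spec.2
  obtain ⟨s, hs, hdisc⟩ := H.discrete
  obtain ⟨δ, hδ, hδz, hfreq⟩ := exists_frequently_eq (l := 𝓝[≠] z₀) (z := fun u => u) hs hdisc hz hz hγ
    (tendsto_id.mono_left nhdsWithin_le_nhds)
    (((hwt.mono_left nhdsWithin_le_nhds)).congr' (hγw.mono fun u hu => hu.symm))
  refine ⟨δ, hδ, hδz, ?_⟩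
  have hfr : ∃ᶠ u in 𝓝[≠] z₀, ψ (moebius δ u) = ζ * ψ u := by
    refine (hfreq.and_eventually (hγw.and (hψw.filter_mono nhdsWithin_le_nhds))).mono ?_
    rintro u ⟨h1, h2, h3⟩
    rw [← h1, h2, h3]
  have hψδ : AnalyticAt ℂ ψ (moebius δ z₀) := by rw [hδz]; exact hψ
  have ha : AnalyticAt ℂ (fun u => ψ (moebius δ u)) z₀ := hψδ.comp (analyticAt_moebius δ hz)
  have hev := (ha.frequently_eq_iff_eventually_eq (analyticAt_const.mul hψ)).1 hfr
  have hd1 : deriv (fun u => ψ (moebius δ u)) z₀ = deriv ψ z₀ * (1 / den δ z₀ ^ 2) := by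
    have h2 : HasDerivAt ψ (deriv ψ z₀) (moebius δ z₀) := by
      rw [hδz]; exact hψ.differentiableAt.hasDerivAt
    exact (h2.comp z₀ (hasDerivAt_moebius δ hz)).deriv
  have hd2 : deriv (fun u => ζ * ψ u) z₀ = ζ * deriv ψ z₀ :=
    (hψ.differentiableAt.hasDerivAt.const_mul ζ).deriv
  have := Filter.EventuallyEq.deriv_eq hev
  change deriv (fun u => ψ (moebius δ u)) z₀ = deriv (fun u => ζ * ψ u) z₀ at this
  rw [hd1, hd2, mul_comm] at this
  exact mul_right_cancel₀ hψ' this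

end

end FrickeTrace

namespace FrickeTrace

open Filter Topology

section
variable {Γ : Subgroup SL2R} {J g : ℂ → ℂ}

lemma IsHaupt.exists_sub_eq_pow_mul (H : IsHaupt Γ J g) {z₀ : ℂ} (hz : z₀ ∈ UH) {N : SL2R}
    (hN : moebius N z₀ = z₀) : ∃ V : ℂ → ℂ, AnalyticAt ℂ V z₀ ∧
      (∀ᶠ z in 𝓝 z₀, J (moebius N z) - J z = (z - z₀) ^ ram J z₀ * V z) ∧
      (V z₀ = 0 ↔ (1 / den N z₀ ^ 2) ^ ram J z₀ = 1) := by
  obtain ⟨ψ, hψ, hψ0, hψ', hJ⟩ := H.exists_coordinate hz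
  have hψN : AnalyticAt ℂ ψ (moebius N z₀) := by rw [hN]; exact hψ
  have ha : AnalyticAt ℂ (fun u => ψ (moebius N u)) z₀ := hψN.comp (analyticAt_moebius N hz)
  have hd1 : deriv (fun u => ψ (moebius N u)) z₀ = deriv ψ z₀ * (1 / den N z₀ ^ 2) := by
    have h2 : HasDerivAt ψ (deriv ψ z₀) (moebius N z₀) := by
      rw [hN]; exact hψ.differentiableAt.hasDerivAt
    exact (h2.comp z₀ (hasDerivAt_moebius N hz)).deriv
  have hNt : Tendsto (moebius N) (𝓝 z₀) (𝓝 z₀) := by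
    have := continuousAt_moebius N hz
    rw [ContinuousAt, hN] at this
    exact this
  refine ⟨fun z => dslope (fun u => ψ (moebius N u)) z₀ z ^ ram J z₀ - dslope ψ z₀ z ^ ram J z₀,
    ((analyticAt_dslope ha).pow _).sub ((analyticAt_dslope hψ).pow _), ?_, ?_⟩
  · filter_upwards [hJ, hNt.eventually hJ] with z h1 h2
    have e1 := eq_mul_dslope hψ0 z
    have e2 := eq_mul_dslope (f := fun u => ψ (moebius N u)) (z₀ := z₀) (by simp only [hN, hψ0]) z
    have e3 : J (moebius N z) - J z = ψ (moebius N z) ^ ram J z₀ - ψ z ^ ram J z₀ := by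
      rw [← h1, ← h2]; ring
    rw [e3, mul_sub, ← mul_pow, ← mul_pow, ← e1, ← e2]
  · simp only [dslope_same, hd1, mul_pow]
    have hne : deriv ψ z₀ ^ ram J z₀ ≠ 0 := pow_ne_zero _ hψ'
    rw [sub_eq_zero]
    constructor
    · intro h
      exact mul_left_cancel₀ hne (by rw [h, mul_one])
    · intro h
      rw [h, mul_one]

lemma IsHaupt.mem_iff_of_fix (H : IsHaupt Γ J g) {z₀ : ℂ} (hz : z₀ ∈ UH) {N : SL2R}
    (hN : moebius N z₀ = z₀) : N ∈ Γ ↔ (1 / den N z₀ ^ 2) ^ ram J z₀ = 1 := by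
  constructor
  · intro h
    obtain ⟨V, hV, hJ, hV0⟩ := H.exists_sub_eq_pow_mul hz hN
    rw [← hV0]
    have : ∃ᶠ z in 𝓝[≠] z₀, V z = 0 := by
      refine Eventually.frequently ?_
      filter_upwards [hJ.filter_mono nhdsWithin_le_nhds, self_mem_nhdsWithin,
        (isOpen_UH.mem_nhds hz : UH ∈ 𝓝 z₀) |> mem_nhdsWithin_of_mem_nhds] with z h1 h2 h3
      rw [H.inv N h z h3, sub_self, eq_comm, mul_eq_zero] at h1
      exact h1.resolve_left (pow_ne_zero _ (sub_ne_zero.2 h2))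
    exact ((hV.frequently_zero_iff_eventually_zero).1 this).self_of_nhds
  · intro h
    obtain ⟨γ, hγ, hγz, hγd⟩ := H.exists_stab_of_pow_eq_one hz h
    have h2 : den N z₀ ^ 2 = den γ z₀ ^ 2 := by
      have := congrArg (fun x : ℂ => x⁻¹) hγd
      simpa using this.symm
    rcases eq_or_neg_of_moebius_den_sq hz (hN.trans hγz.symm) h2 with h3 | h3
    · rw [h3]; exact hγ
    · rw [h3, ← neg_one_mul]; exact Γ.mul_mem H.neg_one_mem hγ

/-- The stabilizer of a point. -/
def stabSet (Γ : Subgroup SL2R) (z : ℂ) : Set SL2R := {γ | γ ∈ Γ ∧ moebius γ z = z}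

lemma den_sq_pow {N : SL2R} {z₀ : ℂ} {e : ℕ} :
    (1 / den N z₀ ^ 2) ^ e = 1 ↔ den N z₀ ^ (2 * e) = 1 := by
  rw [one_div, inv_pow, inv_eq_one, ← pow_mul]

lemma IsHaupt.stab_card (H : IsHaupt Γ J g) {z₀ : ℂ} (hz : z₀ ∈ UH) :
    (stabSet Γ z₀).Finite ∧ (stabSet Γ z₀).ncard = 2 * ram J z₀ := by
  have he : 0 < 2 * ram J z₀ := Nat.mul_pos two_pos (Nat.pos_of_ne_zero (H.ram_ne_zero hz))
  have himg : (fun γ => den γ z₀) '' stabSet Γ z₀ =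
      (Polynomial.nthRootsFinset (2 * ram J z₀) (1 : ℂ) : Set ℂ) := by
    ext μ
    simp only [Set.mem_image, Finset.mem_coe, Polynomial.mem_nthRootsFinset he]
    constructor
    · rintro ⟨γ, ⟨h1, h2⟩, rfl⟩
      exact den_sq_pow.1 ((H.mem_iff_of_fix hz h2).1 h1)
    · intro hμ
      have h1 : (1 / μ ^ 2) ^ ram J z₀ = 1 := by
        rw [one_div, inv_pow, inv_eq_one, ← pow_mul, hμ]
      obtain ⟨γ, hγ, hγz, hγd⟩ := H.exists_stab_of_pow_eq_one hz h1
      have h2 : den γ z₀ ^ 2 = μ ^ 2 := by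
        have := congrArg (fun x : ℂ => x⁻¹) hγd
        simpa using this
      rcases sq_eq_sq_iff_eq_or_eq_neg.1 h2 with h3 | h3
      · exact ⟨γ, ⟨hγ, hγz⟩, h3⟩
      · refine ⟨-γ, ⟨?_, by rw [moebius_neg, hγz]⟩, by simp [h3]⟩
        rw [← neg_one_mul]; exact Γ.mul_mem H.neg_one_mem hγ
  have hinj : Set.InjOn (fun γ => den γ z₀) (stabSet Γ z₀) := by
    rintro γ ⟨-, h1⟩ δ ⟨-, h2⟩ h
    exact eq_of_moebius_den hz (h1.trans h2.symm) h
  have hfin : ((fun γ => den γ z₀) '' stabSet Γ z₀).Finite := by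
    rw [himg]; exact Finset.finite_toSet _
  refine ⟨hfin.of_finite_image hinj, ?_⟩
  rw [← hinj.ncard_image, himg, Set.ncard_coe_finset,
    (Complex.isPrimitiveRoot_exp _ he.ne').card_nthRootsFinset]

open Classical in
/-- The factor of a modular correspondence attached to the coset `Γ M`. -/
noncomputable def fac (Γ : Subgroup SL2R) (J : ℂ → ℂ) (α M : SL2R) : ℂ → ℂ :=
  if M * α⁻¹ ∈ Γ then deriv (fun z => J (moebius α z))
  else fun z => J (moebius α z) - J (moebius M z)

/-- Elements of `Γ M` agreeing with `α` at `z`, other than `±α`. -/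
def hitSet (Γ : Subgroup SL2R) (α M : SL2R) (z : ℂ) : Set SL2R :=
  {X | X * M⁻¹ ∈ Γ ∧ moebius X z = moebius α z ∧ X ≠ α ∧ X ≠ -α}

lemma IsHaupt.analyticAt_comp (H : IsHaupt Γ J g) (α : SL2R) {z : ℂ} (hz : z ∈ UH) :
    AnalyticAt ℂ (fun z => J (moebius α z)) z :=
  AnalyticAt.comp (H.analyticAt (moebius_mem α hz)) (analyticAt_moebius α hz)

lemma IsHaupt.analyticAt_fac (H : IsHaupt Γ J g) (α M : SL2R) {z : ℂ} (hz : z ∈ UH) :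
    AnalyticAt ℂ (fac Γ J α M) z := by
  unfold fac
  split_ifs
  · exact (H.analyticAt_comp α hz).deriv
  · exact (H.analyticAt_comp α hz).sub (H.analyticAt_comp M hz)

lemma deriv_moebius_ne_zero (α : SL2R) {z : ℂ} (hz : z ∈ UH) : deriv (moebius α) z ≠ 0 := by
  rw [(hasDerivAt_moebius α hz).deriv]
  exact one_div_ne_zero (pow_ne_zero _ (den_ne_zero α hz))

lemma ne_neg_self (α : SL2R) : α ≠ -α := by
  intro h
  have h1 := det_entries α
  have h2 : ∀ i j, α.1 i j = 0 := by
    intro i j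
    have := congrArg (fun X : SL2R => X.1 i j) h
    simp only [SpecialLinearGroup.coe_neg, Matrix.neg_apply] at this
    linarith
  rw [h2 0 0, h2 0 1] at h1
  norm_num at h1

lemma IsHaupt.order_fac (H : IsHaupt Γ J g) (α M : SL2R) {z₀ : ℂ} (hz : z₀ ∈ UH) :
    ∃ m : ℕ, analyticOrderAt (fac Γ J α M) z₀ = m ∧ (hitSet Γ α M z₀).Finite ∧
      (hitSet Γ α M z₀).ncard = 2 * m := by
  have hαz := moebius_mem α hz
  by_cases hex : ∃ X : SL2R, X * M⁻¹ ∈ Γ ∧ moebius X z₀ = moebius α z₀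
  swap
  · have hnot : ¬ M * α⁻¹ ∈ Γ := fun h => hex ⟨α, by simpa using Γ.inv_mem h, rfl⟩
    have hemp : hitSet Γ α M z₀ = ∅ := by
      ext X
      simp only [Set.mem_empty_iff_false, iff_false]
      exact fun hX => hex ⟨X, hX.1, hX.2.1⟩
    refine ⟨0, ?_, by rw [hemp]; exact Set.finite_empty, by rw [hemp]; simp⟩
    rw [Nat.cast_zero, (H.analyticAt_fac α M hz).analyticOrderAt_eq_zero]
    simp only [fac, if_neg hnot]
    intro h
    obtain ⟨γ, hγ, hγz⟩ := H.orbitEquiv_of_eq (moebius_mem M hz) hαz (sub_eq_zero.1 h).symm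
    exact hex ⟨γ * M, by simpa using hγ, by rw [moebius_mul _ _ hz, hγz]⟩
  obtain ⟨X₀, hX₀, hX₀z⟩ := hex
  obtain ⟨hfin, hcard⟩ := H.stab_card hαz
  set A : Set SL2R := {X | X * M⁻¹ ∈ Γ ∧ moebius X z₀ = moebius α z₀} with hA
  have hAimg : A = (fun γ => γ * X₀) '' stabSet Γ (moebius α z₀) := by
    ext X
    constructor
    · rintro ⟨h1, h2⟩
      refine ⟨X * X₀⁻¹, ⟨?_, ?_⟩, by simp⟩
      · have : X * X₀⁻¹ = (X * M⁻¹) * (X₀ * M⁻¹)⁻¹ := by group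
        rw [this]
        exact Γ.mul_mem h1 (Γ.inv_mem hX₀)
      · rw [moebius_mul _ _ hαz, moebius_inv_eq X₀ hz hX₀z, h2]
    · rintro ⟨γ, ⟨h1, h2⟩, rfl⟩
      refine ⟨?_, ?_⟩
      · simp only [mul_assoc]
        exact Γ.mul_mem h1 hX₀
      · simp only
        rw [moebius_mul _ _ hz, hX₀z, h2]
  have hAfin : A.Finite := by rw [hAimg]; exact hfin.image _
  have hAcard : A.ncard = 2 * ram J (moebius α z₀) := by
    rw [hAimg, Set.ncard_image_of_injective _ (mul_left_injective X₀), hcard]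
  have hsub : hitSet Γ α M z₀ ⊆ A := fun X hX => ⟨hX.1, hX.2.1⟩
  by_cases hT : M * α⁻¹ ∈ Γ
  · have hαA : α ∈ A := ⟨by simpa using Γ.inv_mem hT, rfl⟩
    have hnA : -α ∈ A := by
      refine ⟨?_, moebius_neg _ _⟩
      rw [neg_mul, ← neg_one_mul]
      exact Γ.mul_mem H.neg_one_mem hαA.1
    have hdiff : hitSet Γ α M z₀ = A \ {α, -α} := by
      ext X
      simp only [hitSet, hA, Set.mem_sdiff, Set.mem_insert_iff, Set.mem_singleton_iff, not_or]
      constructor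
      · rintro ⟨a, b, c, d⟩; exact ⟨⟨a, b⟩, c, d⟩
      · rintro ⟨⟨a, b⟩, c, d⟩; exact ⟨a, b, c, d⟩
    have hpair : ({α, -α} : Set SL2R).ncard = 2 := Set.ncard_pair (ne_neg_self α)
    have hc2 : (hitSet Γ α M z₀).ncard = 2 * ram J (moebius α z₀) - 2 := by
      rw [hdiff, Set.ncard_sdiff (by
        intro X hX
        rcases hX with rfl | rfl
        · exact hαA
        · exact hnA) (Set.toFinite _), hAcard, hpair]
    have h1 := (H.analyticAt_comp α hz).analyticOrderAt_deriv_add_one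
    have h2 : analyticOrderAt (fun z => J (moebius α z) - J (moebius α z₀)) z₀ =
        ram J (moebius α z₀) := by
      rw [← H.order_eq_ram hαz]
      exact analyticOrderAt_comp_of_deriv_ne_zero (f := fun w => J w - J (moebius α z₀))
        (analyticAt_moebius α hz) (deriv_moebius_ne_zero α hz)
    rw [h2] at h1
    refine ⟨ram J (moebius α z₀) - 1, ?_, hAfin.subset hsub, by rw [hc2]; omega⟩
    simp only [fac, if_pos hT]
    have hr := H.ram_ne_zero hαz
    obtain ⟨r, hr'⟩ := Nat.exists_eq_succ_of_ne_zero hr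
    rw [hr'] at h1 ⊢
    simp only [Nat.succ_eq_add_one, Nat.cast_add, Nat.cast_one, Nat.add_sub_cancel] at h1 ⊢
    exact (ENat.add_left_injective_of_ne_top (by simp)) h1
  · have heq : hitSet Γ α M z₀ = A := by
      refine Set.Subset.antisymm hsub fun X hX => ⟨hX.1, hX.2, ?_, ?_⟩
      · rintro rfl
        exact hT (by simpa using Γ.inv_mem hX.1)
      · rintro rfl
        apply hT
        have := Γ.inv_mem hX.1
        have h2 := Γ.mul_mem H.neg_one_mem this
        simpa using h2
    refine ⟨ram J (moebius α z₀), ?_, heq ▸ hAfin, by rw [heq, hAcard]⟩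
    set N : SL2R := X₀ * α⁻¹ with hN
    have hNz : moebius N (moebius α z₀) = moebius α z₀ := by
      rw [hN, ← moebius_mul _ _ hz]; simpa using hX₀z
    have hNΓ : N ∉ Γ := by
      intro h
      apply hT
      have : M * α⁻¹ = (X₀ * M⁻¹)⁻¹ * N := by rw [hN]; group
      rw [this]
      exact Γ.mul_mem (Γ.inv_mem hX₀) h
    obtain ⟨V, hV, hJV, hV0⟩ := H.exists_sub_eq_pow_mul hαz hNz
    have hVne : V (moebius α z₀) ≠ 0 := fun h => hNΓ ((H.mem_iff_of_fix hαz hNz).2 (hV0.1 h))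
    have ho : analyticOrderAt (fun y => J (moebius N y) - J y) (moebius α z₀) =
        ram J (moebius α z₀) := by
      rw [AnalyticAt.analyticOrderAt_eq_natCast]
      · exact ⟨V, hV, hVne, hJV⟩
      · exact (H.analyticAt_comp N hαz).sub (H.analyticAt hαz)
    have ho2 := analyticOrderAt_comp_of_deriv_ne_zero (f := fun y => J (moebius N y) - J y)
        (analyticAt_moebius α hz) (deriv_moebius_ne_zero α hz)
    rw [ho] at ho2
    rw [← ho2, ← analyticOrderAt_neg]
    apply analyticOrderAt_congr
    filter_upwards [isOpen_UH.mem_nhds hz] with z hz'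
    have hz' : z ∈ UH := hz'
    simp only [fac, if_neg hT, Pi.neg_apply, Function.comp, neg_sub, sub_left_inj]
    have e1 : moebius N (moebius α z) = moebius (X₀ * M⁻¹) (moebius M z) := by
      rw [← moebius_mul _ _ hz', ← moebius_mul _ _ hz']
      congr 1
      rw [hN]; group
    rw [e1, H.inv _ hX₀ _ (moebius_mem M hz')]

end

end FrickeTrace

namespace FrickeTrace

open Filter Topology

section
variable {Γ : Subgroup SL2R} {J g : ℂ → ℂ} {ι κ : Type*}

/-- The product of the factors attached to a finite family of cosets. -/
noncomputable def famProd (Γ : Subgroup SL2R) (J : ℂ → ℂ) (α : SL2R) (s : Finset ι)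
    (M : ι → SL2R) (z : ℂ) : ℂ := ∏ i ∈ s, fac Γ J α (M i) z

/-- The union of the cosets of a family. -/
def famSet (Γ : Subgroup SL2R) (s : Finset ι) (M : ι → SL2R) : Set SL2R :=
  {X | ∃ i ∈ s, X * (M i)⁻¹ ∈ Γ}

/-- The cosets of a family are pairwise distinct. -/
def FamDisjoint (Γ : Subgroup SL2R) (s : Finset ι) (M : ι → SL2R) : Prop :=
  ∀ i ∈ s, ∀ j ∈ s, M i * (M j)⁻¹ ∈ Γ → i = j

lemma IsHaupt.analyticAt_famProd (H : IsHaupt Γ J g) (α : SL2R) (s : Finset ι) (M : ι → SL2R)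
    {z : ℂ} (hz : z ∈ UH) : AnalyticAt ℂ (famProd Γ J α s M) z := by
  unfold famProd
  exact Finset.analyticAt_fun_prod s fun i _ => H.analyticAt_fac α (M i) hz

lemma IsHaupt.order_famProd (H : IsHaupt Γ J g) (α : SL2R) (M : ι → SL2R) {z₀ : ℂ}
    (hz : z₀ ∈ UH) (s : Finset ι) (hs : FamDisjoint Γ s M) :
    ∃ m : ℕ, analyticOrderAt (famProd Γ J α s M) z₀ = m ∧
      {X ∈ famSet Γ s M | moebius X z₀ = moebius α z₀ ∧ X ≠ α ∧ X ≠ -α}.Finite ∧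
      {X ∈ famSet Γ s M | moebius X z₀ = moebius α z₀ ∧ X ≠ α ∧ X ≠ -α}.ncard = 2 * m := by
  classical
  induction s using Finset.induction_on with
  | empty =>
    have h1 : {X ∈ famSet Γ ∅ M | moebius X z₀ = moebius α z₀ ∧ X ≠ α ∧ X ≠ -α} = ∅ := by
      ext X; simp [famSet]
    refine ⟨0, ?_, by rw [h1]; exact Set.finite_empty, by rw [h1]; simp⟩
    rw [Nat.cast_zero, (H.analyticAt_famProd α ∅ M hz).analyticOrderAt_eq_zero]
    simp [famProd]
  | insert i s hi ih =>
    obtain ⟨m, hm, hfin, hcard⟩ := ih fun i hi j hj =>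
      hs i (Finset.mem_insert_of_mem hi) j (Finset.mem_insert_of_mem hj)
    obtain ⟨k, hk, hfin', hcard'⟩ := H.order_fac α (M i) hz
    have hU : {X ∈ famSet Γ (insert i s) M | moebius X z₀ = moebius α z₀ ∧ X ≠ α ∧ X ≠ -α} =
        hitSet Γ α (M i) z₀ ∪
          {X ∈ famSet Γ s M | moebius X z₀ = moebius α z₀ ∧ X ≠ α ∧ X ≠ -α} := by
      ext X
      constructor
      · rintro ⟨⟨j, hj, hX⟩, h2⟩
        rcases Finset.mem_insert.1 hj with rfl | hj
        · exact Or.inl ⟨hX, h2⟩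
        · exact Or.inr ⟨⟨j, hj, hX⟩, h2⟩
      · rintro (⟨hX, h2⟩ | ⟨⟨j, hj, hX⟩, h2⟩)
        · exact ⟨⟨i, Finset.mem_insert_self _ _, hX⟩, h2⟩
        · exact ⟨⟨j, Finset.mem_insert_of_mem hj, hX⟩, h2⟩
    have hdis : Disjoint (hitSet Γ α (M i) z₀)
        {X ∈ famSet Γ s M | moebius X z₀ = moebius α z₀ ∧ X ≠ α ∧ X ≠ -α} := by
      rw [Set.disjoint_left]
      rintro X ⟨hX, -⟩ ⟨⟨j, hj, hXj⟩, -⟩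
      have : M i * (M j)⁻¹ ∈ Γ := by
        have h := Γ.mul_mem (Γ.inv_mem hX) hXj
        simpa [mul_assoc] using h
      have := hs i (Finset.mem_insert_self _ _) j (Finset.mem_insert_of_mem hj) this
      exact hi (this ▸ hj)
    refine ⟨k + m, ?_, by rw [hU]; exact hfin'.union hfin, ?_⟩
    · have : famProd Γ J α (insert i s) M = fac Γ J α (M i) * famProd Γ J α s M := by
        funext z
        simp only [famProd, Finset.prod_insert hi, Pi.mul_apply]
      rw [this, analyticOrderAt_mul (H.analyticAt_fac α (M i) hz) (H.analyticAt_famProd α s M hz),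
        hk, hm, Nat.cast_add]
    · rw [hU, Set.ncard_union_eq hdis hfin' hfin, hcard, hcard', mul_add]

open Classical in
/-- The number of trivial factors of a family. -/
noncomputable def famWeight (Γ : Subgroup SL2R) (α : SL2R) (s : Finset ι) (M : ι → SL2R) : ℕ :=
  (s.filter fun i => M i * α⁻¹ ∈ Γ).card

open Classical in
lemma IsHaupt.fac_moebius (H : IsHaupt Γ J g) {α α' M M' δ : SL2R} (hα : α * δ * α'⁻¹ ∈ Γ)
    (hM : M * δ * M'⁻¹ ∈ Γ) {z : ℂ} (hz : z ∈ UH) :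
    fac Γ J α M (moebius δ z) =
      (if M * α⁻¹ ∈ Γ then den δ z ^ 2 else 1) * fac Γ J α' M' z := by
  have hJ : ∀ {A A' : SL2R}, A * δ * A'⁻¹ ∈ Γ → ∀ w ∈ UH,
      J (moebius A (moebius δ w)) = J (moebius A' w) := by
    intro A A' h w hw
    rw [← moebius_mul _ _ hw]
    have : A * δ = (A * δ * A'⁻¹) * A' := by group
    rw [this, moebius_mul _ _ hw, H.inv _ h _ (moebius_mem _ hw)]
  have hiff : M' * α'⁻¹ ∈ Γ ↔ M * α⁻¹ ∈ Γ := by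
    have e : M' * α'⁻¹ = (M * δ * M'⁻¹)⁻¹ * (M * α⁻¹) * (α * δ * α'⁻¹) := by group
    rw [e, Γ.mul_mem_cancel_right hα, Γ.mul_mem_cancel_left (Γ.inv_mem hM)]
  by_cases hT : M * α⁻¹ ∈ Γ
  · simp only [fac, if_pos hT, if_pos (hiff.2 hT)]
    have h1 : (fun w => J (moebius α' w)) =ᶠ[𝓝 z] fun w => J (moebius α (moebius δ w)) := by
      filter_upwards [isOpen_UH.mem_nhds hz] with w hw
      exact (hJ hα w hw).symm
    have h2 := (H.analyticAt_comp α (moebius_mem δ hz)).differentiableAt.hasDerivAt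
    have h3 := (h2.comp z (hasDerivAt_moebius δ hz)).deriv
    have h4 := h1.deriv_eq
    have h5 : deriv (fun w => J (moebius α (moebius δ w))) z =
      deriv (fun z => J (moebius α z)) (moebius δ z) * (1 / den δ z ^ 2) := h3
    rw [h4, h5]
    have := den_ne_zero δ hz
    field_simp
  · simp only [fac, if_neg hT, if_neg (fun h => hT (hiff.1 h)), one_mul, hJ hα z hz, hJ hM z hz]

lemma IsHaupt.famProd_moebius [Nonempty κ] (H : IsHaupt Γ J g) {α α' δ : SL2R} (hα : α * δ * α'⁻¹ ∈ Γ)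
    {s : Finset ι} {M : ι → SL2R} {s' : Finset κ} {M' : κ → SL2R}
    (hs : FamDisjoint Γ s M) (hs' : FamDisjoint Γ s' M')
    (h1 : ∀ i ∈ s, M i * δ ∈ famSet Γ s' M') (h2 : ∀ j ∈ s', M' j * δ⁻¹ ∈ famSet Γ s M)
    {z : ℂ} (hz : z ∈ UH) :
    famProd Γ J α s M (moebius δ z) =
      den δ z ^ (2 * famWeight Γ α s M) * famProd Γ J α' s' M' z := by
  classical
  choose! σ hσ hσΓ using h1
  have hbij : ∏ i ∈ s, fac Γ J α' (M' (σ i)) z = ∏ j ∈ s', fac Γ J α' (M' j) z := by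
    refine Finset.prod_bij (fun i _ => σ i) hσ ?_ ?_ fun _ _ => rfl
    · intro i hi j hj hij
      refine hs i hi j hj ?_
      have h3 := Γ.mul_mem (hσΓ i hi) (Γ.inv_mem (hσΓ j hj))
      have hij' : σ i = σ j := hij
      rw [← hij'] at h3
      have e : M i * δ * (M' (σ i))⁻¹ * (M j * δ * (M' (σ i))⁻¹)⁻¹ = M i * (M j)⁻¹ := by group
      rwa [e] at h3
    · intro j hj
      obtain ⟨i, hi, hiΓ⟩ := h2 j hj
      refine ⟨i, hi, hs' _ (hσ i hi) _ hj ?_⟩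
      have h3 := Γ.mul_mem (Γ.inv_mem (hσΓ i hi)) (Γ.inv_mem hiΓ)
      have e : (M i * δ * (M' (σ i))⁻¹)⁻¹ * (M' j * δ⁻¹ * (M i)⁻¹)⁻¹ = M' (σ i) * (M' j)⁻¹ := by
        group
      rwa [e] at h3
  unfold famProd
  rw [← hbij, Finset.prod_congr rfl fun i hi => H.fac_moebius hα (hσΓ i hi) hz,
    Finset.prod_mul_distrib]
  congr 1
  rw [Finset.prod_ite, Finset.prod_const, Finset.prod_const_one, mul_one, famWeight, ← pow_mul]

end

end FrickeTrace

namespace FrickeTrace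

open Filter Topology Asymptotics

/-- `f = A + B q + C q² + o(q²)` at `i∞`. -/
def Jet (f : ℂ → ℂ) (A B C : ℂ) : Prop :=
  (fun z => f z - (A + B * qc z + C * qc z ^ 2)) =o[imInf] fun z => qc z ^ 2

/-- `F = A q^m (1 + a q + b q² + o(q²))` with `A ≠ 0` and `κ = a² - 2 b`. -/
def HasJet (F : ℂ → ℂ) (m : ℤ) (κ : ℂ) : Prop :=
  ∃ A B C : ℂ, A ≠ 0 ∧ κ * A ^ 2 = B ^ 2 - 2 * A * C ∧ Jet (fun z => F z * qc z ^ (-m)) A B C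

lemma poly_isBigO_one {P : ℂ → ℂ} (hP : Continuous P) :
    (fun z => P (qc z)) =O[imInf] fun _ => (1 : ℂ) :=
  ((hP.tendsto 0).comp qc_tendsto_zero).isBigO_one ℂ

lemma qc_isLittleO_one : qc =o[imInf] fun _ => (1 : ℂ) :=
  (isLittleO_one_iff ℂ).2 qc_tendsto_zero

lemma qc_pow_isLittleO {k l : ℕ} (h : l < k) : (fun z => qc z ^ k) =o[imInf] fun z => qc z ^ l := by
  have e : (fun z => qc z ^ k) = fun z => qc z ^ (k - l) * qc z ^ l := by
    funext z; rw [← pow_add]; congr 1; omega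
  rw [e]
  have h1 : (fun z => qc z ^ (k - l)) =o[imInf] fun _ => (1 : ℂ) := by
    have := qc_tendsto_zero.pow (k - l)
    rw [zero_pow (Nat.sub_ne_zero_of_lt h)] at this
    exact (isLittleO_one_iff ℂ).2 this
  simpa using h1.mul_isBigO (isBigO_refl (fun z => qc z ^ l) imInf)

lemma Jet.mul {f g : ℂ → ℂ} {A B C A' B' C' : ℂ} (hf : Jet f A B C) (hg : Jet g A' B' C') :
    Jet (fun z => f z * g z) (A * A') (A * B' + B * A') (A * C' + B * B' + C * A') := by
  unfold Jet at *
  set r := fun z => f z - (A + B * qc z + C * qc z ^ 2) with hr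
  set s := fun z => g z - (A' + B' * qc z + C' * qc z ^ 2) with hs
  have e : (fun z => f z * g z - (A * A' + (A * B' + B * A') * qc z +
      (A * C' + B * B' + C * A') * qc z ^ 2)) = fun z =>
      (B * C' + C * B' + C * C' * qc z) * qc z ^ 3 + (A + B * qc z + C * qc z ^ 2) * s z +
      (A' + B' * qc z + C' * qc z ^ 2) * r z + r z * s z := by
    funext z
    simp only [hr, hs]
    ring
  rw [e]
  have hP := poly_isBigO_one (P := fun q => A + B * q + C * q ^ 2) (by fun_prop)
  have hR := poly_isBigO_one (P := fun q => A' + B' * q + C' * q ^ 2) (by fun_prop)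
  have hT := poly_isBigO_one (P := fun q => B * C' + C * B' + C * C' * q) (by fun_prop)
  have h1 := hT.mul_isLittleO (qc_pow_isLittleO (k := 3) (l := 2) (by norm_num))
  have h2 := hP.mul_isLittleO hg
  have h3 := hR.mul_isLittleO hf
  have hr1 : r =O[imInf] fun _ => (1 : ℂ) :=
    hf.isBigO.trans (poly_isBigO_one (P := fun q => q ^ 2) (by fun_prop))
  have h4 := hr1.mul_isLittleO hg
  simp only [one_mul] at h1 h2 h3 h4
  exact ((h1.add h2).add h3).add h4

lemma Jet.congr' {f g : ℂ → ℂ} {A B C : ℂ} (hf : Jet f A B C) (h : f =ᶠ[imInf] g) : Jet g A B C :=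
  IsLittleO.congr' hf (h.mono fun z hz => by simp only [hz]) EventuallyEq.rfl

lemma Jet.tendsto {f : ℂ → ℂ} {A B C : ℂ} (hf : Jet f A B C) : Tendsto f imInf (𝓝 A) := by
  have h1 : Tendsto (fun z => f z - (A + B * qc z + C * qc z ^ 2)) imInf (𝓝 0) :=
    (isLittleO_one_iff ℂ).1
      (hf.trans_isBigO (poly_isBigO_one (P := fun q => q ^ 2) (by fun_prop)))
  have h2 : Tendsto (fun z => A + B * qc z + C * qc z ^ 2) imInf (𝓝 A) := by
    have hc : Continuous fun q : ℂ => A + B * q + C * q ^ 2 := by fun_prop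
    have := (hc.tendsto 0).comp qc_tendsto_zero
    simpa [Function.comp_def] using this
  simpa using h1.add h2

lemma tendsto_of_littleO {f : ℂ → ℂ} {k : ℕ} (h : f =o[imInf] fun z => qc z ^ k) {l : ℕ}
    (hl : l ≤ k) : Tendsto (fun z => f z / qc z ^ l) imInf (𝓝 0) := by
  have h1 : (fun z => qc z ^ k) =O[imInf] fun z => qc z ^ l := by
    rcases hl.eq_or_lt with rfl | hl
    · exact isBigO_refl _ _
    · exact (qc_pow_isLittleO hl).isBigO
  exact (h.trans_isBigO h1).tendsto_div_nhds_zero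

lemma Jet.unique {f : ℂ → ℂ} {A B C A' B' C' : ℂ} (hf : Jet f A B C) (hf' : Jet f A' B' C') :
    A = A' ∧ B = B' ∧ C = C' := by
  have hA : A = A' := tendsto_nhds_unique hf.tendsto hf'.tendsto
  have hd : (fun z => (B' - B) * qc z + (C' - C) * qc z ^ 2) =o[imInf] fun z => qc z ^ 2 := by
    have := hf.sub hf'
    refine this.congr_left fun z => ?_
    rw [hA]; ring
  have hB : B' - B = 0 := by
    have h1 := tendsto_of_littleO hd (l := 1) (by norm_num)
    have h2 : Tendsto (fun z => (B' - B) + (C' - C) * qc z) imInf (𝓝 (B' - B)) := by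
      have hc : Continuous fun q : ℂ => (B' - B) + (C' - C) * q := by fun_prop
      have := (hc.tendsto 0).comp qc_tendsto_zero
      simpa [Function.comp_def] using this
    refine tendsto_nhds_unique (h2.congr fun z => ?_) h1
    have := qc_ne_zero z
    field_simp
  have hC : C' - C = 0 := by
    have h1 := tendsto_of_littleO hd (l := 2) le_rfl
    refine tendsto_nhds_unique (tendsto_const_nhds.congr fun z => ?_) h1
    have := qc_ne_zero z
    rw [hB]
    field_simp
    ring
  exact ⟨hA, (sub_eq_zero.1 hB).symm, (sub_eq_zero.1 hC).symm⟩

lemma HasJet.congr' {F G : ℂ → ℂ} {m : ℤ} {κ : ℂ} (hF : HasJet F m κ) (h : F =ᶠ[imInf] G) :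
    HasJet G m κ := by
  obtain ⟨A, B, C, hA, hκ, hj⟩ := hF
  exact ⟨A, B, C, hA, hκ, hj.congr' (h.mono fun z hz => by simp only [hz])⟩

lemma HasJet.mul {F G : ℂ → ℂ} {m m' : ℤ} {κ κ' : ℂ} (hF : HasJet F m κ) (hG : HasJet G m' κ') :
    HasJet (fun z => F z * G z) (m + m') (κ + κ') := by
  obtain ⟨A, B, C, hA, hκ, hj⟩ := hF
  obtain ⟨A', B', C', hA', hκ', hj'⟩ := hG
  refine ⟨_, _, _, mul_ne_zero hA hA', ?_, (hj.mul hj').congr' (Eventually.of_forall fun z => ?_)⟩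
  · linear_combination A' ^ 2 * hκ + A ^ 2 * hκ'
  · simp only
    rw [neg_add, zpow_add₀ (qc_ne_zero z)]
    ring

lemma jet_const (c : ℂ) : Jet (fun _ => c) c 0 0 := by
  unfold Jet
  refine (isLittleO_zero _ _).congr_left fun z => ?_
  ring

lemma hasJet_qc_zpow (m : ℤ) : HasJet (fun z => qc z ^ m) m 0 := by
  refine ⟨1, 0, 0, one_ne_zero, by ring, (jet_const 1).congr' (Eventually.of_forall fun z => ?_)⟩
  simp only
  rw [← zpow_add₀ (qc_ne_zero z), add_neg_cancel, zpow_zero]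

lemma Jet.hasJet {F : ℂ → ℂ} {A B C κ : ℂ} (h : Jet F A B C) (hA : A ≠ 0)
    (hκ : κ * A ^ 2 = B ^ 2 - 2 * A * C) : HasJet F 0 κ :=
  ⟨A, B, C, hA, hκ, h.congr' (Eventually.of_forall fun z => by simp)⟩

lemma hasJet_const {c : ℂ} (hc : c ≠ 0) : HasJet (fun _ => c) 0 0 :=
  (jet_const c).hasJet hc (by ring)

lemma HasJet.prod {ι : Type*} {F : ι → ℂ → ℂ} {m : ι → ℤ} {κ : ι → ℂ} (s : Finset ι)
    (h : ∀ i ∈ s, HasJet (F i) (m i) (κ i)) :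
    HasJet (fun z => ∏ i ∈ s, F i z) (∑ i ∈ s, m i) (∑ i ∈ s, κ i) := by
  classical
  induction s using Finset.induction_on with
  | empty => simpa using hasJet_const one_ne_zero
  | insert i s hi ih =>
    simp only [Finset.prod_insert hi, Finset.sum_insert hi]
    exact (h i (Finset.mem_insert_self _ _)).mul
      (ih fun j hj => h j (Finset.mem_insert_of_mem hj))

lemma HasJet.pow {F : ℂ → ℂ} {m : ℤ} {κ : ℂ} (h : HasJet F m κ) (n : ℕ) :
    HasJet (fun z => F z ^ n) (n * m) (n * κ) := by
  have := HasJet.prod (Finset.range n) (F := fun _ => F) (m := fun _ => m) (κ := fun _ => κ)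
    fun _ _ => h
  simpa using this

lemma HasJet.unique {F : ℂ → ℂ} {m m' : ℤ} {κ κ' : ℂ} (h : HasJet F m κ) (h' : HasJet F m' κ') :
    m = m' ∧ κ = κ' := by
  have key : ∀ {m m' : ℤ} {κ κ' : ℂ}, HasJet F m κ → HasJet F m' κ' → ¬ m < m' := by
    intro m m' κ κ' h h' hlt
    obtain ⟨A, B, C, hA, -, hj⟩ := h
    obtain ⟨A', B', C', hA', -, hj'⟩ := h'
    have h1 : Tendsto (fun z => qc z ^ (m' - m).toNat) imInf (𝓝 0) := by
      have := qc_tendsto_zero.pow (m' - m).toNat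
      rwa [zero_pow (by omega)] at this
    have h2 := hj'.tendsto.mul h1
    refine hA (tendsto_nhds_unique hj.tendsto ?_)
    rw [mul_zero] at h2
    refine h2.congr fun z => ?_
    rw [mul_assoc, ← zpow_natCast, ← zpow_add₀ (qc_ne_zero z)]
    congr 2
    omega
  have hm : m = m' := by
    rcases lt_trichotomy m m' with hlt | heq | hlt
    · exact absurd hlt (key h h')
    · exact heq
    · exact absurd hlt (key h' h)
  subst hm
  obtain ⟨A, B, C, hA, hκ, hj⟩ := h
  obtain ⟨A', B', C', hA', hκ', hj'⟩ := h'
  obtain ⟨rfl, rfl, rfl⟩ := hj.unique hj'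
  refine ⟨rfl, mul_right_cancel₀ (pow_ne_zero 2 hA) (hκ.trans hκ'.symm)⟩

lemma taylor_isBigO {f : ℂ → ℂ} (hf : AnalyticAt ℂ f 0) :
    ∃ a : ℕ → ℂ, a 0 = f 0 ∧ a 1 = deriv f 0 ∧ (∀ n, a n = iteratedDeriv n f 0 / n.factorial) ∧
      ∀ n, (fun w => f w - ∑ i ∈ Finset.range n, a i * w ^ i) =O[𝓝 0] fun w => w ^ n := by
  refine ⟨fun n => iteratedDeriv n f 0 / n.factorial, by simp, by simp, fun n => rfl, fun n => ?_⟩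
  have h := (hf.hasFPowerSeriesAt).isBigO_sub_partialSum_pow n
  refine (h.congr_left fun w => ?_).trans (isBigO_of_le _ fun w => by simp)
  simp [FormalMultilinearSeries.partialSum, FormalMultilinearSeries.ofScalars, div_eq_mul_inv,
    mul_comm]

lemma jet_comp_qc {f : ℂ → ℂ} (hf : AnalyticAt ℂ f 0) :
    Jet (fun z => f (qc z)) (f 0) (deriv f 0) (iteratedDeriv 2 f 0 / 2) := by
  obtain ⟨a, h0, h1, h2, ha⟩ := taylor_isBigO hf
  have h3 := (ha 3).comp_tendsto qc_tendsto_zero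
  have h4 := h3.trans_isLittleO (qc_pow_isLittleO (k := 3) (l := 2) (by norm_num))
  refine h4.congr_left fun z => ?_
  simp only [Function.comp, Finset.sum_range_succ, Finset.sum_range_zero, h2 2, h0, h1]
  norm_num [Nat.factorial]

end FrickeTrace

namespace FrickeTrace

open Filter Topology Asymptotics

/-- The matrix `[[a, b], [0, d]]` scaled to determinant one. -/
noncomputable def upM (a d b : ℕ) : SL2R :=
  if h : 0 < a * d then
    ⟨(Real.sqrt (a * d : ℕ))⁻¹ • !![(a : ℝ), (b : ℝ); 0, (d : ℝ)], by
      have h0 : (0 : ℝ) < (a * d : ℕ) := by exact_mod_cast h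
      rw [Matrix.det_smul, Matrix.det_fin_two_of, Fintype.card_fin, inv_pow, Real.sq_sqrt h0.le,
        mul_zero, sub_zero, ← Nat.cast_mul, inv_mul_cancel₀ h0.ne']⟩
  else 1

lemma upM_coe {a d : ℕ} (b : ℕ) (ha : 0 < a) (hd : 0 < d) :
    (upM a d b).1 = (Real.sqrt (a * d : ℕ))⁻¹ • !![(a : ℝ), (b : ℝ); 0, (d : ℝ)] := by
  have h : upM a d b = ⟨_, _⟩ := dif_pos (Nat.mul_pos ha hd)
  exact congrArg Subtype.val h

lemma sqrt_mul_pos {a d : ℕ} (ha : 0 < a) (hd : 0 < d) : 0 < Real.sqrt (a * d : ℕ) :=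
  Real.sqrt_pos.2 (by exact_mod_cast Nat.mul_pos ha hd)

lemma moebius_upM {a d : ℕ} (b : ℕ) (ha : 0 < a) (hd : 0 < d) (z : ℂ) :
    moebius (upM a d b) z = (a * z + b) / d := by
  have h := sqrt_mul_pos ha hd
  have h' : (Real.sqrt (a * d : ℕ) : ℂ) ≠ 0 := by exact_mod_cast h.ne'
  have hd' : (d : ℂ) ≠ 0 := by exact_mod_cast hd.ne'
  simp only [moebius, upM_coe b ha hd, Matrix.smul_apply, smul_eq_mul, Matrix.of_apply,
    Matrix.cons_val', Matrix.cons_val_zero, Matrix.cons_val_one, Matrix.cons_val_fin_one]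
  generalize Real.sqrt (a * d : ℕ) = s at h' ⊢
  push_cast
  rw [mul_zero, zero_mul, zero_add]
  field_simp

lemma tendsto_upM {a d : ℕ} (b : ℕ) (ha : 0 < a) (hd : 0 < d) :
    Tendsto (moebius (upM a d b)) imInf imInf := by
  rw [imInf, tendsto_comap_iff]
  have h1 : Tendsto (fun z : ℂ => (a / d : ℝ) * z.im) (comap Complex.im atTop) atTop :=
    Tendsto.const_mul_atTop (by positivity) tendsto_comap
  refine h1.congr fun z => ?_
  rw [Function.comp, moebius_upM b ha hd]
  have : (a * z + b) / d = ((a / d : ℝ) : ℂ) * z + ((b / d : ℝ) : ℂ) := by push_cast; ring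
  rw [this, Complex.add_im, Complex.im_ofReal_mul, Complex.ofReal_im, add_zero]

section
variable {Γ : Subgroup SL2R} {J g : ℂ → ℂ}

/-- An upper triangular element of the group is a translation up to sign. -/
lemma IsHaupt.eq_transl (H : IsHaupt Γ J g) {γ : SL2R} (hγ : γ ∈ Γ) (h0 : γ.1 1 0 = 0) :
    ∃ k : ℤ, γ = transl k ∨ γ = -transl k := by
  have hdet := det_entries γ
  rw [h0, mul_zero, sub_zero] at hdet
  set a := γ.1 0 0 with ha
  set b := γ.1 0 1 with hb
  set d := γ.1 1 1 with hd
  have ha0 : a ≠ 0 := fun h => by rw [h, zero_mul] at hdet; norm_num at hdet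
  have hdinv : d = a⁻¹ := by field_simp; linarith
  have hm : ∀ z, moebius γ z = ((a ^ 2 : ℝ) : ℂ) * z + ((a * b : ℝ) : ℂ) := by
    intro z
    have ha0' : (a : ℂ) ≠ 0 := by exact_mod_cast ha0
    rw [moebius, h0, ← ha, ← hb, ← hd, hdinv]
    push_cast
    field_simp
    ring
  have him : ∀ z : ℂ, (moebius γ z).im = a ^ 2 * z.im := by
    intro z
    rw [hm, Complex.add_im, Complex.im_ofReal_mul, Complex.ofReal_im, add_zero]
  have ht : Tendsto (moebius γ) imInf imInf := by
    rw [imInf, tendsto_comap_iff]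
    have h1 : Tendsto (fun z : ℂ => a ^ 2 * z.im) (comap Complex.im atTop) atTop :=
      Tendsto.const_mul_atTop (by positivity) tendsto_comap
    exact h1.congr fun z => (him z).symm
  have hlim : Tendsto (fun z => qc z / qc (moebius γ z)) imInf (𝓝 1) := by
    have h1 := H.tendsto_mul_qc
    have h2 := h1.comp ht
    have h3 := h1.div h2 one_ne_zero
    rw [div_one] at h3
    have hJ : ∀ᶠ z in imInf, J z ≠ 0 := by
      filter_upwards [H.tendsto_norm.eventually (eventually_gt_atTop 0)] with z hz
      exact norm_pos_iff.1 hz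
    refine h3.congr' ?_
    filter_upwards [hJ, eventually_imInf_UH] with z hz hz'
    simp only [Pi.div_apply, Function.comp, H.inv γ hγ z hz']
    have := qc_ne_zero (moebius γ z)
    field_simp
  have ha2 : a ^ 2 = 1 := by
    have h4 := hlim.norm
    have h5 : ∀ z, ‖qc z / qc (moebius γ z)‖ = Real.exp (2 * Real.pi * (a ^ 2 - 1) * z.im) := by
      intro z
      rw [norm_div, norm_qc, norm_qc, him, ← Real.exp_sub]
      congr 1; ring
    simp only [h5, norm_one] at h4
    rcases lt_trichotomy (a ^ 2 - 1) 0 with h | h | h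
    · have h6 : Tendsto (fun z : ℂ => 2 * Real.pi * (a ^ 2 - 1) * z.im) imInf atBot :=
        Tendsto.const_mul_atTop_of_neg (by nlinarith [Real.pi_pos]) tendsto_comap
      have := tendsto_nhds_unique h4 (Real.tendsto_exp_atBot.comp h6)
      norm_num at this
    · linarith
    · have h6 : Tendsto (fun z : ℂ => 2 * Real.pi * (a ^ 2 - 1) * z.im) imInf atTop :=
        Tendsto.const_mul_atTop (by nlinarith [Real.pi_pos]) tendsto_comap
      exact absurd h4 (not_tendsto_nhds_of_tendsto_atTop (Real.tendsto_exp_atTop.comp h6) _)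
  have hq : qc ((a * b : ℝ) : ℂ) = 1 := by
    have h7 : Tendsto (fun z => qc z / qc (moebius γ z)) imInf (𝓝 (qc ((a * b : ℝ) : ℂ))⁻¹) := by
      refine tendsto_const_nhds.congr fun z => ?_
      rw [hm, ha2, qc_add]
      have := qc_ne_zero z
      simp only [Complex.ofReal_one, one_mul]
      field_simp
    have := tendsto_nhds_unique h7 hlim
    exact inv_eq_one.1 this
  rw [qc, Complex.exp_eq_one_iff] at hq
  obtain ⟨k, hk⟩ := hq
  have hk' : a * b = k := by
    have h8 : (2 * Real.pi * I : ℂ) ≠ 0 := by simp [Real.pi_ne_zero]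
    have : ((a * b : ℝ) : ℂ) = k := mul_left_cancel₀ h8 (by rw [hk]; ring)
    exact_mod_cast this
  refine ⟨k, ?_⟩
  rcases (show a = 1 ∨ a = -1 from by simpa using ha2) with h | h
  · left
    ext i j
    rw [h] at hk' hdinv
    fin_cases i <;> fin_cases j <;> simp [transl, h0, ← ha, ← hb, ← hd, h, hdinv, ← hk']
  · right
    ext i j
    rw [h] at hk' hdinv
    change γ.1 i j = -(transl k).1 i j
    fin_cases i <;> fin_cases j <;>
      simp [transl, h0, ← ha, ← hb, ← hd, h, hdinv, ← hk']

end

/-- Scaled entries of products of upper triangular matrices. -/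
lemma IsHaupt.upM_mul_inv_mem {Γ : Subgroup SL2R} {J g : ℂ → ℂ} (H : IsHaupt Γ J g)
    {a d b a' d' b' : ℕ} (ha : 0 < a) (hd : 0 < d) (ha' : 0 < a') (hd' : 0 < d')
    (h : upM a d b * (upM a' d' b')⁻¹ ∈ Γ) :
    a * d' = a' * d ∧ ∃ k : ℤ, (b : ℤ) * d' = b' * d + k * (d * d') := by
  set γ := upM a d b * (upM a' d' b')⁻¹ with hγ
  have hmul : γ * upM a' d' b' = upM a d b := by rw [hγ]; group
  have h0 : γ.1 1 0 = 0 := by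
    have e1 : (upM a d b).1 1 0 = 0 := by rw [upM_coe b ha hd]; simp
    have e2 : (upM a' d' b').1 1 0 = 0 := by rw [upM_coe b' ha' hd']; simp
    simp [hγ, Matrix.mul_apply, Fin.sum_univ_two, Matrix.adjugate_fin_two, e1, e2]
  obtain ⟨k, hk⟩ := H.eq_transl h h0
  have hm : ∀ z ∈ UH, (a' * z + b') / d' + k = (a * z + b) / d := by
    intro z hz
    rw [← moebius_upM b ha hd, ← moebius_upM b' ha' hd', ← moebius_transl, ← hmul,
      moebius_mul _ _ hz]
    rcases hk with hk | hk
    · rw [hk]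
    · rw [hk, moebius_neg]
  have h1 := hm I (by simp [mem_UH])
  have h2 := hm (2 * I) (by simp [mem_UH])
  have hdc : (d : ℂ) ≠ 0 := by exact_mod_cast hd.ne'
  have hdc' : (d' : ℂ) ≠ 0 := by exact_mod_cast hd'.ne'
  have e1 : (a : ℂ) * d' = a' * d := by
    have : ((a : ℂ) * d' - a' * d) * I = 0 := by
      field_simp at h1 h2
      linear_combination h1 - h2
    rcases mul_eq_zero.1 this with h | h
    · exact sub_eq_zero.1 h
    · exact absurd h I_ne_zero
  refine ⟨by exact_mod_cast e1, k, ?_⟩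
  have : (b : ℂ) * d' = b' * d + k * (d * d') := by
    field_simp at h1
    linear_combination -h1 - I * e1
  exact_mod_cast this

end FrickeTrace

namespace FrickeTrace

open Filter Topology Asymptotics

lemma dslope_bounded {h : ℂ → ℂ} (hh : AnalyticAt ℂ h 0) :
    ∃ K : ℝ, ∀ᶠ x : ℂ × ℂ in 𝓝 (0, 0), ‖dslope h x.2 x.1‖ ≤ K := by
  have hs : HasStrictDerivAt h (deriv h 0) 0 := hh.hasStrictDerivAt
  have h1 := hs.hasStrictFDerivAt.isBigO_sub
  obtain ⟨K, hK⟩ := h1.bound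
  have h2 : ∀ᶠ y in 𝓝 (0 : ℂ), ‖deriv h y‖ < ‖deriv h 0‖ + 1 :=
    hh.deriv.continuousAt.norm.eventually (gt_mem_nhds (by linarith))
  have h3 : ∀ᶠ x : ℂ × ℂ in 𝓝 (0, 0), ‖deriv h x.2‖ < ‖deriv h 0‖ + 1 :=
    (continuous_snd.tendsto ((0 : ℂ), (0 : ℂ))).eventually h2
  refine ⟨max K (‖deriv h 0‖ + 1), ?_⟩
  filter_upwards [hK, h3] with x hx hx'
  by_cases e : x.1 = x.2
  · rw [e, dslope_same]
    exact hx'.le.trans (le_max_right _ _)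
  · rw [dslope_of_ne _ e, slope_def_field, norm_div]
    refine le_trans ?_ (le_max_left _ _)
    rwa [div_le_iff₀ (norm_pos_iff.2 (sub_ne_zero.2 e))]

lemma prod_one_sub_isLittleO {ι : Type*} (s : Finset ι) {U : ι → ℂ → ℂ}
    (hU : ∀ i ∈ s, U i =o[imInf] qc) :
    (fun z => ∏ i ∈ s, (1 - U i z) - (1 - ∑ i ∈ s, U i z)) =o[imInf] fun z => qc z ^ 2 := by
  classical
  induction s using Finset.induction_on with
  | empty => simp
  | insert i s hi ih =>
    have hi' := hU i (Finset.mem_insert_self _ _)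
    have hs' : ∀ j ∈ s, U j =o[imInf] qc := fun j hj => hU j (Finset.mem_insert_of_mem hj)
    have ih' := ih hs'
    have hS : (fun z => ∑ j ∈ s, U j z) =o[imInf] qc :=
      (IsLittleO.sum hs').congr_left fun z => Finset.sum_apply z s U
    have h1 : U i =O[imInf] fun _ => (1 : ℂ) := hi'.isBigO.trans qc_isLittleO_one.isBigO
    have h2 := h1.mul_isLittleO ih'
    have h3 := hi'.mul hS
    simp only [one_mul, ← pow_two] at h2 h3
    refine ((ih'.sub h2).add h3).congr_left fun z => ?_
    rw [Finset.prod_insert hi, Finset.sum_insert hi]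
    ring

lemma sum_root_pow {ζ : ℂ} {d i : ℕ} (hζ : IsPrimitiveRoot ζ d) :
    ∑ b ∈ Finset.range d, (ζ ^ b) ^ i = if d ∣ i then (d : ℂ) else 0 := by
  simp_rw [← pow_mul, fun b => mul_comm b i, pow_mul]
  split_ifs with h
  · rw [(hζ.pow_eq_one_iff_dvd i).2 h]; simp
  · have h1 : ζ ^ i ≠ 1 := fun h' => h ((hζ.pow_eq_one_iff_dvd i).1 h')
    rw [geom_sum_eq h1, ← pow_mul, mul_comm, pow_mul, hζ.pow_eq_one, one_pow, sub_self, zero_div]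

lemma prod_sub_root {ζ : ℂ} {d : ℕ} (hd : 0 < d) (hζ : IsPrimitiveRoot ζ d) (x y : ℂ) :
    ∏ b ∈ Finset.range d, (x - (ζ ^ b * y)⁻¹) = x ^ d - (y ^ d)⁻¹ := by
  classical
  have hζ' := hζ.inv
  rw [← inv_pow, hζ'.pow_sub_pow_eq_prod_sub_mul x y⁻¹ hd]
  refine Finset.prod_bij (fun b _ => ζ⁻¹ ^ b) ?_ ?_ ?_ ?_
  · intro b _
    rw [Polynomial.mem_nthRootsFinset hd, ← pow_mul, mul_comm, pow_mul, hζ'.pow_eq_one, one_pow]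
  · intro b hb b' hb' h
    exact hζ'.pow_inj (Finset.mem_range.1 hb) (Finset.mem_range.1 hb') h
  · intro w hw
    rw [Polynomial.mem_nthRootsFinset hd] at hw
    have : NeZero d := ⟨hd.ne'⟩
    obtain ⟨i, hi, rfl⟩ := hζ'.eq_pow_of_pow_eq_one hw
    exact ⟨i, Finset.mem_range.2 hi, rfl⟩
  · intro b _
    rw [mul_inv, inv_pow]

/-- The contribution of `q^{-x} - q^{-y}` with `δ = x - y`. -/
def kap (δ : ℤ) : ℂ := if δ = 1 ∨ δ = -1 then 1 else if δ = 2 ∨ δ = -2 then 2 else 0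

lemma kap_neg (δ : ℤ) : kap (-δ) = kap δ := by
  unfold kap
  congr 1
  · apply propext; omega
  · congr 1
    apply propext; omega

lemma jet_one_sub_qc_pow {k : ℕ} (hk : 0 < k) :
    HasJet (fun z => 1 - qc z ^ k) 0 (kap k) := by
  rcases Nat.lt_or_ge k 3 with h3 | h3
  · interval_cases k
    · have : Jet (fun z => 1 - qc z ^ 1) 1 (-1) 0 :=
        (isLittleO_zero _ _).congr_left fun z => by ring
      exact this.hasJet one_ne_zero (by norm_num [kap])
    · have : Jet (fun z => 1 - qc z ^ 2) 1 0 (-1) :=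
        (isLittleO_zero _ _).congr_left fun z => by ring
      exact this.hasJet one_ne_zero (by norm_num [kap])
  · have : Jet (fun z => 1 - qc z ^ k) 1 0 0 :=
      (qc_pow_isLittleO (k := k) (l := 2) (by omega)).neg_left.congr_left fun z => by ring
    refine this.hasJet one_ne_zero ?_
    have : kap k = 0 := by
      rw [kap, if_neg (by omega), if_neg (by omega)]
    rw [this]; ring

lemma jet_sub_zpow {x y : ℕ} (hxy : x ≠ y) :
    ∃ m, HasJet (fun z => qc z ^ (-x : ℤ) - qc z ^ (-y : ℤ)) m (kap (x - y)) := by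
  rcases lt_or_gt_of_ne hxy with h | h
  · refine ⟨_, (((hasJet_const (c := -1) (by norm_num)).mul (hasJet_qc_zpow (-y))).mul
      (jet_one_sub_qc_pow (k := y - x) (by omega))).congr' (Eventually.of_forall fun z => ?_) |>
        fun h => by
          rw [zero_add, zero_add, zero_add] at h
          have e : ((y - x : ℕ) : ℤ) = -((x : ℤ) - y) := by omega
          rw [e, kap_neg] at h
          exact h⟩
    simp only
    have e2 : qc z ^ (-x : ℤ) = qc z ^ (-y : ℤ) * qc z ^ ((y - x : ℕ) : ℤ) := by
      rw [← zpow_add₀ (qc_ne_zero z)]; congr 1; omega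
    rw [← zpow_natCast, e2]; ring
  · refine ⟨_, ((hasJet_qc_zpow (-x)).mul
      (jet_one_sub_qc_pow (k := x - y) (by omega))).congr' (Eventually.of_forall fun z => ?_) |>
        fun h => by
          have e : ((x - y : ℕ) : ℤ) = ((x : ℤ) - y) := by omega
          rw [zero_add, e] at h
          exact h⟩
    simp only
    rw [← zpow_natCast, mul_sub, ← zpow_add₀ (qc_ne_zero z)]
    have : (-(x : ℤ) + ((x - y : ℕ) : ℤ)) = -y := by omega
    rw [this]; ring

lemma upM_trivial {s d : ℕ} (hs : 0 < s) (hd : 0 < d) : upM (s * d) d 0 = upM s 1 0 := by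
  have e : Real.sqrt (s * d * d : ℕ) = d * Real.sqrt s := by
    rw [mul_assoc, mul_comm, Nat.cast_mul, Nat.cast_mul, Real.sqrt_mul (by positivity),
      Real.sqrt_mul_self (by positivity)]
  have h1 : (0 : ℝ) < Real.sqrt s := Real.sqrt_pos.2 (by exact_mod_cast hs)
  have h2 : (0 : ℝ) < d := by exact_mod_cast hd
  apply Subtype.ext
  rw [upM_coe 0 (Nat.mul_pos hs hd) hd, upM_coe 0 hs one_pos, e]
  ext i j
  fin_cases i <;> fin_cases j <;> simp <;> field_simp

section
variable {Γ : Subgroup SL2R} {J g : ℂ → ℂ}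

lemma IsHaupt.trivial_iff (H : IsHaupt Γ J g) {s a d b : ℕ} (hs : 0 < s) (ha : 0 < a) (hb : b < d) :
    upM a d b * (upM s 1 0)⁻¹ ∈ Γ ↔ a = s * d ∧ b = 0 := by
  have hd : 0 < d := by omega
  constructor
  · intro h
    obtain ⟨h1, k, hk⟩ := H.upM_mul_inv_mem ha hd hs one_pos h
    refine ⟨by simpa using h1, ?_⟩
    have h2 : (d : ℤ) ∣ b := ⟨k, by push_cast at hk; linarith⟩
    exact Nat.eq_zero_of_dvd_of_lt (by exact_mod_cast h2) hb
  · rintro ⟨rfl, rfl⟩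
    rw [upM_trivial hs hd, mul_inv_cancel]
    exact Γ.one_mem

lemma IsHaupt.analyticAt_g_zero (H : IsHaupt Γ J g) : AnalyticAt ℂ g 0 :=
  (H.gdiff.analyticOnNhd Metric.isOpen_ball) 0 (by simp)

/-- The factor splits into its principal part and a factor close to `1`. -/
lemma IsHaupt.fac_eq (H : IsHaupt Γ J g) {s a d b : ℕ} (hs : 0 < s) (ha : 0 < a) (hb : b < d)
    {z : ℂ} (hz : z ∈ UH) :
    fac Γ J (upM s 1 0) (upM a d b) z =
      (if a = s * d ∧ b = 0 then -(2 * Real.pi * I * s) * (qc z ^ s)⁻¹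
        else (qc z ^ s)⁻¹ - (qc ((a * z + b) / d))⁻¹) *
      (1 - qc z ^ s * qc ((a * z + b) / d) * dslope g (qc ((a * z + b) / d)) (qc z ^ s)) := by
  have hd : 0 < d := by omega
  have hP0 : qc z ^ s ≠ 0 := pow_ne_zero _ (qc_ne_zero z)
  have hα : ∀ w ∈ UH, J (moebius (upM s 1 0) w) = (qc w ^ s)⁻¹ + g (qc w ^ s) := by
    intro w hw
    rw [H.qexp _ (moebius_mem _ hw), moebius_upM 0 hs one_pos]
    simp [qc_nat_mul]
  by_cases ht : a = s * d ∧ b = 0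
  · rw [fac, if_pos ((H.trivial_iff hs ha hb).2 ht), if_pos ht]
    have hQ : qc ((a * z + b) / d) = qc z ^ s := by
      rw [← qc_nat_mul, ht.1, ht.2]
      have : (d : ℂ) ≠ 0 := by exact_mod_cast hd.ne'
      congr 1
      push_cast
      field_simp
      ring
    rw [hQ, dslope_same]
    have hev : (fun w => J (moebius (upM s 1 0) w)) =ᶠ[𝓝 z]
        fun w => (qc w ^ s)⁻¹ + g (qc w ^ s) := by
      filter_upwards [isOpen_UH.mem_nhds hz] with w hw using hα w hw
    rw [hev.deriv_eq]
    have h1 := (hasDerivAt_qc z).pow s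
    have hg : HasDerivAt g (deriv g (qc z ^ s)) (qc z ^ s) := by
      refine (H.gdiff.differentiableAt (Metric.isOpen_ball.mem_nhds ?_)).hasDerivAt
      rw [← qc_nat_mul]
      apply qc_mem_ball
      simp only [mem_UH] at hz ⊢
      simp only [mul_im, natCast_re, natCast_im, zero_mul, add_zero]
      positivity
    have h2 := (h1.inv hP0).add (hg.comp z h1)
    have h3 : deriv (fun w => (qc w ^ s)⁻¹ + g (qc w ^ s)) z = _ := h2.deriv
    rw [h3]
    obtain ⟨t, rfl⟩ : ∃ t, s = t + 1 := ⟨s - 1, by omega⟩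
    have := qc_ne_zero z
    simp only [Nat.add_sub_cancel, Pi.pow_apply]
    field_simp
    ring
  · rw [fac, if_neg (fun h => ht ((H.trivial_iff hs ha hb).1 h)), if_neg ht, hα z hz,
      H.qexp _ (moebius_mem _ hz), moebius_upM b ha hd]
    generalize hQ : qc ((a * z + b) / d) = Q
    have hQ0 : Q ≠ 0 := hQ ▸ qc_ne_zero _
    have h1 := sub_smul_dslope g Q (qc z ^ s)
    rw [smul_eq_mul] at h1
    generalize qc z ^ s = P at *
    have h2 : P⁻¹ - Q⁻¹ = (Q - P) * (P * Q)⁻¹ := by field_simp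
    rw [mul_sub, mul_one]
    have h3 : (P⁻¹ - Q⁻¹) * (P * Q * dslope g Q P) = -((P - Q) * dslope g Q P) := by
      rw [h2]; field_simp; ring
    rw [h3, h1]; ring

/-- The jet of the product of the factors of all the cosets with a given diagonal. -/
lemma IsHaupt.jet_pair (H : IsHaupt Γ J g) {s a d : ℕ} (hs : 0 < s) (ha : 0 < a) (hd : 0 < d) :
    ∃ m, HasJet (fun z => ∏ b ∈ Finset.range d, fac Γ J (upM s 1 0) (upM a d b) z) m
      (kap ((s * d : ℕ) - (a : ℤ)) +
        if s = 1 ∧ a = 1 then 2 * d * (iteratedDeriv d g 0 / d.factorial) else 0) := by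
  set ζ : ℂ := Complex.exp (2 * Real.pi * I / d) with hζdef
  have hζ : IsPrimitiveRoot ζ d := Complex.isPrimitiveRoot_exp d hd.ne'
  have hdc : (d : ℂ) ≠ 0 := by exact_mod_cast hd.ne'
  set Q : ℂ → ℂ := fun z => qc (a * z / d) with hQdef
  have hQb : ∀ (b : ℕ) (z : ℂ), qc ((a * z + b) / d) = ζ ^ b * Q z := by
    intro b z
    rw [add_div, qc_add, mul_comm]
    congr 1
    rw [qc, hζdef, ← Complex.exp_nat_mul]
    congr 1
    ring
  have hQd : ∀ z, Q z ^ d = qc z ^ a := by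
    intro z
    rw [hQdef, ← qc_nat_mul, ← qc_nat_mul]
    congr 1
    field_simp
  have hQt : Tendsto Q imInf (𝓝 0) := by
    refine (qc_tendsto_zero.comp (tendsto_upM 0 ha hd)).congr fun z => ?_
    rw [Function.comp, moebius_upM 0 ha hd]; simp [hQdef]
  have hPt : Tendsto (fun z => qc z ^ s) imInf (𝓝 0) := by
    have := qc_tendsto_zero.pow s
    rwa [zero_pow hs.ne'] at this
  have hQbt : ∀ b : ℕ, Tendsto (fun z => ζ ^ b * Q z) imInf (𝓝 0) := by
    intro b
    have := hQt.const_mul (ζ ^ b)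
    rwa [mul_zero] at this
  have hQbo : ∀ b : ℕ, (fun z => ζ ^ b * Q z) =o[imInf] fun _ => (1 : ℂ) := fun b =>
    (isLittleO_one_iff ℂ).2 (hQbt b)
  have hPO : ∀ k : ℕ, (fun z => (qc z ^ s) ^ k) =O[imInf] fun z => qc z ^ k := by
    intro k
    rcases Nat.lt_or_ge 1 s with h | h
    · rcases Nat.eq_zero_or_pos k with rfl | hk
      · simp only [pow_zero]; exact isBigO_refl _ _
      · simp_rw [← pow_mul]
        exact (qc_pow_isLittleO (by nlinarith)).isBigO
    · have : s = 1 := by omega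
      simp only [this, pow_one]; exact isBigO_refl _ _
  -- Taylor coefficients of `g` and the difference quotient of `g(w)/w`
  obtain ⟨c, hc0, -, hc, hcO⟩ := taylor_isBigO H.analyticAt_g_zero
  rw [H.g_zero] at hc0
  set h := dslope g 0 with hh
  have hgh : ∀ w, g w = w * h w := by
    intro w
    have := eq_mul_dslope (f := g) (z₀ := 0) H.g_zero w
    rwa [sub_zero] at this
  have han : AnalyticAt ℂ h 0 := analyticAt_dslope H.analyticAt_g_zero
  obtain ⟨K, hK⟩ := dslope_bounded han
  set U : ℕ → ℂ → ℂ := fun b z => qc z ^ s * (ζ ^ b * Q z) * dslope g (ζ ^ b * Q z) (qc z ^ s)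
    with hU
  set V : ℕ → ℂ → ℂ := fun b z => (qc z ^ s) ^ 2 * ((ζ ^ b * Q z) * dslope h (ζ ^ b * Q z) (qc z ^ s))
    with hV
  have hUV : ∀ b, ∀ᶠ z in imInf, U b z = qc z ^ s * g (ζ ^ b * Q z) + V b z := by
    intro b
    have hd0 : ∀ᶠ w in 𝓝 (0 : ℂ), DifferentiableAt ℂ h w :=
      han.eventually_analyticAt.mono fun w hw => hw.differentiableAt
    filter_upwards [(hQbt b).eventually hd0] with z hz
    simp only [hU, hV]
    generalize ζ ^ b * Q z = w at *
    generalize qc z ^ s = P at *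
    have key : dslope g w P = h w + P * dslope h w P := by
      by_cases e : P = w
      · subst e
        rw [dslope_same, dslope_same]
        have h1 : HasDerivAt (fun w => w * h w) (1 * h P + P * deriv h P) P :=
          (hasDerivAt_id P).mul hz.hasDerivAt
        have : g = fun w => w * h w := funext hgh
        rw [this, h1.deriv, one_mul]
      · rw [dslope_of_ne _ e, dslope_of_ne _ e, slope_def_field, slope_def_field, hgh P, hgh w]
        have := sub_ne_zero.2 e
        field_simp
        ring
    rw [key, hgh w]; ring
  have hVo : ∀ b, V b =o[imInf] fun z => qc z ^ 2 := by
    intro b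
    have h1 : (fun z => dslope h (ζ ^ b * Q z) (qc z ^ s)) =O[imInf] fun _ => (1 : ℂ) := by
      refine IsBigO.of_bound K ?_
      have := (hPt.prodMk_nhds (hQbt b)).eventually hK
      filter_upwards [this] with z hz
      simpa using hz
    have h2 := (hPO 2).mul_isLittleO ((hQbo b).mul_isBigO h1)
    simpa using h2
  have hgO : ∀ b : ℕ, (fun z => g (ζ ^ b * Q z)) =o[imInf] fun _ => (1 : ℂ) := by
    intro b
    refine (isLittleO_one_iff ℂ).2 ?_
    have := H.continuousAt_g_zero.tendsto.comp (hQbt b)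
    rw [H.g_zero] at this
    exact this
  have hUo : ∀ b, U b =o[imInf] qc := by
    intro b
    have h1 := (hPO 1).mul_isLittleO (hgO b)
    simp only [pow_one, mul_one] at h1
    have h2 : (fun z => qc z ^ 2) =O[imInf] qc := by
      have := (qc_pow_isLittleO (k := 2) (l := 1) (by norm_num)).isBigO
      simpa using this
    exact (h1.add ((hVo b).trans_isBigO h2)).congr' ((hUV b).mono fun z hz => hz.symm)
      EventuallyEq.rfl
  have hsumg : (fun z => ∑ b ∈ Finset.range d, g (ζ ^ b * Q z) - d * c d * qc z ^ a) =o[imInf]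
      fun z => qc z ^ a := by
    have h1 : ∀ b ∈ Finset.range d, (fun z => g (ζ ^ b * Q z) -
        ∑ i ∈ Finset.range (d + 1), c i * (ζ ^ b * Q z) ^ i) =o[imInf] fun z => qc z ^ a := by
      intro b _
      have h2 := (hcO (d + 1)).comp_tendsto (hQbt b)
      refine h2.trans_isLittleO ?_
      have h3 : (fun z => (ζ ^ b) ^ d * qc z ^ a) =O[imInf] fun z => qc z ^ a :=
        isBigO_const_mul_self _ _ _
      have h4 := h3.mul_isLittleO (hQbo b)
      simp only [mul_one] at h4
      refine h4.congr_left fun z => ?_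
      simp only [Function.comp]
      rw [pow_succ, mul_pow, hQd]
    refine (IsLittleO.sum h1).congr_left fun z => ?_
    simp only [Finset.sum_apply, Finset.sum_sub_distrib]
    congr 1
    rw [Finset.sum_comm]
    have h5 : ∀ i ∈ Finset.range (d + 1), ∑ b ∈ Finset.range d, c i * (ζ ^ b * Q z) ^ i =
        if i = d then d * c d * qc z ^ a else 0 := by
      intro i hi
      have hi' := Finset.mem_range.1 hi
      simp_rw [mul_pow, ← mul_assoc, ← Finset.sum_mul, ← Finset.mul_sum, sum_root_pow hζ]
      by_cases hid : i = d
      · rw [if_pos hid, hid, if_pos dvd_rfl, hQd]; ring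
      · rw [if_neg hid]
        split_ifs with hdv
        · have : i = 0 := Nat.eq_zero_of_dvd_of_lt hdv (by omega)
          rw [this, hc0]; ring
        · ring
    rw [Finset.sum_congr rfl h5]
    simp
  have hsumU : (fun z => ∑ b ∈ Finset.range d, U b z -
      (if s = 1 ∧ a = 1 then d * c d else 0) * qc z ^ 2) =o[imInf] fun z => qc z ^ 2 := by
    have h1 : (fun z => ∑ b ∈ Finset.range d, V b z) =o[imInf] fun z => qc z ^ 2 :=
      (IsLittleO.sum fun b _ => hVo b).congr_left fun z => Finset.sum_apply z _ V
    have h2 : (fun z => qc z ^ s * (∑ b ∈ Finset.range d, g (ζ ^ b * Q z) - d * c d * qc z ^ a))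
        =o[imInf] fun z => qc z ^ 2 := by
      have h3 := (hPO 1).mul_isLittleO hsumg
      simp only [pow_one, ← pow_succ'] at h3
      refine h3.trans_isBigO ?_
      rcases Nat.lt_or_ge 1 a with h | h
      · exact (qc_pow_isLittleO (by omega)).isBigO
      · have : a = 1 := by omega
        rw [this]; exact isBigO_refl _ _
    have h4 : (fun z => d * c d * qc z ^ (s + a) -
        (if s = 1 ∧ a = 1 then d * c d else 0) * qc z ^ 2) =o[imInf] fun z => qc z ^ 2 := by
      split_ifs with hsa
      · rw [hsa.1, hsa.2]; simp
      · simp only [zero_mul, sub_zero]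
        exact (qc_pow_isLittleO (by omega)).const_mul_left _
    have hall : ∀ᶠ z in imInf, ∀ b ∈ Finset.range d,
        U b z = qc z ^ s * g (ζ ^ b * Q z) + V b z :=
      (Finset.eventually_all _).2 fun b _ => hUV b
    refine ((h1.add h2).add h4).congr' (hall.mono fun z hz => ?_) EventuallyEq.rfl
    simp only
    rw [Finset.sum_congr rfl hz, Finset.sum_add_distrib, pow_add, mul_sub, Finset.mul_sum]
    ring
  have hjetU : HasJet (fun z => ∏ b ∈ Finset.range d, (1 - U b z)) 0
      (if s = 1 ∧ a = 1 then 2 * d * (iteratedDeriv d g 0 / d.factorial) else 0) := by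
    have h1 := prod_one_sub_isLittleO (Finset.range d) fun b _ => hUo b
    have h2 : Jet (fun z => ∏ b ∈ Finset.range d, (1 - U b z)) 1 0
        (-(if s = 1 ∧ a = 1 then d * c d else 0)) := by
      refine (h1.sub hsumU).congr_left fun z => ?_
      ring
    refine h2.hasJet one_ne_zero ?_
    rw [← hc d]
    split_ifs <;> ring
  have hjetL : ∃ m, HasJet (fun z => ∏ b ∈ Finset.range d,
      (if a = s * d ∧ b = 0 then -(2 * Real.pi * I * s) * (qc z ^ s)⁻¹
        else (qc z ^ s)⁻¹ - (ζ ^ b * Q z)⁻¹)) m (kap ((s * d : ℕ) - (a : ℤ))) := by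
    by_cases hsd : a = s * d
    · have hk : kap ((s * d : ℕ) - (a : ℤ)) = 0 := by
        rw [hsd, sub_self, kap, if_neg (by omega), if_neg (by omega)]
      rw [hk]
      have hQs : ∀ z, Q z = qc z ^ s := by
        intro z
        rw [hQdef, ← qc_nat_mul, hsd]
        push_cast
        field_simp
      have hb : ∀ b ∈ Finset.range d, HasJet (fun z => if a = s * d ∧ b = 0 then
          -(2 * Real.pi * I * s) * (qc z ^ s)⁻¹ else (qc z ^ s)⁻¹ - (ζ ^ b * Q z)⁻¹) (-s) 0 := by
        intro b hb
        have hq : HasJet (fun z => (qc z ^ s)⁻¹) (-s) 0 :=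
          (hasJet_qc_zpow (-s)).congr' (Eventually.of_forall fun z => by simp)
        by_cases hb0 : b = 0
        · simp only [hsd, hb0, true_and, if_true]
          have hc1 : -(2 * Real.pi * I * s : ℂ) ≠ 0 := by
            simp [Real.pi_ne_zero, hs.ne']
          simpa using (hasJet_const hc1).mul hq
        · simp only [hb0, and_false, if_false, hQs]
          have hne : (ζ ^ b)⁻¹ ≠ 1 := by
            rw [Ne, inv_eq_one, hζ.pow_eq_one_iff_dvd]
            intro hdv
            exact hb0 (Nat.eq_zero_of_dvd_of_lt hdv (Finset.mem_range.1 hb))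
          have := (hasJet_const (sub_ne_zero.2 hne.symm)).mul hq
          rw [zero_add, zero_add] at this
          refine this.congr' (Eventually.of_forall fun z => ?_)
          simp only
          rw [mul_inv]; ring
      have := HasJet.prod (Finset.range d) hb
      rw [Finset.sum_const_zero] at this
      exact ⟨_, this⟩
    · obtain ⟨m, hm⟩ := jet_sub_zpow (x := s * d) (y := a) (Ne.symm hsd)
      refine ⟨m, hm.congr' (Eventually.of_forall fun z => ?_)⟩
      simp only [hsd, false_and, if_false]
      rw [prod_sub_root hd hζ, hQd, inv_pow, ← pow_mul]
      simp [_root_.zpow_neg, ← zpow_natCast]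
  obtain ⟨m, hm⟩ := hjetL
  refine ⟨m + 0, (hm.mul hjetU).congr' ?_⟩
  filter_upwards [eventually_imInf_UH] with z hz
  rw [← Finset.prod_mul_distrib]
  refine Finset.prod_congr rfl fun b hb => ?_
  rw [H.fac_eq hs ha (Finset.mem_range.1 hb) hz, hQb]

end

end FrickeTrace

namespace FrickeTrace

open Filter Topology Asymptotics

section
variable {Γ : Subgroup SL2R} {J g : ℂ → ℂ}

lemma IsHaupt.hasJet_sub (H : IsHaupt Γ J g) (x : ℂ) :
    HasJet (fun z => J z - x) (-1) (x ^ 2 - 2 * deriv g 0) := by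
  have h1 := jet_comp_qc H.analyticAt_g_zero
  rw [H.g_zero] at h1
  have h2 : Jet (fun z => (J z - x) * qc z ^ (-(-1) : ℤ)) 1 (-x) (deriv g 0) := by
    have h3 : (fun z => qc z * (g (qc z) - (0 + deriv g 0 * qc z +
        iteratedDeriv 2 g 0 / 2 * qc z ^ 2))) =o[imInf] fun z => qc z ^ 2 := by
      have := qc_isLittleO_one.isBigO.mul_isLittleO h1
      simpa using this
    have h4 : (fun z => iteratedDeriv 2 g 0 / 2 * qc z ^ 3) =o[imInf] fun z => qc z ^ 2 :=
      (qc_pow_isLittleO (by norm_num)).const_mul_left _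
    refine (h3.add h4).congr' ?_ EventuallyEq.rfl
    filter_upwards [eventually_imInf_UH] with z hz
    rw [H.qexp z hz, neg_neg, zpow_one]
    have := qc_ne_zero z
    field_simp
    ring
  exact ⟨1, -x, deriv g 0, one_ne_zero, by ring, h2⟩

lemma HasJet.eventually_ne_zero {F : ℂ → ℂ} {m : ℤ} {κ : ℂ} (h : HasJet F m κ) :
    ∀ᶠ z in imInf, F z ≠ 0 := by
  obtain ⟨A, B, C, hA, -, hj⟩ := h
  filter_upwards [hj.tendsto.eventually_ne hA] with z hz h0
  exact hz (by rw [h0, zero_mul])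

lemma IsHaupt.hasJet_eval (H : IsHaupt Γ J g) {Q : Polynomial ℂ} (hQ : Q ≠ 0) :
    ∃ m, HasJet (fun z => Q.eval (J z)) m
      (∑ x ∈ Q.roots.toFinset, (Q.rootMultiplicity x : ℂ) * (x ^ 2 - 2 * deriv g 0)) := by
  classical
  have h1 := HasJet.prod Q.roots.toFinset (F := fun x z => (J z - x) ^ Q.rootMultiplicity x)
    fun x _ => (H.hasJet_sub x).pow (Q.rootMultiplicity x)
  have h2 := (hasJet_const (Polynomial.leadingCoeff_ne_zero.2 hQ)).mul h1
  rw [zero_add, zero_add] at h2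
  refine ⟨_, h2.congr' (Eventually.of_forall fun z => ?_)⟩
  simp only
  rw [(IsAlgClosed.splits Q).eval_eq_prod_roots, Finset.prod_multiset_map_count]
  simp [Polynomial.count_roots]

lemma IsHaupt.order_eval (H : IsHaupt Γ J g) {Q : Polynomial ℂ} (hQ : Q ≠ 0) {z : ℂ} (hz : z ∈ UH) :
    analyticOrderAt (fun w => Q.eval (J w)) z = (Q.rootMultiplicity (J z) * ram J z : ℕ) := by
  obtain ⟨R, hR, hnd⟩ := Polynomial.exists_eq_pow_rootMultiplicity_mul_and_not_dvd Q hQ (J z)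
  have hJ := H.analyticAt hz
  have e : (fun w => Q.eval (J w)) =
      (fun w => J w - J z) ^ (Q.rootMultiplicity (J z)) * fun w => R.eval (J w) := by
    funext w
    conv_lhs => rw [hR]
    simp
  have h1 : AnalyticAt ℂ (fun w => J w - J z) z := hJ.sub analyticAt_const
  have h2 : AnalyticAt ℂ (fun w => R.eval (J w)) z :=
    AnalyticAt.comp ((AnalyticOnNhd.eval_polynomial R) _ (Set.mem_univ _)) hJ
  rw [e, analyticOrderAt_mul (h1.pow _) h2, analyticOrderAt_pow h1, H.order_eq_ram hz,
    h2.analyticOrderAt_eq_zero.2, add_zero]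
  · simp
  · intro h0
    exact hnd (Polynomial.dvd_iff_isRoot.2 h0)

/-- The valence formula weighted by `x² - 2 c₁`. -/
lemma IsHaupt.weighted_valence (H : IsHaupt Γ J g) {D F : ℂ → ℂ} {mD m : ℤ} {κD κ : ℂ} {w : ℕ}
    (hD : DifferentiableOn ℂ D UH) (hD0 : ∀ z ∈ UH, D z ≠ 0)
    (hDw : ∀ γ ∈ Γ, ∀ z ∈ UH, D (moebius γ z) = den γ z ^ 24 * D z) (hDj : HasJet D mD κD)
    (hF : DifferentiableOn ℂ F UH)
    (hFw : ∀ γ ∈ Γ, ∀ z ∈ UH, F (moebius γ z) = den γ z ^ (2 * w) * F z) (hFj : HasJet F m κ)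
    {o : ℂ → ℕ} (ho : ∀ z ∈ UH, analyticOrderAt F z = o z)
    {sec : ℂ → ℂ} (hsec : ∀ x, sec x ∈ UH ∧ J (sec x) = x) :
    {x | o (sec x) ≠ 0}.Finite ∧
      ∑ᶠ x, (x ^ 2 - 2 * deriv g 0) * ((o (sec x) : ℂ) / ram J (sec x)) = κ - w / 12 * κD := by
  classical
  set G : ℂ → ℂ := fun z => F z ^ 12 / D z ^ w with hG
  have hGd : DifferentiableOn ℂ G UH :=
    (hF.pow 12).div (hD.pow w) fun z hz => pow_ne_zero _ (hD0 z hz)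
  have hGi : ∀ γ ∈ Γ, ∀ z ∈ UH, G (moebius γ z) = G z := by
    intro γ hγ z hz
    simp only [hG]
    rw [hFw γ hγ z hz, hDw γ hγ z hz]
    have h1 := den_ne_zero γ hz
    have h2 := hD0 z hz
    have e : (den γ z ^ (2 * w) * F z) ^ 12 = (den γ z ^ 24) ^ w * F z ^ 12 := by ring
    rw [e, mul_pow, mul_div_mul_left _ _ (pow_ne_zero _ (pow_ne_zero _ h1))]
  have hF12 := hFj.pow 12
  have hDwj := hDj.pow w
  have hGb : ∃ N : ℕ, ∃ K : ℝ, ∀ᶠ z in imInf, ‖G z * qc z ^ N‖ ≤ K := by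
    obtain ⟨A, B, C, hA, -, hj⟩ := hF12
    obtain ⟨A', B', C', hA', -, hj'⟩ := hDwj
    have ht := hj.tendsto.div hj'.tendsto hA'
    push_cast at ht
    set k : ℤ := 12 * m - w * mD with hk
    refine ⟨(-k).toNat, ‖A / A'‖ + 1, ?_⟩
    have hb := ht.norm.eventually (gt_mem_nhds (lt_add_one _))
    filter_upwards [hb, eventually_imInf_UH] with z hz hz'
    have hq := qc_ne_zero z
    have hd := hD0 z hz'
    have e : G z * qc z ^ (-k).toNat = (F z ^ 12 * qc z ^ (-(12 * m))) /
        (D z ^ w * qc z ^ (-(w * mD))) * qc z ^ (k + (-k).toNat) := by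
      have : qc z ^ (k + ((-k).toNat : ℤ)) =
          qc z ^ (12 * m) * (qc z ^ (w * mD))⁻¹ * qc z ^ (-k).toNat := by
        rw [zpow_add₀ hq, hk, zpow_sub₀ hq, zpow_natCast, div_eq_mul_inv]
      rw [this, _root_.zpow_neg, _root_.zpow_neg]
      simp only [hG]
      have h1 : qc z ^ (12 * m) ≠ 0 := zpow_ne_zero _ hq
      have h2 : qc z ^ (w * mD) ≠ 0 := zpow_ne_zero _ hq
      field_simp
    have hn : ‖qc z ^ (k + ((-k).toNat : ℤ))‖ ≤ 1 := by
      obtain ⟨n, hn⟩ : ∃ n : ℕ, k + ((-k).toNat : ℤ) = n := ⟨(k + ((-k).toNat : ℤ)).toNat, by omega⟩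
      rw [hn, zpow_natCast, norm_pow]
      exact pow_le_one₀ (norm_nonneg _) (norm_qc_lt_one hz').le
    rw [e, norm_mul]
    calc _ ≤ (‖A / A'‖ + 1) * 1 := mul_le_mul hz.le hn (norm_nonneg _) (by positivity)
      _ = _ := mul_one _
  obtain ⟨N, hGb⟩ := hGb
  obtain ⟨Q, hQ⟩ := H.exists_polynomial N hGd hGi hGb
  have hFQ : ∀ z ∈ UH, F z ^ 12 = Q.eval (J z) * D z ^ w := by
    intro z hz
    rw [← hQ z hz]
    exact (div_mul_cancel₀ _ (pow_ne_zero _ (hD0 z hz))).symm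
  have hQ0 : Q ≠ 0 := by
    rintro rfl
    obtain ⟨z, hz1, hz2⟩ := (hFj.eventually_ne_zero.and eventually_imInf_UH).exists
    have := hFQ z hz2
    simp at this
    exact hz1 this
  obtain ⟨m', hQj⟩ := H.hasJet_eval hQ0
  have hκ := ((hQj.mul hDwj).congr' (by
    filter_upwards [eventually_imInf_UH] with z hz
    exact (hFQ z hz).symm)).unique hF12
  have hord : ∀ x, 12 * o (sec x) = Q.rootMultiplicity x * ram J (sec x) := by
    intro x
    obtain ⟨hx, hx'⟩ := hsec x
    have h1 := H.order_eval hQ0 hx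
    rw [hx'] at h1
    have hFa : AnalyticAt ℂ F (sec x) := analyticOnNhd_UH hF _ hx
    have hDa : AnalyticAt ℂ D (sec x) := analyticOnNhd_UH hD _ hx
    have h2 : analyticOrderAt (F ^ 12) (sec x) = (12 * o (sec x) : ℕ) := by
      rw [analyticOrderAt_pow hFa, ho _ hx]; simp
    have h3 : F ^ 12 =ᶠ[𝓝 (sec x)] (fun z => Q.eval (J z)) * D ^ w := by
      filter_upwards [isOpen_UH.mem_nhds hx] with z hz
      exact hFQ z hz
    have hQa : AnalyticAt ℂ (fun z => Q.eval (J z)) (sec x) :=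
      AnalyticAt.comp ((AnalyticOnNhd.eval_polynomial Q) _ (Set.mem_univ _)) (H.analyticAt hx)
    rw [analyticOrderAt_congr h3, analyticOrderAt_mul hQa (hDa.pow w), h1,
      (hDa.pow w).analyticOrderAt_eq_zero.2 (pow_ne_zero _ (hD0 _ hx)), add_zero] at h2
    exact_mod_cast h2.symm
  have hram : ∀ x, (ram J (sec x) : ℂ) ≠ 0 := fun x => by
    exact_mod_cast H.ram_ne_zero (hsec x).1
  have hmult : ∀ x, (o (sec x) : ℂ) / ram J (sec x) = Q.rootMultiplicity x / 12 := by
    intro x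
    rw [div_eq_div_iff (hram x) (by norm_num)]
    have := hord x
    have h : (12 * o (sec x) : ℂ) = Q.rootMultiplicity x * ram J (sec x) := by exact_mod_cast this
    linear_combination h
  have hsub : ∀ x, Q.rootMultiplicity x ≠ 0 → x ∈ Q.roots.toFinset := by
    intro x hx
    rw [Multiset.mem_toFinset, Polynomial.mem_roots hQ0]
    by_contra h
    exact hx (Polynomial.rootMultiplicity_eq_zero h)
  constructor
  · refine (Q.roots.toFinset.finite_toSet).subset fun x hx => hsub x fun h0 => hx ?_
    have := hord x
    rw [h0, zero_mul] at this
    omega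
  · rw [finsum_eq_sum_of_support_subset (s := Q.roots.toFinset)]
    · have h12 : ((12 : ℕ) : ℂ) * κ = _ := hκ.2.symm
      have : ∑ x ∈ Q.roots.toFinset, (x ^ 2 - 2 * deriv g 0) *
          ((o (sec x) : ℂ) / ram J (sec x)) = (∑ x ∈ Q.roots.toFinset,
          (Q.rootMultiplicity x : ℂ) * (x ^ 2 - 2 * deriv g 0)) / 12 := by
        rw [Finset.sum_div]
        refine Finset.sum_congr rfl fun x _ => ?_
        rw [hmult]; ring
      rw [this]
      push_cast at h12
      linear_combination -h12 / 12
    · intro x hx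
      refine hsub x fun h0 => hx ?_
      simp only [hmult, h0]
      simp

end

end FrickeTrace

namespace FrickeTrace

open Filter Topology

/-- `√m X` is the integral matrix `[[a, b], [c, d]]`. -/
def Rep (m : ℕ) (X : SL2R) (a b c d : ℤ) : Prop :=
  Real.sqrt m * X.1 0 0 = a ∧ Real.sqrt m * X.1 0 1 = b ∧
    Real.sqrt m * X.1 1 0 = c ∧ Real.sqrt m * X.1 1 1 = d

lemma ext_entries {X Y : SL2R} (h00 : X.1 0 0 = Y.1 0 0) (h01 : X.1 0 1 = Y.1 0 1)
    (h10 : X.1 1 0 = Y.1 1 0) (h11 : X.1 1 1 = Y.1 1 1) : X = Y := by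
  apply Subtype.ext
  ext i j
  fin_cases i <;> fin_cases j <;> assumption

lemma mul_entry (X Y : SL2R) (i j : Fin 2) :
    (X * Y).1 i j = X.1 i 0 * Y.1 0 j + X.1 i 1 * Y.1 1 j := by
  change (X.1 * Y.1) i j = _
  rw [Matrix.mul_apply, Fin.sum_univ_two]

lemma inv_entries (X : SL2R) : (X⁻¹).1 0 0 = X.1 1 1 ∧ (X⁻¹).1 0 1 = -X.1 0 1 ∧
    (X⁻¹).1 1 0 = -X.1 1 0 ∧ (X⁻¹).1 1 1 = X.1 0 0 := by
  simp [Matrix.adjugate_fin_two]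

section
variable {m n : ℕ} {X Y : SL2R} {a b c d a' b' c' d' : ℤ}

lemma sqrt_nat_sq (m : ℕ) : Real.sqrt m * Real.sqrt m = m := Real.mul_self_sqrt (by positivity)

lemma Rep.mul (hX : Rep m X a b c d) (hY : Rep n Y a' b' c' d') :
    Rep (m * n) (X * Y) (a * a' + b * c') (a * b' + b * d') (c * a' + d * c') (c * b' + d * d') := by
  obtain ⟨h1, h2, h3, h4⟩ := hX
  obtain ⟨k1, k2, k3, k4⟩ := hY
  have e : Real.sqrt (m * n : ℕ) = Real.sqrt m * Real.sqrt n := by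
    rw [Nat.cast_mul, Real.sqrt_mul (by positivity)]
  refine ⟨?_, ?_, ?_, ?_⟩ <;> rw [e, mul_entry] <;> push_cast
  · rw [← h1, ← h2, ← k1, ← k3]; ring
  · rw [← h1, ← h2, ← k2, ← k4]; ring
  · rw [← h3, ← h4, ← k1, ← k3]; ring
  · rw [← h3, ← h4, ← k2, ← k4]; ring

lemma Rep.inv (hX : Rep m X a b c d) : Rep m X⁻¹ d (-b) (-c) a := by
  obtain ⟨h1, h2, h3, h4⟩ := hX
  obtain ⟨e1, e2, e3, e4⟩ := inv_entries X
  refine ⟨?_, ?_, ?_, ?_⟩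
  · rw [e1, h4]
  · rw [e2, mul_neg, h2]; push_cast; rfl
  · rw [e3, mul_neg, h3]; push_cast; rfl
  · rw [e4, h1]

lemma Rep.neg (hX : Rep m X a b c d) : Rep m (-X) (-a) (-b) (-c) (-d) := by
  obtain ⟨h1, h2, h3, h4⟩ := hX
  have e : ∀ i j, (-X).1 i j = -X.1 i j := fun i j => rfl
  refine ⟨?_, ?_, ?_, ?_⟩ <;> rw [e, mul_neg] <;> push_cast <;> congr 1

lemma Rep.det (hX : Rep m X a b c d) : a * d - b * c = m := by
  obtain ⟨h1, h2, h3, h4⟩ := hX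
  have h : (a : ℝ) * d - b * c = m := by
    rw [← h1, ← h2, ← h3, ← h4]
    linear_combination (X.1 0 0 * X.1 1 1 - X.1 0 1 * X.1 1 0) * sqrt_nat_sq m + m * det_entries X
  exact_mod_cast h

lemma Rep.scale {k : ℕ} (hk : 0 < k) (hX : Rep (k * k * m) X (k * a) (k * b) (k * c) (k * d)) :
    Rep m X a b c d := by
  obtain ⟨h1, h2, h3, h4⟩ := hX
  have e : Real.sqrt (k * k * m : ℕ) = k * Real.sqrt m := by
    rw [Nat.cast_mul, Nat.cast_mul, Real.sqrt_mul (by positivity),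
      Real.sqrt_mul_self (by positivity)]
  have hk' : (k : ℝ) ≠ 0 := by exact_mod_cast hk.ne'
  rw [e, mul_assoc] at h1 h2 h3 h4
  push_cast at h1 h2 h3 h4
  exact ⟨mul_left_cancel₀ hk' h1, mul_left_cancel₀ hk' h2, mul_left_cancel₀ hk' h3,
    mul_left_cancel₀ hk' h4⟩

lemma Rep.unique (hm : 0 < m) (hX : Rep m X a b c d) (hY : Rep m Y a b c d) : X = Y := by
  have h0 : Real.sqrt m ≠ 0 := (Real.sqrt_pos.2 (by exact_mod_cast hm)).ne'
  obtain ⟨h1, h2, h3, h4⟩ := hX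
  obtain ⟨k1, k2, k3, k4⟩ := hY
  exact ext_entries (mul_left_cancel₀ h0 (h1.trans k1.symm)) (mul_left_cancel₀ h0 (h2.trans k2.symm))
    (mul_left_cancel₀ h0 (h3.trans k3.symm)) (mul_left_cancel₀ h0 (h4.trans k4.symm))

lemma Rep.entries_unique (hX : Rep m X a b c d) (hY : Rep m X a' b' c' d') :
    a = a' ∧ b = b' ∧ c = c' ∧ d = d' := by
  obtain ⟨h1, h2, h3, h4⟩ := hX
  obtain ⟨k1, k2, k3, k4⟩ := hY
  refine ⟨?_, ?_, ?_, ?_⟩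
  · exact_mod_cast h1.symm.trans k1
  · exact_mod_cast h2.symm.trans k2
  · exact_mod_cast h3.symm.trans k3
  · exact_mod_cast h4.symm.trans k4

lemma exists_rep (hm : 0 < m) (h : a * d - b * c = m) : ∃ X, Rep m X a b c d := by
  have h0 : 0 < Real.sqrt m := Real.sqrt_pos.2 (by exact_mod_cast hm)
  have h' : (a : ℝ) * d - b * c = m := by exact_mod_cast h
  have hm' : (m : ℝ) ≠ 0 := by exact_mod_cast hm.ne'
  refine ⟨⟨(Real.sqrt m)⁻¹ • !![(a : ℝ), b; c, d], ?_⟩, ?_⟩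
  · rw [Matrix.det_smul, Matrix.det_fin_two_of, Fintype.card_fin, inv_pow,
      Real.sq_sqrt (by positivity), h', inv_mul_cancel₀ hm']
  · refine ⟨?_, ?_, ?_, ?_⟩ <;> simp <;> field_simp

lemma Rep.den (hX : Rep m X a b c d) (z : ℂ) :
    (Real.sqrt m : ℂ) * den X z = c * z + d := by
  obtain ⟨h1, h2, h3, h4⟩ := hX
  have e3 : (c : ℂ) = Real.sqrt m * (X.1 1 0 : ℝ) := by exact_mod_cast h3.symm
  have e4 : (d : ℂ) = Real.sqrt m * (X.1 1 1 : ℝ) := by exact_mod_cast h4.symm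
  rw [e3, e4, FrickeTrace.den]; ring

lemma Rep.moebius (hm : 0 < m) (hX : Rep m X a b c d) (z : ℂ) :
    moebius X z = (a * z + b) / (c * z + d) := by
  have h0 : (Real.sqrt m : ℂ) ≠ 0 := by
    exact_mod_cast (Real.sqrt_pos.2 (by exact_mod_cast hm : (0 : ℝ) < m)).ne'
  rw [← hX.den]
  obtain ⟨h1, h2, h3, h4⟩ := hX
  have e1 : (a : ℂ) = Real.sqrt m * (X.1 0 0 : ℝ) := by exact_mod_cast h1.symm
  have e2 : (b : ℂ) = Real.sqrt m * (X.1 0 1 : ℝ) := by exact_mod_cast h2.symm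
  rw [e1, e2, moebius_eq, mul_assoc, ← mul_add, mul_div_mul_left _ _ h0, num]

end

lemma rep_upM {a d : ℕ} (b : ℕ) (ha : 0 < a) (hd : 0 < d) : Rep (a * d) (upM a d b) a b 0 d := by
  have h := (sqrt_mul_pos ha hd).ne'
  refine ⟨?_, ?_, ?_, ?_⟩ <;> rw [upM_coe b ha hd] <;> simp <;> field_simp

lemma rep_one : Rep 1 1 1 0 0 1 := by
  refine ⟨?_, ?_, ?_, ?_⟩ <;> simp

lemma rep_transl (k : ℤ) : Rep 1 (transl k) 1 k 0 1 := by
  refine ⟨?_, ?_, ?_, ?_⟩ <;> simp [transl]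

/-- Explicit description of the Fricke group of prime level. -/
def InFricke (p : ℕ) (X : SL2R) : Prop :=
  (∃ a b c d : ℤ, Rep 1 X a b (p * c) d) ∨ ∃ a b c d : ℤ, Rep p X (p * a) b (p * c) (p * d)

lemma InFricke.mul {p : ℕ} (hp : 0 < p) {X Y : SL2R} (hX : InFricke p X) (hY : InFricke p Y) :
    InFricke p (X * Y) := by
  rcases hX with ⟨a, b, c, d, hX⟩ | ⟨a, b, c, d, hX⟩ <;>
    rcases hY with ⟨a', b', c', d', hY⟩ | ⟨a', b', c', d', hY⟩
  · refine Or.inl ⟨a * a' + b * (p * c'), a * b' + b * d', c * a' + d * c', p * c * b' + d * d', ?_⟩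
    convert hX.mul hY using 1
    ring
  · refine Or.inr ⟨a * a' + b * c', a * b' + b * (p * d'), p * c * a' + d * c', c * b' + d * d', ?_⟩
    convert hX.mul hY using 1 <;> ring
  · refine Or.inr ⟨a * a' + b * c', p * a * b' + b * d', c * a' + p * d * c', c * b' + d * d', ?_⟩
    convert hX.mul hY using 1 <;> ring
  · refine Or.inl ⟨p * a * a' + b * c', a * b' + b * d', c * a' + d * c', c * b' + p * d * d', ?_⟩
    refine Rep.scale hp ?_
    rw [mul_one]
    convert hX.mul hY using 1 <;> ring

lemma InFricke.inv {p : ℕ} {X : SL2R} (hX : InFricke p X) : InFricke p X⁻¹ := by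
  rcases hX with ⟨a, b, c, d, hX⟩ | ⟨a, b, c, d, hX⟩
  · refine Or.inl ⟨d, -b, -c, a, ?_⟩
    rw [mul_neg]; exact hX.inv
  · refine Or.inr ⟨d, -b, -c, a, ?_⟩
    rw [mul_neg]; exact hX.inv

lemma mem_fricke_iff {p : ℕ} (hp : p.Prime) (X : SL2R) : X ∈ FrickeGroup p ↔ InFricke p X := by
  have hp0 := hp.pos
  constructor
  · intro hX
    refine Subgroup.closure_induction ?_ ?_ ?_ ?_ hX
    · rintro Y (hY | hY)
      · obtain ⟨A, hA, rfl⟩ := Subgroup.mem_map.1 hY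
        rw [CongruenceSubgroup.Gamma0_mem] at hA
        obtain ⟨c, hc⟩ := (ZMod.intCast_zmod_eq_zero_iff_dvd _ _).1 hA
        refine Or.inl ⟨A 0 0, A 0 1, c, A 1 1, ?_⟩
        rw [← hc]
        refine ⟨?_, ?_, ?_, ?_⟩ <;> simp
      · obtain ⟨e, he, hY⟩ := Set.mem_iUnion₂.1 hY
        obtain ⟨x, y, z, w, hg⟩ := hY
        rcases (Nat.dvd_prime hp).1 he.1 with rfl | rfl
        · refine Or.inl ⟨x, y, z, w, ?_⟩
          refine ⟨?_, ?_, ?_, ?_⟩ <;> rw [hg] <;> simp <;> ring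
        · have h0 : 0 < Real.sqrt e := Real.sqrt_pos.2 (by exact_mod_cast hp0)
          refine Or.inr ⟨x, y, z, w, ?_⟩
          refine ⟨?_, ?_, ?_, ?_⟩ <;> rw [hg] <;> simp <;> field_simp
    · exact Or.inl ⟨1, 0, 0, 1, by rw [mul_zero]; exact rep_one⟩
    · intro x y _ _ hx hy
      exact hx.mul hp0 hy
    · intro x _ hx
      exact hx.inv
  · rintro (⟨a, b, c, d, hX⟩ | ⟨a, b, c, d, hX⟩)
    · refine Subgroup.subset_closure (Or.inr (Set.mem_iUnion₂.2 ⟨1, ⟨one_dvd _, by simp⟩, ?_⟩))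
      refine ⟨a, b, c, d, ?_⟩
      obtain ⟨h1, h2, h3, h4⟩ := hX
      simp only [Nat.cast_one, Real.sqrt_one, one_mul] at h1 h2 h3 h4
      push_cast at h3
      ext i j
      fin_cases i <;> fin_cases j <;> simp [h1, h2, h3, h4, mul_comm]
    · refine Subgroup.subset_closure (Or.inr (Set.mem_iUnion₂.2 ⟨p, ⟨dvd_rfl, ?_⟩, ?_⟩))
      · rw [Nat.div_self hp0]; exact Nat.coprime_one_right p
      refine ⟨a, b, c, d, ?_⟩
      obtain ⟨h1, h2, h3, h4⟩ := hX
      have h0 : Real.sqrt p ≠ 0 := (Real.sqrt_pos.2 (by exact_mod_cast hp0)).ne'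
      push_cast at h1 h3 h4
      ext i j
      fin_cases i <;> fin_cases j <;> simp <;> field_simp <;> linarith

end FrickeTrace

namespace FrickeTrace

open Filter Topology Asymptotics

/-- The Euler product `∏ (1 - q ^ (n + 1))`. -/
noncomputable def euler (q : ℂ) : ℂ := ∏' n : ℕ, (1 - q ^ (n + 1))

lemma dedekindEta_eq_exp_mul_euler (z : ℂ) :
    dedekindEta z = Complex.exp (Real.pi * I * z / 12) * euler (qc z) := by
  unfold dedekindEta euler
  congr 1
  refine tprod_congr fun n => ?_
  rw [qc, ← Complex.exp_nat_mul]
  congr 2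
  push_cast
  ring

lemma dedekindEta_eq_eta (z : ℂ) : dedekindEta z = ModularForm.eta z := by
  rw [dedekindEta_eq_exp_mul_euler, ModularForm.eta, euler]
  congr 1
  · simp only [Function.Periodic.qParam]
    congr 1
    push_cast
    ring
  · exact tprod_congr fun n => by rw [ModularForm.eta_q, qc_eq_qParam]

lemma dedekindEta_ne_zero {z : ℂ} (hz : z ∈ UH) : dedekindEta z ≠ 0 := by
  rw [dedekindEta_eq_eta]; exact ModularForm.eta_ne_zero hz

lemma differentiableOn_dedekindEta : DifferentiableOn ℂ dedekindEta UH := by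
  intro z hz
  rw [funext dedekindEta_eq_eta]
  exact (ModularForm.differentiableAt_eta_of_mem_upperHalfPlaneSet hz).differentiableWithinAt

lemma euler_zero : euler 0 = 1 := by simp [euler]

lemma differentiableOn_euler : DifferentiableOn ℂ euler (Metric.ball 0 1) :=
  ModularForm.differentiableOn_tprod_one_sub_pow

lemma euler_ne_zero {q : ℂ} (hq : ‖q‖ < 1) : euler q ≠ 0 := by
  rcases eq_or_ne q 0 with rfl | h0
  · rw [euler_zero]; exact one_ne_zero
  · obtain ⟨z, hz, rfl⟩ := exists_qc_eq h0 hq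
    have := dedekindEta_ne_zero hz
    rw [dedekindEta_eq_exp_mul_euler] at this
    exact right_ne_zero_of_mul this

lemma euler_tail_bound (m : ℕ) {q : ℂ} (hq : ‖q‖ ≤ 1 / 2) :
    ∃ R : ℂ, euler q = (∏ i ∈ Finset.range m, (1 - q ^ (i + 1))) * R ∧
      ‖R - 1‖ ≤ 4 * ‖q‖ ^ (m + 1) := by
  have hq1 : ‖q‖ < 1 := by linarith
  have hs : HasSum (fun n : ℕ => ‖q‖ ^ (n + m + 1)) (‖q‖ ^ (m + 1) * (1 - ‖q‖)⁻¹) := by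
    have := (hasSum_geometric_of_lt_one (norm_nonneg q) hq1).mul_left (‖q‖ ^ (m + 1))
    refine this.congr_fun fun n => ?_
    rw [← pow_add]; congr 1; ring
  have hmul : Multipliable fun n : ℕ => 1 - q ^ (n + m + 1) := by
    have := multipliable_one_add_of_summable (f := fun n : ℕ => -q ^ (n + m + 1))
      (by simpa using hs.summable)
    simpa [sub_eq_add_neg] using this
  refine ⟨∏' n : ℕ, (1 - q ^ (n + m + 1)), ?_, ?_⟩
  · exact (Multipliable.prod_mul_tprod_nat_mul' (f := fun n : ℕ => 1 - q ^ (n + 1)) hmul).symm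
  · set x := ‖q‖ ^ (m + 1) * (1 - ‖q‖)⁻¹ with hx
    have hinv : (1 - ‖q‖)⁻¹ ≤ 2 := by
      rw [inv_le_comm₀ (by linarith) two_pos]; linarith
    have hx2 : x ≤ 2 * ‖q‖ ^ (m + 1) := by
      rw [hx, mul_comm]; gcongr
    have hx0 : 0 ≤ x := hs.nonneg fun n => by positivity
    have hx1 : x ≤ 1 := by
      have : ‖q‖ ^ (m + 1) ≤ 1 / 2 := (pow_le_of_le_one (norm_nonneg _) hq1.le (by omega)).trans hq
      linarith
    have hb : ‖(∏' n : ℕ, (1 - q ^ (n + m + 1))) - 1‖ ≤ Real.exp x - 1 := by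
      have ht : Tendsto (fun s : Finset ℕ => ‖(∏ n ∈ s, (1 - q ^ (n + m + 1))) - 1‖) atTop
          (𝓝 ‖(∏' n : ℕ, (1 - q ^ (n + m + 1))) - 1‖) :=
        (Tendsto.sub_const hmul.hasProd 1).norm
      refine le_of_tendsto' ht fun s => ?_
      have h1 := s.norm_prod_one_add_sub_one_le (fun n : ℕ => -q ^ (n + m + 1))
      simp only [← sub_eq_add_neg, norm_neg, norm_pow] at h1
      refine h1.trans ?_
      gcongr
      exact sum_le_hasSum s (fun _ _ => by positivity) hs
    have he : Real.exp x - 1 ≤ 2 * x := by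
      have := Real.exp_bound' hx0 hx1 (n := 1) one_pos
      norm_num at this
      linarith
    linarith

lemma jet_euler_qc_pow {k : ℕ} (hk : 0 < k) :
    HasJet (fun z => euler (qc z ^ k)) 0 (if k = 1 then 3 else if k = 2 then 2 else 0) := by
  have hev : ∀ᶠ z in imInf, ‖qc z ^ k‖ ≤ 1 / 2 := by
    have h1 : Tendsto (fun z => ‖qc z ^ k‖) imInf (𝓝 0) := by
      have := (qc_tendsto_zero.pow k).norm
      simpa [hk.ne'] using this
    exact h1.eventually (ge_mem_nhds (by norm_num))
  have key : ∀ m : ℕ, 2 < k * (m + 1) →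
      HasJet (fun z => euler (qc z ^ k)) 0 (∑ i ∈ Finset.range m, kap ((k * (i + 1) : ℕ) : ℤ)) := by
    intro m hm
    choose! R hR1 hR2 using fun (q : ℂ) (hq : ‖q‖ ≤ 1 / 2) => euler_tail_bound m hq
    have hRj : Jet (fun z => R (qc z ^ k)) 1 0 0 := by
      have : (fun z => R (qc z ^ k) - (1 + 0 * qc z + 0 * qc z ^ 2)) =O[imInf]
          fun z => qc z ^ (k * (m + 1)) := by
        refine IsBigO.of_bound 4 (hev.mono fun z hz => ?_)
        have := hR2 _ hz
        rw [pow_mul]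
        simpa using this
      exact this.trans_isLittleO (qc_pow_isLittleO hm)
    have hp := HasJet.prod (Finset.range m) (F := fun i z => 1 - qc z ^ (k * (i + 1)))
      (m := fun _ => 0) (κ := fun i => kap ((k * (i + 1) : ℕ) : ℤ))
      fun i _ => jet_one_sub_qc_pow (by positivity)
    have := hp.mul (hRj.hasJet (κ := 0) one_ne_zero (by ring))
    simp only [Finset.sum_const_zero, add_zero] at this
    refine this.congr' (hev.mono fun z hz => ?_)
    simp only
    rw [hR1 _ hz]
    simp only [pow_mul]
  rcases (by omega : k = 1 ∨ k = 2 ∨ 3 ≤ k) with rfl | rfl | h3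
  · have := key 2 (by norm_num)
    convert this using 1
    norm_num [Finset.sum_range_succ, kap]
  · have := key 1 (by norm_num)
    convert this using 1
    norm_num [kap]
  · have := key 0 (by omega)
    convert this using 1
    rw [if_neg (by omega), if_neg (by omega)]
    simp

end FrickeTrace

namespace FrickeTrace

open Filter Topology Asymptotics

/-- The exponent (modulo `12`) of the multiplier of `η ^ 2`. -/
def etaExp (a b c d : ℤ) : ℤ := (1 - c ^ 2) * (b * d + 3 * (c - 1) * d + c + 3) + c * (a + d - 3)

/-- The twelfth root of unity with exponent `m`. -/
noncomputable def unity12 (m : ℤ) : ℂ := Complex.exp (2 * Real.pi * I * m / 12)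

lemma unity12_add (m n : ℤ) : unity12 (m + n) = unity12 m * unity12 n := by
  rw [unity12, unity12, unity12, ← Complex.exp_add]
  congr 1
  push_cast
  ring

lemma unity12_pow (m : ℤ) (n : ℕ) : unity12 m ^ n = unity12 (n * m) := by
  rw [unity12, unity12, ← Complex.exp_nat_mul]
  congr 1
  push_cast
  ring

lemma unity12_ne_zero (m : ℤ) : unity12 m ≠ 0 := Complex.exp_ne_zero _

lemma unity12_twelve_mul (m : ℤ) : unity12 (12 * m) = 1 := by
  rw [unity12, Complex.exp_eq_one_iff]
  exact ⟨m, by push_cast; ring⟩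

lemma unity12_congr {m n : ℤ} (h : (12 : ℤ) ∣ m - n) : unity12 m = unity12 n := by
  obtain ⟨k, hk⟩ := h
  rw [show m = n + 12 * k by linarith, unity12_add, unity12_twelve_mul, mul_one]

lemma unity12_neg_three : unity12 (-3) = -I := by
  have : unity12 (-3) = Complex.exp (-(Real.pi / 2 * I)) := by
    rw [unity12]; congr 1; push_cast; ring
  rw [this, Complex.exp_neg, Complex.exp_pi_div_two_mul_I, Complex.inv_I]

lemma twelve_dvd_of_zmod {x : ℤ} (h3 : (x : ZMod 3) = 0) (h4 : (x : ZMod 4) = 0) :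
    (12 : ℤ) ∣ x := by
  have h3' := (ZMod.intCast_zmod_eq_zero_iff_dvd x 3).1 h3
  have h4' := (ZMod.intCast_zmod_eq_zero_iff_dvd x 4).1 h4
  push_cast at h3' h4'
  omega

lemma etaExp_mul_T {a b c d : ℤ} (h : a * d - b * c = 1) :
    (12 : ℤ) ∣ etaExp a (a + b) c (c + d) - (etaExp a b c d + 1) := by
  have key3 : ∀ a b c d : ZMod 3, a * d - b * c = 1 →
      ((1 - c ^ 2) * ((a + b) * (c + d) + 3 * (c - 1) * (c + d) + c + 3) + c * (a + (c + d) - 3)) -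
      ((1 - c ^ 2) * (b * d + 3 * (c - 1) * d + c + 3) + c * (a + d - 3) + 1) = 0 := by decide
  have key4 : ∀ a b c d : ZMod 4, a * d - b * c = 1 →
      ((1 - c ^ 2) * ((a + b) * (c + d) + 3 * (c - 1) * (c + d) + c + 3) + c * (a + (c + d) - 3)) -
      ((1 - c ^ 2) * (b * d + 3 * (c - 1) * d + c + 3) + c * (a + d - 3) + 1) = 0 := by decide
  apply twelve_dvd_of_zmod
  · have := key3 a b c d (by exact_mod_cast congrArg (Int.cast : ℤ → ZMod 3) h)
    rw [etaExp, etaExp]; push_cast; exact this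
  · have := key4 a b c d (by exact_mod_cast congrArg (Int.cast : ℤ → ZMod 4) h)
    rw [etaExp, etaExp]; push_cast; exact this

lemma etaExp_mul_S {a b c d : ℤ} (h : a * d - b * c = 1) :
    (12 : ℤ) ∣ etaExp b (-a) d (-c) - (etaExp a b c d + -3) := by
  have key3 : ∀ a b c d : ZMod 3, a * d - b * c = 1 →
      ((1 - d ^ 2) * (-a * -c + 3 * (d - 1) * -c + d + 3) + d * (b + -c - 3)) -
      ((1 - c ^ 2) * (b * d + 3 * (c - 1) * d + c + 3) + c * (a + d - 3) + -3) = 0 := by decide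
  have key4 : ∀ a b c d : ZMod 4, a * d - b * c = 1 →
      ((1 - d ^ 2) * (-a * -c + 3 * (d - 1) * -c + d + 3) + d * (b + -c - 3)) -
      ((1 - c ^ 2) * (b * d + 3 * (c - 1) * d + c + 3) + c * (a + d - 3) + -3) = 0 := by decide
  apply twelve_dvd_of_zmod
  · have := key3 a b c d (by exact_mod_cast congrArg (Int.cast : ℤ → ZMod 3) h)
    rw [etaExp, etaExp]; push_cast; exact this
  · have := key4 a b c d (by exact_mod_cast congrArg (Int.cast : ℤ → ZMod 4) h)
    rw [etaExp, etaExp]; push_cast; exact this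

lemma dedekindEta_sq_add_one (z : ℂ) :
    dedekindEta (z + 1) ^ 2 = unity12 1 * dedekindEta z ^ 2 := by
  rw [dedekindEta_eq_exp_mul_euler, dedekindEta_eq_exp_mul_euler]
  have h1 : qc (z + 1) = qc z := by simpa using qc_add_int z 1
  rw [h1, mul_pow, mul_pow, ← mul_assoc, unity12, ← Complex.exp_nat_mul, ← Complex.exp_nat_mul,
    ← Complex.exp_add]
  congr 2
  push_cast
  ring

lemma dedekindEta_sq_neg_inv {z : ℂ} (hz : z ∈ UH) :
    dedekindEta (-1 / z) ^ 2 = -I * z * dedekindEta z ^ 2 := by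
  have h := ModularForm.eta_comp_eq_csqrt_I_inv hz
  simp only [Function.comp_apply, Pi.smul_apply, Pi.mul_apply, smul_eq_mul] at h
  rw [dedekindEta_eq_eta, dedekindEta_eq_eta, h, mul_pow, mul_pow, inv_pow]
  have hs : ∀ w : ℂ, sqrt w ^ 2 = w := fun w => by simp [Complex.sqrt]
  rw [hs, hs, Complex.inv_I]
  ring

lemma intMoebius_mem {a b c d : ℤ} (h : a * d - b * c = 1) {z : ℂ} (hz : z ∈ UH) :
    ((a : ℂ) * z + b) / (c * z + d) ∈ UH ∧ (c : ℂ) * z + d ≠ 0 := by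
  obtain ⟨X, hX⟩ := exists_rep (m := 1) one_pos (by exact_mod_cast h)
  have h1 := moebius_mem X hz
  rw [hX.moebius one_pos] at h1
  refine ⟨h1, ?_⟩
  rw [← hX.den]
  simpa using den_ne_zero X hz

/-- The transformation law of `η ^ 2` under the modular group. -/
lemma dedekindEta_sq_transform {a b c d : ℤ} (h : a * d - b * c = 1) {z : ℂ} (hz : z ∈ UH) :
    dedekindEta ((a * z + b) / (c * z + d)) ^ 2 =
      unity12 (etaExp a b c d) * (c * z + d) * dedekindEta z ^ 2 := by
  let Q : Matrix.SpecialLinearGroup (Fin 2) ℤ → Prop := fun A => ∀ z ∈ UH,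
    dedekindEta ((A.1 0 0 * z + A.1 0 1) / (A.1 1 0 * z + A.1 1 1)) ^ 2 =
      unity12 (etaExp (A.1 0 0) (A.1 0 1) (A.1 1 0) (A.1 1 1)) *
        (A.1 1 0 * z + A.1 1 1) * dedekindEta z ^ 2
  have hdet : ∀ A : Matrix.SpecialLinearGroup (Fin 2) ℤ,
      A.1 0 0 * A.1 1 1 - A.1 0 1 * A.1 1 0 = 1 := fun A => by
    rw [← Matrix.det_fin_two]; exact A.2
  have hmul : ∀ (A B : Matrix.SpecialLinearGroup (Fin 2) ℤ) (i j : Fin 2),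
      (A * B).1 i j = A.1 i 0 * B.1 0 j + A.1 i 1 * B.1 1 j := fun A B i j => by
    change (A.1 * B.1) i j = _
    rw [Matrix.mul_apply, Fin.sum_univ_two]
  have hS : ∀ A, Q (A * ModularGroup.S) ↔ Q A := by
    intro A
    have e00 : (A * ModularGroup.S).1 0 0 = A.1 0 1 := by
      rw [hmul]; simp [ModularGroup.S]
    have e01 : (A * ModularGroup.S).1 0 1 = -A.1 0 0 := by
      rw [hmul]; simp [ModularGroup.S]
    have e10 : (A * ModularGroup.S).1 1 0 = A.1 1 1 := by
      rw [hmul]; simp [ModularGroup.S]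
    have e11 : (A * ModularGroup.S).1 1 1 = -A.1 1 0 := by
      rw [hmul]; simp [ModularGroup.S]
    have hA := hdet A
    simp only [Q, e00, e01, e10, e11]
    generalize A.1 0 0 = a at *
    generalize A.1 0 1 = b at *
    generalize A.1 1 0 = c at *
    generalize A.1 1 1 = d at *
    rw [unity12_congr (etaExp_mul_S hA), unity12_add, unity12_neg_three]
    have hw : ∀ z ∈ UH, -1 / z ∈ UH := fun z hz => by
      simpa using (intMoebius_mem (a := 0) (b := -1) (c := 1) (d := 0) (by norm_num) hz).1
    have hz0 : ∀ z ∈ UH, z ≠ 0 := fun z hz h0 => by rw [mem_UH, h0] at hz; simp at hz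
    have e : ∀ z ∈ UH, ((b : ℂ) * z + (-a : ℤ)) / (d * z + (-c : ℤ)) =
        (a * (-1 / z) + b) / (c * (-1 / z) + d) := fun z hz => by
      have := hz0 z hz
      rw [← mul_div_mul_right ((a : ℂ) * (-1 / z) + b) _ this]
      congr 1 <;> field_simp <;> push_cast <;> ring
    constructor
    · intro hQ z hz
      have h1 := hQ (-1 / z) (hw z hz)
      have e2 : -1 / (-1 / z) = z := by have := hz0 z hz; field_simp
      rw [e _ (hw z hz), e2, dedekindEta_sq_neg_inv hz] at h1
      rw [h1]
      have := hz0 z hz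
      push_cast
      field_simp
      rw [I_sq]
      ring
    · intro hQ z hz
      have h1 := hQ (-1 / z) (hw z hz)
      rw [e _ hz, h1, dedekindEta_sq_neg_inv hz]
      have := hz0 z hz
      push_cast
      field_simp
      ring
  have hT : ∀ A, Q (A * ModularGroup.T) ↔ Q A := by
    intro A
    have e00 : (A * ModularGroup.T).1 0 0 = A.1 0 0 := by
      rw [hmul]; simp [ModularGroup.T]
    have e01 : (A * ModularGroup.T).1 0 1 = A.1 0 0 + A.1 0 1 := by
      rw [hmul]; simp [ModularGroup.T]
    have e10 : (A * ModularGroup.T).1 1 0 = A.1 1 0 := by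
      rw [hmul]; simp [ModularGroup.T]
    have e11 : (A * ModularGroup.T).1 1 1 = A.1 1 0 + A.1 1 1 := by
      rw [hmul]; simp [ModularGroup.T]
    have hA := hdet A
    simp only [Q, e00, e01, e10, e11]
    generalize A.1 0 0 = a at *
    generalize A.1 0 1 = b at *
    generalize A.1 1 0 = c at *
    generalize A.1 1 1 = d at *
    rw [unity12_congr (etaExp_mul_T hA), unity12_add]
    have e : ∀ z : ℂ, ((a : ℂ) * z + (a + b : ℤ)) / (c * z + (c + d : ℤ)) =
        (a * (z + 1) + b) / (c * (z + 1) + d) := fun z => by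
      congr 1 <;> push_cast <;> ring
    constructor
    · intro hQ z hz
      have hz' : z - 1 ∈ UH := by rw [mem_UH] at *; simpa using hz
      have h1 := hQ (z - 1) hz'
      have h2 := dedekindEta_sq_add_one (z - 1)
      rw [sub_add_cancel] at h2
      rw [e, sub_add_cancel] at h1
      rw [h1, h2]
      push_cast
      ring
    · intro hQ z hz
      have h1 := hQ (z + 1) (add_one_mem_UH hz)
      rw [e, h1, dedekindEta_sq_add_one]
      push_cast
      ring
  have hall : ∀ A, Q A := by
    intro A
    have hA : A ∈ Subgroup.closure {ModularGroup.S, ModularGroup.T} := by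
      rw [SpecialLinearGroup.SL2Z_generators]; trivial
    refine Subgroup.closure_induction_right (p := fun A _ => Q A) ?_ ?_ ?_ hA
    · intro z hz
      have : unity12 (etaExp 1 0 0 1) = 1 := by
        simpa [etaExp] using unity12_twelve_mul 0
      simp [this]
    · rintro A _ y (rfl | rfl) h
      · exact (hS A).2 h
      · exact (hT A).2 h
    · rintro A _ y (rfl | rfl) h
      · exact (hS _).1 (by simpa using h)
      · exact (hT _).1 (by simpa using h)
  have := hall ⟨!![a, b; c, d], by rw [Matrix.det_fin_two_of]; exact h⟩ z hz
  simpa using this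

end FrickeTrace

namespace FrickeTrace

open Filter Topology Asymptotics

/-- `SL(2, ℤ)` inside `SL(2, ℝ)`. -/
def SLZ : Subgroup SL2R where
  carrier := {X | ∃ a b c d : ℤ, Rep 1 X a b c d}
  mul_mem' := by
    rintro X Y ⟨a, b, c, d, hX⟩ ⟨a', b', c', d', hY⟩
    exact ⟨_, _, _, _, hX.mul hY⟩
  one_mem' := ⟨_, _, _, _, rep_one⟩
  inv_mem' := by
    rintro X ⟨a, b, c, d, hX⟩
    exact ⟨_, _, _, _, hX.inv⟩

lemma exists_SLZ_row {c d : ℤ} (h : IsCoprime c d) : ∃ X, ∃ a b : ℤ, Rep 1 X a b c d := by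
  obtain ⟨u, v, huv⟩ := h
  obtain ⟨X, hX⟩ := exists_rep (m := 1) (a := v) (b := -u) (c := c) (d := d) one_pos
    (by push_cast; linarith)
  exact ⟨X, _, _, hX⟩

lemma exists_fricke_row {p : ℕ} (hp : p.Prime) {c d : ℤ} (h : IsCoprime c d) :
    ∃ X ∈ FrickeGroup p, ((p : ℤ) ∣ c ∧ ∃ a b : ℤ, Rep 1 X a b c d) ∨
      ¬ (p : ℤ) ∣ c ∧ ∃ a b : ℤ, Rep p X (p * a) b (p * c) (p * d) := by
  by_cases hpc : (p : ℤ) ∣ c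
  · obtain ⟨X, a, b, hX⟩ := exists_SLZ_row h
    obtain ⟨c', rfl⟩ := hpc
    exact ⟨X, (mem_fricke_iff hp X).2 (Or.inl ⟨a, b, c', d, hX⟩), Or.inl ⟨dvd_mul_right _ _, a, b, hX⟩⟩
  · have hpc' : IsCoprime c (p : ℤ) :=
      ((Prime.coprime_iff_not_dvd (Nat.prime_iff_prime_int.1 hp)).2 hpc).symm
    obtain ⟨u, v, huv⟩ := hpc'.mul_right h
    obtain ⟨X, hX⟩ := exists_rep (m := p) (a := p * v) (b := -u) (c := p * c) (d := p * d) hp.pos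
      (by linear_combination (p : ℤ) * huv)
    exact ⟨X, (mem_fricke_iff hp X).2 (Or.inr ⟨v, -u, c, d, hX⟩), Or.inr ⟨hpc, v, -u, hX⟩⟩

lemma exists_row_half_le {z : ℂ} (hz : z ∈ UH) :
    ∃ c d : ℤ, IsCoprime c d ∧ 1 / 2 ≤ z.im / Complex.normSq (c * z + d) := by
  obtain ⟨γ, hγ⟩ := ModularGroup.exists_one_half_le_im_smul ⟨z, hz⟩
  refine ⟨γ 1 0, γ 1 1, ModularGroup.bottom_row_coprime γ, ?_⟩
  rw [ModularGroup.im_smul_eq_div_normSq, ModularGroup.denom_apply] at hγ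
  exact hγ

lemma SLZ_fund {z : ℂ} (hz : z ∈ UH) : ∃ γ ∈ SLZ, 1 / 2 ≤ (moebius γ z).im := by
  obtain ⟨c, d, h, hcd⟩ := exists_row_half_le hz
  obtain ⟨X, a, b, hX⟩ := exists_SLZ_row h
  refine ⟨X, ⟨_, _, _, _, hX⟩, ?_⟩
  have e := hX.den z
  simp only [Nat.cast_one, Real.sqrt_one, ofReal_one, one_mul] at e
  rw [im_moebius, e]
  exact hcd

lemma fricke_fund {p : ℕ} (hp : p.Prime) {z : ℂ} (hz : z ∈ UH) :
    ∃ γ ∈ FrickeGroup p, 1 / (2 * p) ≤ (moebius γ z).im := by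
  obtain ⟨c, d, h, hcd⟩ := exists_row_half_le hz
  have hp1 : (1 : ℝ) ≤ p := by exact_mod_cast hp.one_le
  obtain ⟨X, hXm, ⟨-, a, b, hX⟩ | ⟨-, a, b, hX⟩⟩ := exists_fricke_row hp h <;>
    refine ⟨X, hXm, ?_⟩ <;> have e := hX.den z
  · simp only [Nat.cast_one, Real.sqrt_one, ofReal_one, one_mul] at e
    rw [im_moebius, e]
    refine le_trans ?_ hcd
    apply one_div_le_one_div_of_le <;> linarith
  · have e2 : (p : ℝ) * Complex.normSq (den X z) = p ^ 2 * Complex.normSq (c * z + d) := by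
      have := congrArg Complex.normSq e
      push_cast at this
      rw [show (p : ℂ) * c * z + p * d = p * (c * z + d) by ring, Complex.normSq_mul,
        Complex.normSq_mul, Complex.normSq_ofReal, sqrt_nat_sq, Complex.normSq_natCast] at this
      rw [this]; ring
    have e3 : Complex.normSq (den X z) = p * Complex.normSq (c * z + d) := by
      have : (p : ℝ) ≠ 0 := by positivity
      apply mul_left_cancel₀ this
      rw [e2]; ring
    rw [im_moebius, e3, mul_comm (p : ℝ), ← div_div, ← div_div]
    gcongr

lemma fricke_discrete {p : ℕ} (hp : p.Prime) {γ : SL2R} (hγ : γ ∈ FrickeGroup p) (i j : Fin 2) :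
    ∃ m : ℤ, (p : ℝ) * γ.1 i j ^ 2 = m := by
  have key : ∀ (x : ℝ) (k : ℤ), Real.sqrt p * x = k → ∃ m : ℤ, (p : ℝ) * x ^ 2 = m := by
    intro x k hk
    refine ⟨k ^ 2, ?_⟩
    push_cast
    rw [← hk, mul_pow, sq (Real.sqrt p), sqrt_nat_sq]
  have key1 : ∀ (x : ℝ) (k : ℤ), Real.sqrt (1 : ℕ) * x = k → ∃ m : ℤ, (p : ℝ) * x ^ 2 = m := by
    intro x k hk
    simp only [Nat.cast_one, Real.sqrt_one, one_mul] at hk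
    exact ⟨p * k ^ 2, by push_cast; rw [hk]⟩
  rcases (mem_fricke_iff hp γ).1 hγ with ⟨a, b, c, d, h1, h2, h3, h4⟩ | ⟨a, b, c, d, h1, h2, h3, h4⟩
  · fin_cases i <;> fin_cases j
    exacts [key1 _ _ h1, key1 _ _ h2, key1 _ _ h3, key1 _ _ h4]
  · fin_cases i <;> fin_cases j
    exacts [key _ _ h1, key _ _ h2, key _ _ h3, key _ _ h4]

/-- The Fricke involution. -/
lemma exists_fricke_involution {p : ℕ} (hp : 0 < p) : ∃ W, Rep p W 0 (-1) p 0 :=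
  exists_rep hp (by push_cast; ring)

/-- A function transforming under the Fricke group with a cocycle factor: it suffices to check
`Γ₀(p)` and the Fricke involution. -/
lemma fricke_transform {p : ℕ} (hp : p.Prime) (F : ℂ → ℂ) (n : ℕ)
    (h0 : ∀ X, (∃ a b c d : ℤ, Rep 1 X a b (p * c) d) → ∀ z ∈ UH,
      F (moebius X z) = den X z ^ n * F z)
    (hW : ∀ W, Rep p W 0 (-1) p 0 → ∀ z ∈ UH, F (moebius W z) = den W z ^ n * F z)
    {γ : SL2R} (hγ : γ ∈ FrickeGroup p) {z : ℂ} (hz : z ∈ UH) :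
    F (moebius γ z) = den γ z ^ n * F z := by
  rcases (mem_fricke_iff hp γ).1 hγ with h | ⟨a, b, c, d, h⟩
  · exact h0 γ h z hz
  · obtain ⟨W, hrW⟩ := exists_fricke_involution hp.pos
    have hX : Rep 1 (W⁻¹ * γ) c d (p * -a) (-b) := by
      refine Rep.scale hp.pos ?_
      rw [mul_one]
      convert hrW.inv.mul h using 1 <;> ring
    have e : γ = W * (W⁻¹ * γ) := by group
    have hw := moebius_mem (W⁻¹ * γ) hz
    conv_lhs => rw [e, moebius_mul _ _ hz, hW W hrW _ hw, h0 _ ⟨_, _, _, _, hX⟩ z hz]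
    rw [← mul_assoc, ← mul_pow, ← den_mul _ _ hz, ← e]

end FrickeTrace

namespace FrickeTrace

open Filter Topology Asymptotics

section
variable {p h : ℕ}

lemma nat_mul_mem_UH (hp : 0 < p) {z : ℂ} (hz : z ∈ UH) : (p : ℂ) * z ∈ UH := by
  rw [mem_UH] at *
  have : ((p : ℂ) * z).im = p * z.im := by simp
  rw [this]
  positivity

/-- The eta quotient `(η(z) / η(pz)) ^ (2h)`. -/
noncomputable def etaQuot (p h : ℕ) (z : ℂ) : ℂ := (dedekindEta z ^ 2 / dedekindEta (p * z) ^ 2) ^ h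

lemma etaQuot_ne_zero (hp : 0 < p) {z : ℂ} (hz : z ∈ UH) : etaQuot p h z ≠ 0 :=
  pow_ne_zero _ (div_ne_zero (pow_ne_zero _ (dedekindEta_ne_zero hz))
    (pow_ne_zero _ (dedekindEta_ne_zero (nat_mul_mem_UH hp hz))))

lemma jnStar_eq (hp : p.Prime) (hh : h * (p - 1) = 12) (z : ℂ) :
    jnStar p z = etaQuot p h z + 2 * h + (p : ℂ) ^ h * (etaQuot p h z)⁻¹ := by
  have h2 := hp.two_le
  have h6 : p ≠ 6 := by rintro rfl; norm_num at hp
  have h10 : p ≠ 10 := by rintro rfl; norm_num at hp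
  have e12 : 12 / (p - 1) = h := by rw [← hh]; exact Nat.mul_div_cancel _ (by omega)
  have e24 : 24 / (p - 1) = 2 * h := by
    rw [show 24 = 2 * h * (p - 1) by rw [mul_assoc, hh]; norm_num]; exact Nat.mul_div_cancel _ (by omega)
  have hc : (h : ℂ) * (p - 1) = 12 := by
    have : ((h * (p - 1) : ℕ) : ℂ) = 12 := by rw [hh]; norm_num
    rwa [Nat.cast_mul, Nat.cast_sub hp.one_le, Nat.cast_one] at this
  have hp1 : (p : ℂ) - 1 ≠ 0 := fun h0 => by rw [h0] at hc; norm_num at hc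
  have ec : 24 / ((p : ℂ) - 1) = 2 * h := by
    rw [div_eq_iff hp1]; linear_combination -2 * hc
  rw [jnStar, if_neg h6, if_neg h10, e12, e24, ec, etaQuot, pow_mul, pow_mul]
  simp only [div_pow, inv_div]

lemma etaQuot_gamma0 (hp : p.Prime) (hh : h * (p - 1) = 12) {X : SL2R} {a b c d : ℤ}
    (hX : Rep 1 X a b (p * c) d) {z : ℂ} (hz : z ∈ UH) :
    etaQuot p h (moebius X z) = etaQuot p h z := by
  have hdet : a * d - b * (p * c) = 1 := by simpa using hX.det
  have hdet' : a * d - p * b * c = 1 := by linarith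
  have hpz := nat_mul_mem_UH hp.pos hz
  have h1 := dedekindEta_sq_transform hdet hz
  have h2 := dedekindEta_sq_transform hdet' hpz
  have hne := (intMoebius_mem hdet hz).2
  rw [← hX.moebius one_pos] at h1
  have e1 : (a * (p * z) + (p * b : ℤ)) / (c * (p * z) + d) = (p : ℂ) * moebius X z := by
    rw [hX.moebius one_pos, mul_div_assoc']
    push_cast
    congr 1 <;> ring
  rw [e1] at h2
  have e2 : (c : ℂ) * (p * z) + d = (p * c : ℤ) * z + d := by push_cast; ring
  rw [etaQuot, etaQuot, h1, h2, e2, mul_assoc, mul_assoc, mul_div_mul_comm,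
    mul_div_mul_left _ _ hne, mul_pow]
  have hchar : (unity12 (etaExp a b (p * c) d) / unity12 (etaExp a (p * b) c d)) ^ h = 1 := by
    rw [div_pow, div_eq_one_iff_eq (pow_ne_zero _ (unity12_ne_zero _)), unity12_pow, unity12_pow]
    apply unity12_congr
    have hdvd : ((p : ℤ) - 1) ∣ etaExp a b (p * c) d - etaExp a (p * b) c d := by
      have hp1 : (p : ℤ) ≡ 1 [ZMOD (p - 1)] := (Int.modEq_iff_dvd.2 (dvd_refl _)).symm
      have hpc : (p : ℤ) * c ≡ c [ZMOD (p - 1)] := by simpa using hp1.mul_right c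
      have hpb : (p : ℤ) * b ≡ b [ZMOD (p - 1)] := by simpa using hp1.mul_right b
      have : etaExp a (p * b) c d ≡ etaExp a b (p * c) d [ZMOD (p - 1)] := by
        unfold etaExp
        gcongr
      exact this.dvd
    have h12 : (12 : ℤ) = h * (p - 1) := by
      have : ((h * (p - 1) : ℕ) : ℤ) = 12 := by rw [hh]; norm_num
      rw [Nat.cast_mul, Nat.cast_sub hp.one_le, Nat.cast_one] at this
      exact this.symm
    rw [← mul_sub, h12]
    exact mul_dvd_mul_left _ hdvd
  rw [hchar, one_mul]

lemma moebius_involution {W : SL2R} (hp : 0 < p) (hW : Rep p W 0 (-1) p 0) (z : ℂ) :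
    moebius W z = -1 / (p * z) := by
  rw [hW.moebius hp]; push_cast; ring_nf

lemma neg_one_div_mul (hp : 0 < p) (z : ℂ) : (p : ℂ) * (-1 / (p * z)) = -1 / z := by
  have : (p : ℂ) ≠ 0 := by exact_mod_cast hp.ne'
  rcases eq_or_ne z 0 with rfl | hz
  · simp
  · field_simp

lemma etaQuot_involution (hp : 0 < p) {W : SL2R} (hW : Rep p W 0 (-1) p 0) {z : ℂ}
    (hz : z ∈ UH) : etaQuot p h (moebius W z) = (p : ℂ) ^ h * (etaQuot p h z)⁻¹ := by
  have hp' : (p : ℂ) ≠ 0 := by exact_mod_cast hp.ne'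
  have hz0 : z ≠ 0 := fun h0 => by rw [mem_UH, h0] at hz; simp at hz
  have h1 := dedekindEta_ne_zero hz
  have h2 := dedekindEta_ne_zero (nat_mul_mem_UH hp hz)
  rw [moebius_involution hp hW, etaQuot, etaQuot, neg_one_div_mul hp,
    dedekindEta_sq_neg_inv (nat_mul_mem_UH hp hz), dedekindEta_sq_neg_inv hz, ← inv_pow, ← mul_pow]
  congr 1
  field_simp

lemma jnStar_invariant (hp : p.Prime) (hh : h * (p - 1) = 12) {γ : SL2R}
    (hγ : γ ∈ FrickeGroup p) {z : ℂ} (hz : z ∈ UH) : jnStar p (moebius γ z) = jnStar p z := by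
  have := fricke_transform hp (jnStar p) 0 ?_ ?_ hγ hz
  · simpa using this
  · rintro X ⟨a, b, c, d, hX⟩ z hz
    rw [jnStar_eq hp hh, jnStar_eq hp hh, etaQuot_gamma0 hp hh hX hz]; ring
  · intro W hW z hz
    have hp' : (p : ℂ) ≠ 0 := by exact_mod_cast hp.ne_zero
    have h0 := etaQuot_ne_zero (h := h) hp.pos hz
    rw [jnStar_eq hp hh, jnStar_eq hp hh, etaQuot_involution hp.pos hW hz]
    field_simp
    ring

lemma differentiableOn_etaQuot (hp : 0 < p) : DifferentiableOn ℂ (etaQuot p h) UH := by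
  have h1 : DifferentiableOn ℂ (fun z : ℂ => dedekindEta (p * z)) UH :=
    differentiableOn_dedekindEta.comp (by fun_prop) fun z hz => nat_mul_mem_UH hp hz
  exact (((differentiableOn_dedekindEta.pow 2).div (h1.pow 2) fun z hz =>
    pow_ne_zero _ (dedekindEta_ne_zero (nat_mul_mem_UH hp hz))).pow h)

/-- The `q`-series of `q (η(z) / η(pz)) ^ (2h)`. -/
noncomputable def quotSeries (p h : ℕ) (q : ℂ) : ℂ := (euler q / euler (q ^ p)) ^ (2 * h)

lemma pow_mem_ball (hp : 0 < p) {q : ℂ} (hq : q ∈ Metric.ball (0 : ℂ) 1) :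
    q ^ p ∈ Metric.ball (0 : ℂ) 1 := by
  rw [mem_ball_zero_iff] at *
  rw [norm_pow]
  exact pow_lt_one₀ (norm_nonneg _) hq hp.ne'

lemma differentiableOn_quotSeries (hp : 0 < p) :
    DifferentiableOn ℂ (quotSeries p h) (Metric.ball 0 1) := by
  have h1 : DifferentiableOn ℂ (fun q : ℂ => euler (q ^ p)) (Metric.ball 0 1) :=
    differentiableOn_euler.comp (by fun_prop) fun q hq => pow_mem_ball hp hq
  exact (differentiableOn_euler.div h1 fun q hq =>
    euler_ne_zero (by simpa using pow_mem_ball hp hq)).pow _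

lemma quotSeries_ne_zero (hp : 0 < p) {q : ℂ} (hq : q ∈ Metric.ball (0 : ℂ) 1) :
    quotSeries p h q ≠ 0 :=
  pow_ne_zero _ (div_ne_zero (euler_ne_zero (by simpa using hq))
    (euler_ne_zero (by simpa using pow_mem_ball hp hq)))

lemma quotSeries_zero (hp : 0 < p) : quotSeries p h 0 = 1 := by
  simp [quotSeries, hp.ne', euler_zero]

lemma hasDerivAt_euler_zero : HasDerivAt euler (-1) 0 := by
  rw [hasDerivAt_iff_isLittleO]
  have h1 : (fun q : ℂ => euler q - euler 0 - (q - 0) • (-1 : ℂ)) =O[𝓝 0] fun q => q ^ 2 := by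
    refine IsBigO.of_bound 8 ?_
    have : ∀ᶠ q : ℂ in 𝓝 0, ‖q‖ ≤ 1 / 2 := by
      filter_upwards [Metric.closedBall_mem_nhds (0 : ℂ) (by norm_num : (0 : ℝ) < 1 / 2)] with q hq
      simpa using hq
    filter_upwards [this] with q hq
    obtain ⟨R, hR, hR'⟩ := euler_tail_bound 1 hq
    have e : euler q - euler 0 - (q - 0) • (-1 : ℂ) = (1 - q) * (R - 1) := by
      rw [hR, euler_zero]; simp; ring
    rw [e, norm_mul, norm_pow]
    have h2 : ‖1 - q‖ ≤ 2 := (norm_sub_le _ _).trans (by rw [norm_one]; linarith)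
    calc ‖1 - q‖ * ‖R - 1‖ ≤ 2 * (4 * ‖q‖ ^ (1 + 1)) := by gcongr
      _ = _ := by ring
  refine h1.trans_isLittleO ?_
  have := isLittleO_pow_pow (𝕜 := ℂ) (m := 1) (n := 2) (by norm_num)
  simpa using this

lemma hasDerivAt_quotSeries_zero (hp : 2 ≤ p) : HasDerivAt (quotSeries p h) (-(2 * h)) 0 := by
  have h1 : HasDerivAt (fun q : ℂ => euler (q ^ p)) 0 0 := by
    have hpow : HasDerivAt (fun q : ℂ => q ^ p) 0 0 := by
      have := hasDerivAt_pow p (0 : ℂ)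
      rw [zero_pow (by omega), mul_zero] at this
      exact this
    have h0 : HasDerivAt euler (-1) ((0 : ℂ) ^ p) := by
      rw [zero_pow (by omega)]; exact hasDerivAt_euler_zero
    have := h0.comp (0 : ℂ) hpow
    rw [mul_zero] at this
    exact this
  have e0 : euler ((0 : ℂ) ^ p) = 1 := by rw [zero_pow (by omega), euler_zero]
  have h2 := (hasDerivAt_euler_zero.div h1 (by rw [e0]; exact one_ne_zero)).pow (2 * h)
  rw [Pi.div_apply, e0, euler_zero] at h2
  simp only [div_one, one_pow, mul_one, mul_zero, sub_zero] at h2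
  push_cast at h2
  rw [mul_neg, mul_one] at h2
  exact h2

/-- The regular part of the `q`-expansion of the Fricke Hauptmodul. -/
noncomputable def frickeReg (p h : ℕ) (q : ℂ) : ℂ :=
  dslope (quotSeries p h) 0 q + 2 * h + (p : ℂ) ^ h * (q / quotSeries p h q)

lemma etaQuot_eq (hp : p.Prime) (hh : h * (p - 1) = 12) (z : ℂ) :
    etaQuot p h z = (qc z)⁻¹ * quotSeries p h (qc z) := by
  have hc : (h : ℂ) * (p - 1) = 12 := by
    have : ((h * (p - 1) : ℕ) : ℂ) = 12 := by rw [hh]; norm_num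
    rwa [Nat.cast_mul, Nat.cast_sub hp.one_le, Nat.cast_one] at this
  rw [etaQuot, quotSeries, ← div_pow, ← pow_mul, dedekindEta_eq_exp_mul_euler,
    dedekindEta_eq_exp_mul_euler, qc_nat_mul, mul_div_mul_comm, mul_pow, ← Complex.exp_sub,
    ← Complex.exp_nat_mul, qc, ← Complex.exp_neg]
  congr 2
  push_cast
  linear_combination (-2 * (Real.pi : ℂ) * I * z / 12) * hc

theorem isHaupt_fricke (hp : p.Prime) (hh : h * (p - 1) = 12) :
    IsHaupt (FrickeGroup p) (jnStar p) (frickeReg p h) where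
  transl_mem := (mem_fricke_iff hp _).2 (Or.inl ⟨1, 1, 0, 1, by rw [mul_zero]; exact rep_transl 1⟩)
  neg_one_mem := (mem_fricke_iff hp _).2 (Or.inl ⟨-1, 0, 0, -1, by
    rw [mul_zero]; simpa using rep_one.neg⟩)
  discrete := ⟨p, by exact_mod_cast hp.pos, fun γ hγ i j => fricke_discrete hp hγ i j⟩
  fund := ⟨1 / (2 * p), by have := hp.pos; positivity, fun z hz => fricke_fund hp hz⟩
  diff := by
    have h1 := differentiableOn_etaQuot (h := h) hp.pos
    rw [funext (jnStar_eq hp hh)]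
    exact (h1.add_const _).add ((h1.inv fun z hz => etaQuot_ne_zero hp.pos hz).const_mul _)
  inv := fun γ hγ z hz => jnStar_invariant hp hh hγ hz
  gdiff := by
    have h1 := differentiableOn_quotSeries (h := h) hp.pos
    have h2 : DifferentiableOn ℂ (dslope (quotSeries p h) 0) (Metric.ball 0 1) :=
      (Complex.differentiableOn_dslope (Metric.ball_mem_nhds _ one_pos)).2 h1
    exact (h2.add_const _).add ((differentiableOn_id.div h1 fun q hq =>
      quotSeries_ne_zero hp.pos hq).const_mul _)
  g_zero := by
    rw [frickeReg, dslope_same, (hasDerivAt_quotSeries_zero hp.two_le).deriv]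
    simp
  qexp := fun z hz => by
    have hq := qc_ne_zero z
    rw [jnStar_eq hp hh, etaQuot_eq hp hh, frickeReg, dslope_of_ne _ hq, slope_def_field,
      quotSeries_zero hp.pos]
    have := quotSeries_ne_zero (h := h) hp.pos (qc_mem_ball hz)
    field_simp
    ring

/-- The weight `24` form `(η(z) η(pz)) ^ 24`. -/
noncomputable def frickeDisc (p : ℕ) (z : ℂ) : ℂ := (dedekindEta z * dedekindEta (p * z)) ^ 24

lemma dedekindEta_pow_24 {a b c d : ℤ} (h : a * d - b * c = 1) {z : ℂ} (hz : z ∈ UH) :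
    dedekindEta ((a * z + b) / (c * z + d)) ^ 24 = (c * z + d) ^ 12 * dedekindEta z ^ 24 := by
  have := dedekindEta_sq_transform h hz
  rw [show 24 = 2 * 12 by norm_num, pow_mul, this, mul_pow, mul_pow, unity12_pow, pow_mul]
  rw [show ((12 : ℕ) : ℤ) = 12 by norm_num, unity12_twelve_mul, one_mul]

lemma frickeDisc_transform (hp : p.Prime) {γ : SL2R} (hγ : γ ∈ FrickeGroup p) {z : ℂ}
    (hz : z ∈ UH) : frickeDisc p (moebius γ z) = den γ z ^ 24 * frickeDisc p z := by
  refine fricke_transform hp (frickeDisc p) 24 ?_ ?_ hγ hz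
  · rintro X ⟨a, b, c, d, hX⟩ z hz
    have hdet : a * d - b * (p * c) = 1 := by simpa using hX.det
    have hdet' : a * d - p * b * c = 1 := by linarith
    have hpz := nat_mul_mem_UH hp.pos hz
    have h1 := dedekindEta_pow_24 hdet hz
    have h2 := dedekindEta_pow_24 hdet' hpz
    have e1 : (a * (p * z) + (p * b : ℤ)) / (c * (p * z) + d) = (p : ℂ) * moebius X z := by
      rw [hX.moebius one_pos, mul_div_assoc']
      push_cast
      congr 1 <;> ring
    have e := hX.den z
    simp only [Nat.cast_one, Real.sqrt_one, ofReal_one, one_mul] at e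
    rw [← hX.moebius one_pos] at h1
    rw [e1] at h2
    rw [frickeDisc, frickeDisc, mul_pow, h1, h2, e]
    push_cast
    ring
  · intro W hW z hz
    have hpz := nat_mul_mem_UH hp.pos hz
    have e := hW.den z
    rw [moebius_involution hp.pos hW, frickeDisc, frickeDisc, neg_one_div_mul hp.pos, mul_pow,
      show 24 = 2 * 12 by norm_num, pow_mul, pow_mul, dedekindEta_sq_neg_inv hpz,
      dedekindEta_sq_neg_inv hz]
    have hs : (Real.sqrt p : ℂ) * Real.sqrt p = p := by exact_mod_cast sqrt_nat_sq p
    have hp' : (p : ℂ) ≠ 0 := by exact_mod_cast hp.ne_zero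
    have e2 : den W z ^ 2 = p * z ^ 2 := by
      apply mul_left_cancel₀ hp'
      push_cast at e
      linear_combination (Real.sqrt p * den W z + p * z) * e - den W z ^ 2 * hs
    have hI : I ^ 24 = 1 := by
      rw [show 24 = 2 * 12 by norm_num, pow_mul, I_sq]; norm_num
    rw [pow_mul (den W z), e2]
    linear_combination ((p : ℂ) ^ 12 * z ^ 24 * dedekindEta (p * z) ^ 24 * dedekindEta z ^ 24) * hI

lemma frickeDisc_ne_zero (hp : 0 < p) {z : ℂ} (hz : z ∈ UH) : frickeDisc p z ≠ 0 :=
  pow_ne_zero _ (mul_ne_zero (dedekindEta_ne_zero hz) (dedekindEta_ne_zero (nat_mul_mem_UH hp hz)))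

lemma differentiableOn_frickeDisc (hp : 0 < p) : DifferentiableOn ℂ (frickeDisc p) UH := by
  have h1 : DifferentiableOn ℂ (fun z : ℂ => dedekindEta (p * z)) UH :=
    differentiableOn_dedekindEta.comp (by fun_prop) fun z hz => nat_mul_mem_UH hp hz
  exact (differentiableOn_dedekindEta.mul h1).pow 24

lemma hasJet_frickeDisc (hp : 2 ≤ p) :
    ∃ m, HasJet (frickeDisc p) m (24 * if p = 2 then 5 else 3) := by
  have h1 := jet_euler_qc_pow (k := 1) one_pos
  have hp2 := jet_euler_qc_pow (k := p) (by omega)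
  have h3 := ((h1.mul hp2).pow 24).mul (hasJet_qc_zpow (p + 1))
  refine ⟨24 * (0 + 0) + (p + 1), ?_⟩
  convert h3.congr' (Eventually.of_forall fun z => ?_) using 1
  · norm_num
  · rw [if_neg (show p ≠ 1 by omega), if_pos rfl]
    split_ifs <;> norm_num
  · simp only [frickeDisc]
    rw [dedekindEta_eq_exp_mul_euler, dedekindEta_eq_exp_mul_euler, qc_nat_mul, mul_mul_mul_comm,
      ← Complex.exp_add, mul_pow (Complex.exp _) _ 24, ← Complex.exp_nat_mul, pow_one, mul_comm]
    congr 1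
    rw [qc, ← Complex.exp_int_mul]
    congr 1
    push_cast
    ring

end

end FrickeTrace

namespace FrickeTrace

open Filter Topology

/-- The Eisenstein series `E₄` as a function of `q`. -/
noncomputable def eisenFour : ℂ → ℂ :=
  UpperHalfPlane.cuspFunction 1 (ModularForm.E (k := 4) (by norm_num))

lemma differentiableOn_eisenFour : DifferentiableOn ℂ eisenFour (Metric.ball 0 1) := fun _ hq =>
  (ModularFormClass.differentiableAt_cuspFunction _ one_pos
    one_mem_strictPeriods_SL (mem_ball_zero_iff.1 hq)).differentiableWithinAt

lemma eisenFour_zero : eisenFour 0 = 1 := by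
  have h := EisensteinSeries.E_qExpansion_coeff_zero (k := 4) (by norm_num) (by decide)
  rw [UpperHalfPlane.qExpansion_coeff] at h
  simpa [eisenFour] using h

lemma eisenFour_transform {a b c d : ℤ} (h : a * d - b * c = 1) {z : ℂ} (hz : z ∈ UH) :
    eisenFour (qc ((a * z + b) / (c * z + d))) = (c * z + d) ^ 4 * eisenFour (qc z) := by
  have hval : ∀ τ : UpperHalfPlane, eisenFour (qc τ) = ModularForm.E (k := 4) (by norm_num) τ :=
    fun τ => by
      rw [qc_eq_qParam]
      exact SlashInvariantFormClass.eq_cuspFunction _ τ one_mem_strictPeriods_SL one_ne_zero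
  let γ : Matrix.SpecialLinearGroup (Fin 2) ℤ := ⟨!![a, b; c, d], by
    rw [Matrix.det_fin_two_of]; exact h⟩
  have h1 := UpperHalfPlane.coe_specialLinearGroup_apply γ ⟨z, hz⟩
  have h2 := SlashInvariantForm.slash_action_eqn' (ModularForm.E (k := 4) (by norm_num))
    (γ := Matrix.SpecialLinearGroup.toGL (Matrix.SpecialLinearGroup.map (Int.castRingHom ℝ) γ))
    (Γ := (Matrix.SpecialLinearGroup.mapGL ℝ : Matrix.SpecialLinearGroup (Fin 2) ℤ →* _).range)
    (MonoidHom.mem_range.2 ⟨γ, rfl⟩) ⟨z, hz⟩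
  have h3 := hval (γ • ⟨z, hz⟩)
  rw [h1] at h3
  have h4 := hval ⟨z, hz⟩
  have h5 : ModularForm.E (k := 4) (by norm_num) (γ • (⟨z, hz⟩ : UpperHalfPlane)) = _ := h2
  rw [h5, ← h4] at h3
  have h6 : ∀ i j, (Matrix.SpecialLinearGroup.toGL
      (Matrix.SpecialLinearGroup.map (Int.castRingHom ℝ) γ)) i j = ((γ i j : ℤ) : ℝ) :=
    fun _ _ => rfl
  rw [h6, h6] at h3
  simpa [γ, zpow_ofNat] using h3

/-- The `q`-series of `q j`. -/
noncomputable def jSeries (q : ℂ) : ℂ := eisenFour q ^ 3 / euler q ^ 24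

lemma differentiableOn_jSeries : DifferentiableOn ℂ jSeries (Metric.ball 0 1) :=
  (differentiableOn_eisenFour.pow 3).div (differentiableOn_euler.pow 24) fun _ hq =>
    pow_ne_zero _ (euler_ne_zero (by simpa using hq))

lemma jSeries_zero : jSeries 0 = 1 := by simp [jSeries, eisenFour_zero, euler_zero]

/-- The modular invariant normalised to have vanishing constant term. -/
noncomputable def jOne (z : ℂ) : ℂ := (qc z)⁻¹ * jSeries (qc z) - deriv jSeries 0

/-- The regular part of `jOne`. -/
noncomputable def jOneReg (q : ℂ) : ℂ := dslope jSeries 0 q - deriv jSeries 0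

lemma dedekindEta_pow_24_eq (z : ℂ) : dedekindEta z ^ 24 = qc z * euler (qc z) ^ 24 := by
  rw [dedekindEta_eq_exp_mul_euler, mul_pow, ← Complex.exp_nat_mul]
  congr 1
  rw [qc]
  congr 1
  push_cast
  ring

lemma jOne_eq {z : ℂ} : jOne z = eisenFour (qc z) ^ 3 / dedekindEta z ^ 24 - deriv jSeries 0 := by
  rw [jOne, jSeries, dedekindEta_pow_24_eq, inv_mul_eq_div, div_div, mul_comm (euler _ ^ 24)]

theorem isHaupt_jOne : IsHaupt SLZ jOne jOneReg where
  transl_mem := ⟨_, _, _, _, rep_transl 1⟩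
  neg_one_mem := ⟨_, _, _, _, rep_one.neg⟩
  discrete := by
    refine ⟨1, one_pos, ?_⟩
    rintro γ ⟨a, b, c, d, h⟩ i j
    obtain ⟨h00, h01, h10, h11⟩ := h
    simp only [Nat.cast_one, Real.sqrt_one, one_mul] at h00 h01 h10 h11
    fin_cases i <;> fin_cases j
    · exact ⟨a ^ 2, by simp [h00]⟩
    · exact ⟨b ^ 2, by simp [h01]⟩
    · exact ⟨c ^ 2, by simp [h10]⟩
    · exact ⟨d ^ 2, by simp [h11]⟩
  fund := ⟨1 / 2, by norm_num, fun z hz => SLZ_fund hz⟩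
  diff := by
    have h1 : DifferentiableOn ℂ (fun z => jSeries (qc z)) UH :=
      differentiableOn_jSeries.comp differentiable_qc.differentiableOn fun z hz => qc_mem_ball hz
    exact (((differentiable_qc.differentiableOn).inv fun z _ => qc_ne_zero z).mul h1).sub_const _
  inv := by
    rintro γ ⟨a, b, c, d, h⟩ z hz
    have hdet : a * d - b * c = 1 := by simpa using h.det
    have hne := (intMoebius_mem hdet hz).2
    rw [jOne_eq, jOne_eq, h.moebius one_pos, dedekindEta_pow_24 hdet hz, eisenFour_transform hdet hz,
      mul_pow, ← pow_mul, mul_div_mul_left _ _ (pow_ne_zero _ hne)]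
  gdiff := ((Complex.differentiableOn_dslope (Metric.ball_mem_nhds _ one_pos)).2
    differentiableOn_jSeries).sub_const _
  g_zero := by rw [jOneReg, dslope_same, sub_self]
  qexp := fun z _ => by
    have hq := qc_ne_zero z
    rw [jOne, jOneReg, dslope_of_ne _ hq, slope_def_field, jSeries_zero]
    field_simp
    ring

end FrickeTrace

namespace FrickeTrace

open Filter Topology

/-- Index set of the matrices `[[a, b], [0, d]]` with `(a, d) ∈ S` and `0 ≤ b < d`. -/
def pairIdx (S : Finset (ℕ × ℕ)) : Finset (Σ _ : ℕ × ℕ, ℕ) := S.sigma fun x => Finset.range x.2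

/-- The matrix `[[a, b], [0, d]]` attached to an index. -/
noncomputable def pairM (i : Σ _ : ℕ × ℕ, ℕ) : SL2R := upM i.1.1 i.1.2 i.2

section
variable {Γ : Subgroup SL2R} {J g : ℂ → ℂ} {S : Finset (ℕ × ℕ)} {s : ℕ}

lemma mem_pairIdx {i : Σ _ : ℕ × ℕ, ℕ} : i ∈ pairIdx S ↔ i.1 ∈ S ∧ i.2 < i.1.2 := by
  rw [pairIdx, Finset.mem_sigma, Finset.mem_range]

lemma IsHaupt.hasJet_pairs (H : IsHaupt Γ J g) (hs : 0 < s) (hS : ∀ x ∈ S, 0 < x.1 ∧ 0 < x.2) :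
    ∃ m, HasJet (famProd Γ J (upM s 1 0) (pairIdx S) pairM) m
      (∑ x ∈ S, (kap ((s * x.2 : ℕ) - (x.1 : ℤ)) +
        if s = 1 ∧ x.1 = 1 then 2 * x.2 * (iteratedDeriv x.2 g 0 / x.2.factorial) else 0)) := by
  have h : ∀ x : ℕ × ℕ, ∃ m, x ∈ S →
      HasJet (fun z => ∏ b ∈ Finset.range x.2, fac Γ J (upM s 1 0) (upM x.1 x.2 b) z) m
        (kap ((s * x.2 : ℕ) - (x.1 : ℤ)) +
        if s = 1 ∧ x.1 = 1 then 2 * x.2 * (iteratedDeriv x.2 g 0 / x.2.factorial) else 0) := by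
    intro x
    by_cases hx : x ∈ S
    · obtain ⟨m, hm⟩ := H.jet_pair hs (hS x hx).1 (hS x hx).2
      exact ⟨m, fun _ => hm⟩
    · exact ⟨0, fun h => absurd h hx⟩
  choose m hm using h
  refine ⟨_, (HasJet.prod S hm).congr' (Eventually.of_forall fun z => ?_)⟩
  simp only [famProd, pairIdx, pairM]
  rw [Finset.prod_sigma]

open Classical in
lemma IsHaupt.famWeight_pairs (H : IsHaupt Γ J g) (hs : 0 < s) (hS : ∀ x ∈ S, 0 < x.1 ∧ 0 < x.2) :
    famWeight Γ (upM s 1 0) (pairIdx S) pairM = (S.filter fun x => x.1 = s * x.2).card := by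
  rw [famWeight]
  refine Finset.card_bij' (fun i _ => i.1) (fun x _ => ⟨x, 0⟩) ?_ ?_ ?_ ?_
  · rintro ⟨x, b⟩ hi
    rw [Finset.mem_filter, mem_pairIdx] at hi
    exact Finset.mem_filter.2 ⟨hi.1.1, ((H.trivial_iff hs (hS x hi.1.1).1 hi.1.2).1 hi.2).1⟩
  · intro x hx
    rw [Finset.mem_filter] at hx
    rw [Finset.mem_filter, mem_pairIdx]
    exact ⟨⟨hx.1, (hS x hx.1).2⟩, (H.trivial_iff hs (hS x hx.1).1 (hS x hx.1).2).2 ⟨hx.2, rfl⟩⟩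
  · rintro ⟨x, b⟩ hi
    rw [Finset.mem_filter, mem_pairIdx] at hi
    have := ((H.trivial_iff hs (hS x hi.1.1).1 hi.1.2).1 hi.2).2
    simp only at this
    rw [this]
  · intro x _
    rfl

lemma IsHaupt.famDisjoint_pairs (H : IsHaupt Γ J g) (hS : ∀ x ∈ S, 0 < x.1 ∧ 0 < x.2)
    (hinj : ∀ x ∈ S, ∀ y ∈ S, x.1 * y.2 = y.1 * x.2 → x = y) :
    FamDisjoint Γ (pairIdx S) pairM := by
  rintro ⟨x, b⟩ hi ⟨y, b'⟩ hj h
  rw [mem_pairIdx] at hi hj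
  simp only at hi hj
  obtain ⟨h1, k, hk⟩ := H.upM_mul_inv_mem (hS x hi.1).1 (hS x hi.1).2 (hS y hj.1).1 (hS y hj.1).2 h
  obtain rfl := hinj x hi.1 y hj.1 h1
  have hd : (0 : ℤ) < x.2 := by exact_mod_cast (hS x hi.1).2
  have hb : (b : ℤ) = b' + k * x.2 := by
    apply mul_right_cancel₀ hd.ne'
    linarith
  have hk0 : k = 0 := by
    have h1 : (b : ℤ) < x.2 := by exact_mod_cast hi.2
    have h2 : (b' : ℤ) < x.2 := by exact_mod_cast hj.2
    have h3 : k < 1 := by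
      by_contra hc
      nlinarith
    have h4 : -1 < k := by
      by_contra hc
      nlinarith
    omega
  rw [hk0] at hb
  simp only [Sigma.mk.injEq, heq_eq_eq, true_and]
  omega

lemma famSet_pairs {N : Set SL2R} (h1 : ∀ γ ∈ Γ, ∀ X ∈ N, γ * X ∈ N)
    (h2 : ∀ x ∈ S, ∀ b < x.2, upM x.1 x.2 b ∈ N)
    (h3 : ∀ X ∈ N, ∃ γ ∈ Γ, ∃ x ∈ S, ∃ b < x.2, γ * X = upM x.1 x.2 b) :
    famSet Γ (pairIdx S) pairM = N := by
  ext X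
  constructor
  · rintro ⟨⟨x, b⟩, hi, h⟩
    rw [mem_pairIdx] at hi
    have := h1 _ h _ (h2 x hi.1 b hi.2)
    rwa [pairM, inv_mul_cancel_right] at this
  · intro hX
    obtain ⟨γ, hγ, x, hx, b, hb, h⟩ := h3 X hX
    refine ⟨⟨x, b⟩, mem_pairIdx.2 ⟨hx, hb⟩, ?_⟩
    rw [pairM]
    simp only
    rw [← h, _root_.mul_inv_rev, mul_inv_cancel_left]
    exact Γ.inv_mem hγ

lemma exists_mul_eq_upM (ht : transl 1 ∈ Γ) (hn : (-1 : SL2R) ∈ Γ) {m : ℕ} (hm : 0 < m) {Y : SL2R}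
    {a b d : ℤ} (hY : Rep m Y a b 0 d) :
    ∃ γ ∈ Γ, ∃ b' < d.natAbs, γ * Y = upM a.natAbs d.natAbs b' := by
  have key : ∀ {Y : SL2R} {a b d : ℤ}, Rep m Y a b 0 d → 0 < d →
      ∃ γ ∈ Γ, ∃ b' < d.natAbs, γ * Y = upM a.natAbs d.natAbs b' := by
    intro Y a b d hY hd
    have hdet : a * d = m := by have := hY.det; linarith
    have ha : 0 < a := by
      by_contra hc
      have : (0 : ℤ) < m := by exact_mod_cast hm
      nlinarith
    have hb0 := Int.emod_nonneg b hd.ne'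
    have hb1 := Int.emod_lt_of_pos b hd
    refine ⟨transl (-(b / d)), transl_int_mem ht _, (b % d).natAbs, by omega, ?_⟩
    have h1 : Rep m (upM a.natAbs d.natAbs (b % d).natAbs) a (b % d) 0 d := by
      have := rep_upM (a := a.natAbs) (d := d.natAbs) (b % d).natAbs (by omega) (by omega)
      rw [Int.natAbs_of_nonneg ha.le, Int.natAbs_of_nonneg hd.le, Int.natAbs_of_nonneg hb0] at this
      have e : a.natAbs * d.natAbs = m := by rw [← Int.natAbs_mul, hdet, Int.natAbs_natCast]
      rwa [e] at this
    refine Rep.unique hm ?_ h1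
    have h2 := (rep_transl (-(b / d))).mul hY
    rw [one_mul] at h2
    have e : b % d = 1 * b + -(b / d) * d := by
      have := Int.emod_add_mul_ediv b d
      linarith
    rw [e]
    convert h2 using 1 <;> ring
  rcases lt_trichotomy d 0 with hd | rfl | hd
  · have hY' := hY.neg
    rw [neg_zero] at hY'
    obtain ⟨γ, hγ, b', hb', h⟩ := key hY' (by omega)
    rw [Int.natAbs_neg] at hb'
    refine ⟨γ * -1, Γ.mul_mem hγ hn, b', hb', ?_⟩
    rw [Int.natAbs_neg, Int.natAbs_neg] at h
    rw [← h, mul_assoc, neg_one_mul]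
  · have := hY.det
    have : (0 : ℤ) < m := by exact_mod_cast hm
    linarith
  · exact key hY hd

lemma exists_coprime_factor {a c : ℤ} (h : a ≠ 0 ∨ c ≠ 0) :
    ∃ a' c' g : ℤ, IsCoprime c' (-a') ∧ a = a' * g ∧ c = c' * g := by
  have hg : 0 < Int.gcd a c := Int.gcd_pos_iff.2 h
  obtain ⟨a', c', h1, h2, h3⟩ := Int.exists_gcd_one hg
  exact ⟨a', c', _, (Int.isCoprime_iff_gcd_eq_one.2 h1).symm.neg_right, h2, h3⟩

lemma exists_SLZ_kill {a c : ℤ} (h : a ≠ 0 ∨ c ≠ 0) :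
    ∃ γ ∈ SLZ, γ.1 1 0 * a + γ.1 1 1 * c = 0 := by
  obtain ⟨a', c', g, hc, ha, hc'⟩ := exists_coprime_factor h
  obtain ⟨X, u, v, hX⟩ := exists_SLZ_row hc
  refine ⟨X, ⟨_, _, _, _, hX⟩, ?_⟩
  obtain ⟨-, -, h3, h4⟩ := hX
  simp only [Nat.cast_one, Real.sqrt_one, one_mul] at h3 h4
  rw [h3, h4, ha, hc']
  push_cast
  ring

lemma exists_fricke_kill {p : ℕ} (hp : p.Prime) {a c : ℤ} (h : a ≠ 0 ∨ c ≠ 0) :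
    ∃ γ ∈ FrickeGroup p, γ.1 1 0 * a + γ.1 1 1 * c = 0 := by
  obtain ⟨a', c', g, hc, ha, hc'⟩ := exists_coprime_factor h
  obtain ⟨X, hX, ⟨-, u, v, hR⟩ | ⟨-, u, v, hR⟩⟩ := exists_fricke_row hp hc
  all_goals
    refine ⟨X, hX, ?_⟩
    obtain ⟨-, -, h3, h4⟩ := hR
  · simp only [Nat.cast_one, Real.sqrt_one, one_mul] at h3 h4
    rw [h3, h4, ha, hc']
    push_cast
    ring
  · have h0 : Real.sqrt p ≠ 0 := (Real.sqrt_pos.2 (by exact_mod_cast hp.pos)).ne'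
    apply mul_left_cancel₀ h0
    rw [mul_add, ← mul_assoc, ← mul_assoc, h3, h4, ha, hc']
    push_cast
    ring

lemma Rep.row_zero {m : ℕ} {X : SL2R} {a b c d : ℤ} (hX : Rep m X a b c d)
    (h : X.1 1 0 = 0) : c = 0 := by
  have := hX.2.2.1
  rw [h, mul_zero] at this
  exact_mod_cast this.symm

lemma Rep.kill {m : ℕ} {X γ : SL2R} {a b c d : ℤ} (hm : 0 < m) (hX : Rep m X a b c d)
    (h : γ.1 1 0 * a + γ.1 1 1 * c = 0) : (γ * X).1 1 0 = 0 := by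
  have h0 : Real.sqrt m ≠ 0 := (Real.sqrt_pos.2 (by exact_mod_cast hm)).ne'
  apply mul_left_cancel₀ h0
  rw [mul_entry]
  linear_combination h + γ.1 1 0 * hX.1 + γ.1 1 1 * hX.2.2.1

lemma Rep.col_ne_zero {m : ℕ} {X : SL2R} {a b c d : ℤ} (hm : 0 < m) (hX : Rep m X a b c d) :
    a ≠ 0 ∨ c ≠ 0 := by
  by_contra! hc
  have := hX.det
  rw [hc.1, hc.2] at this
  have : (0 : ℤ) < m := by exact_mod_cast hm
  linarith

end

/-- Integral matrices of determinant `m` whose first column is divisible by `t`. -/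
def colSet (t m : ℕ) : Set SL2R := {X | ∃ a b c d : ℤ, Rep m X a b c d ∧ (t : ℤ) ∣ a ∧ (t : ℤ) ∣ c}

/-- Diagonals of the upper triangular representatives of `SLZ \ colSet t m`. -/
def colPairs (t m : ℕ) : Finset (ℕ × ℕ) := m.divisorsAntidiagonal.filter fun x => t ∣ x.1

/-- Matrices of determinant `n` in the Hecke correspondence of the Fricke group. -/
def frickeSet (p n : ℕ) : Set SL2R :=
  {X | (∃ a b c d : ℤ, Rep n X a b c d ∧ (p : ℤ) ∣ c) ∨
    ∃ a b c d : ℤ, Rep (p * n) X a b c d ∧ (p : ℤ) ∣ a ∧ (p : ℤ) ∣ c ∧ (p : ℤ) ∣ d}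

/-- Diagonals of the upper triangular representatives of `Γ₀*(p) \ frickeSet p n`. -/
def frickePairs (p n : ℕ) : Finset (ℕ × ℕ) :=
  n.divisorsAntidiagonal ∪ (p * n).divisorsAntidiagonal.filter fun x => p ∣ x.1 ∧ p ∣ x.2

lemma pos_of_mem_antidiagonal {m : ℕ} {x : ℕ × ℕ} (h : x ∈ m.divisorsAntidiagonal) :
    0 < x.1 ∧ 0 < x.2 := by
  rw [Nat.mem_divisorsAntidiagonal] at h
  constructor <;> refine Nat.pos_of_ne_zero fun h0 => h.2 ?_ <;> rw [← h.1, h0] <;> simp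

lemma pos_of_mem_colPairs {t m : ℕ} : ∀ x ∈ colPairs t m, 0 < x.1 ∧ 0 < x.2 := fun _ hx =>
  pos_of_mem_antidiagonal (Finset.mem_filter.1 hx).1

lemma pos_of_mem_frickePairs {p n : ℕ} : ∀ x ∈ frickePairs p n, 0 < x.1 ∧ 0 < x.2 := by
  intro x hx
  rcases Finset.mem_union.1 hx with h | h
  · exact pos_of_mem_antidiagonal h
  · exact pos_of_mem_antidiagonal (Finset.mem_filter.1 h).1

lemma eq_of_mul_eq {x y : ℕ × ℕ} {m : ℕ} (hx : x ∈ m.divisorsAntidiagonal)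
    (hy : y ∈ m.divisorsAntidiagonal) (h : x.1 * y.2 = y.1 * x.2) : x = y := by
  have px := pos_of_mem_antidiagonal hx
  have py := pos_of_mem_antidiagonal hy
  have h1 := (Nat.mem_divisorsAntidiagonal.1 hx).1
  have h2 := (Nat.mem_divisorsAntidiagonal.1 hy).1
  have e1 : x.1 * x.1 = y.1 * y.1 := by
    have h3 : 0 < x.2 * y.2 := Nat.mul_pos px.2 py.2
    apply Nat.eq_of_mul_eq_mul_right h3
    calc x.1 * x.1 * (x.2 * y.2) = (x.1 * x.2) * (x.1 * y.2) := by ring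
      _ = (y.1 * y.2) * (y.1 * x.2) := by rw [h1, h2, h]
      _ = _ := by ring
  have e2 : x.1 = y.1 := Nat.mul_self_inj.1 e1
  refine Prod.ext e2 ?_
  rw [e2] at h
  exact (Nat.eq_of_mul_eq_mul_left py.1 h).symm

lemma famDisjoint_col {t m : ℕ} : FamDisjoint SLZ (pairIdx (colPairs t m)) pairM :=
  isHaupt_jOne.famDisjoint_pairs pos_of_mem_colPairs fun _ hx _ hy h =>
    eq_of_mul_eq (Finset.mem_filter.1 hx).1 (Finset.mem_filter.1 hy).1 h

lemma famSet_col {t m : ℕ} (hm : 0 < m) : famSet SLZ (pairIdx (colPairs t m)) pairM = colSet t m := by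
  have hmul : ∀ γ ∈ SLZ, ∀ X ∈ colSet t m, γ * X ∈ colSet t m := by
    rintro γ ⟨u, v, w, x, hγ⟩ X ⟨a, b, c, d, hX, ha, hc⟩
    have := hγ.mul hX
    rw [one_mul] at this
    exact ⟨_, _, _, _, this, dvd_add (ha.mul_left _) (hc.mul_left _),
      dvd_add (ha.mul_left _) (hc.mul_left _)⟩
  refine famSet_pairs hmul ?_ ?_
  · intro x hx b _
    obtain ⟨h1, h2⟩ := Finset.mem_filter.1 hx
    have hpos := pos_of_mem_antidiagonal h1
    have := rep_upM b hpos.1 hpos.2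
    rw [(Nat.mem_divisorsAntidiagonal.1 h1).1] at this
    exact ⟨_, _, _, _, this, by exact_mod_cast h2, dvd_zero _⟩
  · intro X hX
    obtain ⟨a, b, c, d, hR, -, -⟩ := id hX
    obtain ⟨γ, hγ, hk⟩ := exists_SLZ_kill (hR.col_ne_zero hm)
    obtain ⟨a', b', c', d', hR', ha', -⟩ := hmul γ hγ X hX
    obtain rfl := hR'.row_zero (hR.kill hm hk)
    obtain ⟨δ, hδ, β, hβ, h⟩ := exists_mul_eq_upM isHaupt_jOne.transl_mem isHaupt_jOne.neg_one_mem
      hm hR'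
    refine ⟨δ * γ, SLZ.mul_mem hδ hγ, (a'.natAbs, d'.natAbs), ?_, β, hβ, by rw [mul_assoc]; exact h⟩
    have hdet : a' * d' = m := by have := hR'.det; linarith
    rw [colPairs, Finset.mem_filter, Nat.mem_divisorsAntidiagonal]
    refine ⟨⟨?_, hm.ne'⟩, ?_⟩
    · rw [← Int.natAbs_mul, hdet, Int.natAbs_natCast]
    · exact Int.natCast_dvd.1 ha'

lemma frickeSet_mul {p n : ℕ} (hp : 0 < p) {γ X : SL2R} (hγ : InFricke p γ) (hX : X ∈ frickeSet p n) :
    γ * X ∈ frickeSet p n := by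
  rcases hγ with ⟨a, b, c, d, hγ⟩ | ⟨a, b, c, d, hγ⟩ <;>
    rcases hX with ⟨a', b', _, d', hX, ⟨c', rfl⟩⟩ | ⟨_, b', _, _, hX, ⟨a', rfl⟩, ⟨c', rfl⟩, ⟨d', rfl⟩⟩
  · have := hγ.mul hX
    rw [one_mul] at this
    exact Or.inl ⟨_, _, _, _, this, c * a' + d * c', by ring⟩
  · have := hγ.mul hX
    rw [one_mul] at this
    exact Or.inr ⟨_, _, _, _, this, ⟨a * a' + b * c', by ring⟩, ⟨p * c * a' + d * c', by ring⟩,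
      ⟨c * b' + d * d', by ring⟩⟩
  · exact Or.inr ⟨_, _, _, _, hγ.mul hX, ⟨a * a' + b * c', by ring⟩, ⟨c * a' + p * d * c', by ring⟩,
      ⟨c * b' + d * d', by ring⟩⟩
  · refine Or.inl ⟨p * a * a' + b * c', a * b' + b * d', p * (c * a' + d * c'), c * b' + p * d * d',
      Rep.scale hp ?_, dvd_mul_right _ _⟩
    rw [mul_assoc]
    convert hγ.mul hX using 1 <;> ring

lemma frickeSet_mul_right {p n : ℕ} (hp : 0 < p) {γ X : SL2R} (hγ : InFricke p γ)
    (hX : X ∈ frickeSet p n) : X * γ ∈ frickeSet p n := by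
  rcases hγ with ⟨a, b, c, d, hγ⟩ | ⟨a, b, c, d, hγ⟩ <;>
    rcases hX with ⟨a', b', _, d', hX, ⟨c', rfl⟩⟩ | ⟨_, b', _, _, hX, ⟨a', rfl⟩, ⟨c', rfl⟩, ⟨d', rfl⟩⟩
  · have := hX.mul hγ
    rw [mul_one] at this
    exact Or.inl ⟨_, _, _, _, this, c' * a + d' * c, by ring⟩
  · have := hX.mul hγ
    rw [mul_one] at this
    exact Or.inr ⟨_, _, _, _, this, ⟨a' * a + b' * c, by ring⟩, ⟨c' * a + p * d' * c, by ring⟩,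
      ⟨c' * b + d' * d, by ring⟩⟩
  · have := hX.mul hγ
    rw [mul_comm n p] at this
    exact Or.inr ⟨_, _, _, _, this, ⟨a' * a + b' * c, by ring⟩, ⟨p * c' * a + d' * c, by ring⟩,
      ⟨c' * b + d' * d, by ring⟩⟩
  · refine Or.inl ⟨p * a' * a + b' * c, a' * b + b' * d, p * (c' * a + d' * c), c' * b + p * d' * d,
      Rep.scale hp ?_, dvd_mul_right _ _⟩
    convert hX.mul hγ using 1 <;> ring

lemma not_sq_of_prime {p n k : ℕ} (hp : p.Prime) (hn : 0 < n) : p * (n * n) ≠ k * k := by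
  intro h
  have h1 : n ∣ k := by
    rw [← Nat.pow_dvd_pow_iff two_ne_zero, sq, sq, ← h]
    exact dvd_mul_left _ _
  obtain ⟨l, rfl⟩ := h1
  have h2 : p = l * l := by
    apply Nat.eq_of_mul_eq_mul_right (Nat.mul_pos hn hn)
    rw [h]; ring
  exact hp.prime.irreducible.not_isSquare ⟨l, h2⟩

lemma famDisjoint_fricke {p h n : ℕ} (hp : p.Prime) (hh : h * (p - 1) = 12) (hn : 0 < n) :
    FamDisjoint (FrickeGroup p) (pairIdx (frickePairs p n)) pairM := by
  have key : ∀ x ∈ n.divisorsAntidiagonal, ∀ y ∈ (p * n).divisorsAntidiagonal,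
      x.1 * y.2 ≠ y.1 * x.2 := by
    intro x hx y hy hxy
    have h1 := (Nat.mem_divisorsAntidiagonal.1 hx).1
    have h2 := (Nat.mem_divisorsAntidiagonal.1 hy).1
    refine not_sq_of_prime hp hn (k := x.1 * y.2) ?_
    calc p * (n * n) = (x.1 * x.2) * (y.1 * y.2) := by rw [h1, h2]; ring
      _ = (x.1 * y.2) * (y.1 * x.2) := by ring
      _ = _ := by rw [hxy]
  refine (isHaupt_fricke hp hh).famDisjoint_pairs pos_of_mem_frickePairs fun x hx y hy hxy => ?_
  rcases Finset.mem_union.1 hx with hx | hx <;> rcases Finset.mem_union.1 hy with hy | hy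
  · exact eq_of_mul_eq hx hy hxy
  · exact absurd hxy (key x hx y (Finset.mem_filter.1 hy).1)
  · exact absurd hxy.symm (key y hy x (Finset.mem_filter.1 hx).1)
  · exact eq_of_mul_eq (Finset.mem_filter.1 hx).1 (Finset.mem_filter.1 hy).1 hxy

lemma famSet_fricke {p h n : ℕ} (hp : p.Prime) (hh : h * (p - 1) = 12) (hn : 0 < n) :
    famSet (FrickeGroup p) (pairIdx (frickePairs p n)) pairM = frickeSet p n := by
  have hmul : ∀ γ ∈ FrickeGroup p, ∀ X ∈ frickeSet p n, γ * X ∈ frickeSet p n := fun γ hγ X hX =>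
    frickeSet_mul hp.pos ((mem_fricke_iff hp γ).1 hγ) hX
  have H := isHaupt_fricke hp hh
  have hpn : 0 < p * n := Nat.mul_pos hp.pos hn
  refine famSet_pairs hmul ?_ ?_
  · intro x hx b _
    rcases Finset.mem_union.1 hx with hx | hx
    · have hpos := pos_of_mem_antidiagonal hx
      have := rep_upM b hpos.1 hpos.2
      rw [(Nat.mem_divisorsAntidiagonal.1 hx).1] at this
      exact Or.inl ⟨_, _, _, _, this, dvd_zero _⟩
    · obtain ⟨h1, h2, h3⟩ := Finset.mem_filter.1 hx
      have hpos := pos_of_mem_antidiagonal h1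
      have := rep_upM b hpos.1 hpos.2
      rw [(Nat.mem_divisorsAntidiagonal.1 h1).1] at this
      exact Or.inr ⟨_, _, _, _, this, by exact_mod_cast h2, dvd_zero _, by exact_mod_cast h3⟩
  · intro X hX
    have hkill : ∃ γ ∈ FrickeGroup p, (γ * X).1 1 0 = 0 := by
      rcases hX with ⟨a, b, c, d, hR, -⟩ | ⟨a, b, c, d, hR, -⟩
      · obtain ⟨γ, hγ, hk⟩ := exists_fricke_kill hp (hR.col_ne_zero hn)
        exact ⟨γ, hγ, hR.kill hn hk⟩
      · obtain ⟨γ, hγ, hk⟩ := exists_fricke_kill hp (hR.col_ne_zero hpn)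
        exact ⟨γ, hγ, hR.kill hpn hk⟩
    obtain ⟨γ, hγ, hk⟩ := hkill
    rcases hmul γ hγ X hX with ⟨a', b', c', d', hR', -⟩ | ⟨a', b', c', d', hR', ha', -, hd'⟩
    · obtain rfl := hR'.row_zero hk
      obtain ⟨δ, hδ, β, hβ, h⟩ := exists_mul_eq_upM H.transl_mem H.neg_one_mem hn hR'
      refine ⟨δ * γ, (FrickeGroup p).mul_mem hδ hγ, (a'.natAbs, d'.natAbs), ?_, β, hβ,
        by rw [mul_assoc]; exact h⟩
      have hdet : a' * d' = n := by have := hR'.det; linarith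
      refine Finset.mem_union_left _ (Nat.mem_divisorsAntidiagonal.2 ⟨?_, hn.ne'⟩)
      rw [← Int.natAbs_mul, hdet, Int.natAbs_natCast]
    · obtain rfl := hR'.row_zero hk
      obtain ⟨δ, hδ, β, hβ, h⟩ := exists_mul_eq_upM H.transl_mem H.neg_one_mem hpn hR'
      refine ⟨δ * γ, (FrickeGroup p).mul_mem hδ hγ, (a'.natAbs, d'.natAbs), ?_, β, hβ,
        by rw [mul_assoc]; exact h⟩
      have hdet : a' * d' = (p * n : ℕ) := by have := hR'.det; linarith
      refine Finset.mem_union_right _ (Finset.mem_filter.2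
        ⟨Nat.mem_divisorsAntidiagonal.2 ⟨?_, hpn.ne'⟩, Int.natCast_dvd.1 ha', Int.natCast_dvd.1 hd'⟩)
      rw [← Int.natAbs_mul, hdet, Int.natAbs_natCast]

end FrickeTrace

namespace FrickeTrace
open Filter Topology

lemma rep_diag {p : ℕ} (hp : 0 < p) : Rep p (upM p 1 0) p 0 0 1 := by
  have := rep_upM (d := 1) 0 hp one_pos
  rw [mul_one] at this
  exact_mod_cast this

lemma upM_one : upM 1 1 0 = 1 := by
  have := rep_diag one_pos
  rw [Nat.cast_one] at this
  exact this.unique one_pos rep_one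

lemma colSet_mul_right {p t m : ℕ} (ht : t ∣ p) {δ X : SL2R} {a b c d : ℤ}
    (hδ : Rep 1 δ a b (p * c) d) (hX : X ∈ colSet t m) : X * δ ∈ colSet t m := by
  obtain ⟨a', b', c', d', hX, ha, hc⟩ := hX
  have := hX.mul hδ
  rw [mul_one] at this
  have ht' : (t : ℤ) ∣ p := Int.natCast_dvd_natCast.2 ht
  exact ⟨_, _, _, _, this, dvd_add (ha.mul_right _) ((ht'.mul_right _).mul_left _),
    dvd_add (hc.mul_right _) ((ht'.mul_right _).mul_left _)⟩

lemma colSet_one_mul_involution {p n : ℕ} {δ X : SL2R} {a b c d : ℤ}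
    (hδ : Rep p δ (p * a) b (p * c) (p * d)) (hX : X ∈ colSet 1 n) : X * δ ∈ colSet p (p * n) := by
  obtain ⟨a', b', c', d', hX, -, -⟩ := hX
  have := hX.mul hδ
  rw [mul_comm n p] at this
  exact ⟨_, _, _, _, this, ⟨a' * a + b' * c, by ring⟩, ⟨c' * a + d' * c, by ring⟩⟩

lemma colSet_mul_involution {p n : ℕ} (hp : 0 < p) {δ X : SL2R} {a b c d : ℤ}
    (hδ : Rep p δ (p * a) b (p * c) (p * d)) (hX : X ∈ colSet p (p * n)) : X * δ ∈ colSet 1 n := by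
  obtain ⟨_, b', _, d', hX, ⟨a', rfl⟩, ⟨c', rfl⟩⟩ := hX
  refine ⟨p * a' * a + b' * c, a' * b + b' * d, p * c' * a + d' * c, c' * b + d' * d,
    Rep.scale hp ?_, by simp, by simp⟩
  convert hX.mul hδ using 1 <;> ring

section
variable {p h n : ℕ}

lemma famProd_fricke_moebius (hp : p.Prime) (hh : h * (p - 1) = 12) (hn : 0 < n) {δ : SL2R}
    (hδ : δ ∈ FrickeGroup p) {z : ℂ} (hz : z ∈ UH) :
    famProd (FrickeGroup p) (jnStar p) (upM 1 1 0) (pairIdx (frickePairs p n)) pairM (moebius δ z) =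
      den δ z ^ (2 * famWeight (FrickeGroup p) (upM 1 1 0) (pairIdx (frickePairs p n)) pairM) *
        famProd (FrickeGroup p) (jnStar p) (upM 1 1 0) (pairIdx (frickePairs p n)) pairM z := by
  have hD := famDisjoint_fricke hp hh hn
  have hS := famSet_fricke hp hh hn
  have hmem : ∀ i ∈ pairIdx (frickePairs p n), pairM i ∈ frickeSet p n := fun i hi => by
    rw [← hS]
    exact ⟨i, hi, by simp⟩
  refine (isHaupt_fricke hp hh).famProd_moebius ?_ hD hD (fun i hi => ?_) (fun i hi => ?_) hz
  · rw [upM_one]; simpa using hδ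
  · rw [hS]
    exact frickeSet_mul_right hp.pos ((mem_fricke_iff hp δ).1 hδ) (hmem i hi)
  · rw [hS]
    exact frickeSet_mul_right hp.pos ((mem_fricke_iff hp δ).1 hδ).inv (hmem i hi)

/-- The modular function of `τ` attached to the two families of integral matrices. -/
noncomputable def colProd (p n : ℕ) (z : ℂ) : ℂ :=
  famProd SLZ jOne (upM p 1 0) (pairIdx (colPairs 1 n)) pairM z *
    famProd SLZ jOne (upM 1 1 0) (pairIdx (colPairs p (p * n))) pairM z

lemma colProd_moebius (hp : p.Prime) (hn : 0 < n) {δ : SL2R}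
    (hδ : δ ∈ FrickeGroup p) {z : ℂ} (hz : z ∈ UH) :
    colProd p n (moebius δ z) = den δ z ^ (2 *
      (famWeight SLZ (upM p 1 0) (pairIdx (colPairs 1 n)) pairM +
        famWeight SLZ (upM 1 1 0) (pairIdx (colPairs p (p * n))) pairM)) * colProd p n z := by
  have hpn : 0 < p * n := Nat.mul_pos hp.pos hn
  have hmem : ∀ {t m}, 0 < m → ∀ i ∈ pairIdx (colPairs t m), pairM i ∈ colSet t m :=
    fun hm i hi => by
      rw [← famSet_col hm]
      exact ⟨i, hi, by simp⟩
  have hp0 := rep_diag hp.pos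
  rw [colProd, colProd]
  rcases (mem_fricke_iff hp δ).1 hδ with ⟨a, b, c, d, hR⟩ | ⟨a, b, c, d, hR⟩
  · have hR' : Rep 1 δ⁻¹ d (-b) (p * -c) a := by rw [mul_neg]; exact hR.inv
    rw [isHaupt_jOne.famProd_moebius (α' := upM p 1 0) (s' := pairIdx (colPairs 1 n)) (M' := pairM)
        ?_ famDisjoint_col famDisjoint_col (fun i hi => ?_) (fun i hi => ?_) hz,
      isHaupt_jOne.famProd_moebius (α' := upM 1 1 0) (s' := pairIdx (colPairs p (p * n)))
        (M' := pairM) ?_ famDisjoint_col famDisjoint_col (fun i hi => ?_) (fun i hi => ?_) hz]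
    · ring
    · rw [upM_one]
      exact ⟨_, _, _, _, by simpa using hR⟩
    · rw [famSet_col hpn]; exact colSet_mul_right dvd_rfl hR (hmem hpn i hi)
    · rw [famSet_col hpn]; exact colSet_mul_right dvd_rfl hR' (hmem hpn i hi)
    · refine ⟨a, p * b, c, d, Rep.scale hp.pos ?_⟩
      convert (hp0.mul hR).mul hp0.inv using 1 <;> ring
    · rw [famSet_col hn]; exact colSet_mul_right (one_dvd p) hR (hmem hn i hi)
    · rw [famSet_col hn]; exact colSet_mul_right (one_dvd p) hR' (hmem hn i hi)
  · have hR' : Rep p δ⁻¹ (p * d) (-b) (p * -c) (p * a) := by rw [mul_neg]; exact hR.inv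
    rw [isHaupt_jOne.famProd_moebius (α' := upM 1 1 0) (s' := pairIdx (colPairs p (p * n)))
        (M' := pairM)
        ?_ famDisjoint_col famDisjoint_col (fun i hi => ?_) (fun i hi => ?_) hz,
      isHaupt_jOne.famProd_moebius (α' := upM p 1 0) (s' := pairIdx (colPairs 1 n))
        (M' := pairM) ?_ famDisjoint_col famDisjoint_col (fun i hi => ?_) (fun i hi => ?_) hz]
    · ring
    · rw [upM_one, one_mul]
      refine ⟨a, b, c, p * d, Rep.scale hp.pos ?_⟩
      convert hR.mul hp0.inv using 1 <;> ring
    · rw [famSet_col hn]; exact colSet_mul_involution hp.pos hR (hmem hpn i hi)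
    · rw [famSet_col hpn]; exact colSet_one_mul_involution hR' (hmem hn i hi)
    · rw [upM_one, inv_one, mul_one]
      refine ⟨p * a, b, c, d, Rep.scale hp.pos ?_⟩
      convert hp0.mul hR using 1 <;> ring
    · rw [famSet_col hpn]; exact colSet_one_mul_involution hR (hmem hn i hi)
    · rw [famSet_col hn]; exact colSet_mul_involution hp.pos hR' (hmem hpn i hi)

end
end FrickeTrace

namespace FrickeTrace
open Filter Topology

lemma ofReal_quad_eq_zero {a b : ℝ} {z : ℂ} (hz : z ∈ UH) (h : (a : ℂ) * z + b = 0) :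
    a = 0 ∧ b = 0 := by
  have hi := congrArg Complex.im h
  have hr := congrArg Complex.re h
  simp at hi hr
  have ha : a = 0 := hi.resolve_right (ne_of_gt hz)
  rw [ha] at hr
  exact ⟨ha, by simpa using hr⟩

lemma disc_ne_zero {a b c : ℝ} (ha : 0 < a) {z : ℂ} (hz : z ∈ UH) (h : (a : ℂ) * z ^ 2 + b * z + c = 0) :
    b ^ 2 - 4 * a * c ≠ 0 := by
  intro h0
  have h0' : (b : ℂ) ^ 2 - 4 * a * c = 0 := by exact_mod_cast h0
  have h1 : (2 * a * z + b) ^ 2 = 0 := by linear_combination 4 * a * h + h0'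
  have h2 := pow_eq_zero_iff (two_ne_zero) |>.1 h1
  have := ofReal_quad_eq_zero (a := 2 * a) (b := b) hz (by push_cast; exact h2)
  linarith [this.1]

/-- A positive definite form is determined by its root and its discriminant. -/
lemma form_unique {a b c a' b' c' : ℝ} (ha : 0 < a) (ha' : 0 < a') {z : ℂ} (hz : z ∈ UH)
    (hd : b ^ 2 - 4 * a * c = b' ^ 2 - 4 * a' * c') (h : (a : ℂ) * z ^ 2 + b * z + c = 0)
    (h' : (a' : ℂ) * z ^ 2 + b' * z + c' = 0) : a = a' ∧ b = b' ∧ c = c' := by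
  obtain ⟨h1, h2⟩ := ofReal_quad_eq_zero (a := a' * b - a * b') (b := a' * c - a * c') hz (by
    push_cast; linear_combination a' * h - a * h')
  have h3 : (a' ^ 2 - a ^ 2) * (b ^ 2 - 4 * a * c) = 0 := by
    linear_combination (a' * b + a * b') * h1 - 4 * a * a' * h2 - a ^ 2 * hd
  have h4 : a' ^ 2 - a ^ 2 = 0 := (mul_eq_zero.1 h3).resolve_right (disc_ne_zero ha hz h)
  have h5 : a = a' := by
    have : (a' - a) * (a' + a) = 0 := by linear_combination h4
    rcases mul_eq_zero.1 this with h | h <;> linarith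
  subst h5
  refine ⟨rfl, ?_, ?_⟩
  · exact mul_left_cancel₀ ha.ne' (by linarith)
  · exact mul_left_cancel₀ ha.ne' (by linarith)

lemma cmPointC_eq_iff {M : Matrix (Fin 2) (Fin 2) ℝ} (hs : M 1 0 = M 0 1) (h0 : 0 < M 0 0) {z : ℂ}
    (hz : z ∈ UH) :
    cmPointC M = z ↔ ((M 0 0 : ℝ) : ℂ) * z ^ 2 + ((2 * M 0 1 : ℝ) : ℂ) * z + ((M 1 1 : ℝ) : ℂ) = 0 := by
  have hdet : M.det = M 0 0 * M 1 1 - M 0 1 ^ 2 := by rw [Matrix.det_fin_two, hs]; ring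
  have h0' : ((M 0 0 : ℝ) : ℂ) ≠ 0 := by exact_mod_cast h0.ne'
  have hz' : 0 < z.im := hz
  rw [cmPointC, div_eq_iff h0']
  push_cast
  constructor
  · intro h
    have him := congrArg Complex.im h
    simp at him
    have hpos : 0 < M.det := Real.sqrt_pos.1 (by rw [him]; positivity)
    have hsq : ((Real.sqrt M.det : ℝ) : ℂ) ^ 2 = (M.det : ℝ) := by
      exact_mod_cast Real.sq_sqrt hpos.le
    have hdetC : ((M.det : ℝ) : ℂ) = (M 0 0 : ℝ) * (M 1 1 : ℝ) - (M 0 1 : ℝ) ^ 2 := by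
      rw [hdet]; push_cast; ring
    apply mul_left_cancel₀ h0'
    rw [hdetC] at hsq
    generalize ((Real.sqrt M.det : ℝ) : ℂ) = s at *
    rw [mul_zero]
    have h2 : ((M 0 0 : ℝ) : ℂ) * z = -(M 0 1 : ℝ) + I * s := by rw [h]; ring
    linear_combination (((M 0 0 : ℝ) : ℂ) * z + (M 0 1 : ℝ) + I * s) * h2 + s ^ 2 * Complex.I_sq - hsq
  · intro h
    have h1 : (((M 0 0 : ℝ) : ℂ) * z + (M 0 1 : ℝ)) ^ 2 = ((-M.det : ℝ) : ℂ) := by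
      rw [hdet]; push_cast
      linear_combination ((M 0 0 : ℝ) : ℂ) * h
    have him : (((M 0 0 : ℝ) : ℂ) * z + (M 0 1 : ℝ)).im = M 0 0 * z.im := by simp
    have hre : (((M 0 0 : ℝ) : ℂ) * z + (M 0 1 : ℝ)).re = M 0 0 * z.re + M 0 1 := by simp
    have hi := congrArg Complex.im h1
    have hr := congrArg Complex.re h1
    rw [sq, Complex.mul_im, him, hre, Complex.ofReal_im] at hi
    rw [sq, Complex.mul_re, him, hre, Complex.ofReal_re] at hr
    have hp : 0 < M 0 0 * z.im := mul_pos h0 hz'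
    have h3 : M 0 0 * z.re + M 0 1 = 0 := by
      have : (M 0 0 * z.re + M 0 1) * (M 0 0 * z.im) = 0 := by linarith
      exact (mul_eq_zero.1 this).resolve_right hp.ne'
    have h4 : Real.sqrt M.det = M 0 0 * z.im := by
      rw [Real.sqrt_eq_iff_mul_self_eq_of_pos hp]
      rw [h3] at hr
      linarith
    rw [h4]
    apply Complex.ext
    · simp; linarith
    · simp; ring

/-- `z` is the root of a form of discriminant `-d` whose leading coefficient is divisible by `p`. -/
def HasForm (p : ℕ) (d : ℤ) (z : ℂ) : Prop := ∃ Q ∈ QdN d p, cmPointC Q = z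

lemma formMat_entries (a b c : ℤ) : formMat a b c 0 0 = a ∧ formMat a b c 0 1 = b / 2 ∧
    formMat a b c 1 0 = b / 2 ∧ formMat a b c 1 1 = c := by
  simp [formMat]

lemma cmPointC_formMat_iff {a b c : ℤ} (ha : 0 < a) {z : ℂ} (hz : z ∈ UH) :
    cmPointC (formMat a b c) = z ↔ (a : ℂ) * z ^ 2 + b * z + c = 0 := by
  obtain ⟨h1, h2, h3, h4⟩ := formMat_entries a b c
  rw [cmPointC_eq_iff (by rw [h2, h3]) (by rw [h1]; exact_mod_cast ha) hz, h1, h2, h4]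
  push_cast
  rw [mul_div_cancel₀ _ (two_ne_zero' ℂ)]

lemma hasForm_iff {p : ℕ} {d : ℤ} {z : ℂ} (hz : z ∈ UH) : HasForm p d z ↔
    ∃ a b c : ℤ, 0 < a ∧ b ^ 2 - 4 * a * c = -d ∧ (p : ℤ) ∣ a ∧ (a : ℂ) * z ^ 2 + b * z + c = 0 := by
  constructor
  · rintro ⟨Q, ⟨a, b, c, rfl, ha, hd, hp⟩, hQ⟩
    exact ⟨a, b, c, ha, hd, hp, (cmPointC_formMat_iff ha hz).1 hQ⟩
  · rintro ⟨a, b, c, ha, hd, hp, h⟩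
    exact ⟨_, ⟨a, b, c, rfl, ha, hd, hp⟩, (cmPointC_formMat_iff ha hz).2 h⟩

lemma HasForm.pos {p : ℕ} {d : ℤ} {z : ℂ} (hz : z ∈ UH) (h : HasForm p d z) : 0 < d := by
  obtain ⟨Q, ⟨a, b, c, rfl, ha, hd, -⟩, hQ⟩ := h
  obtain ⟨h1, h2, h3, h4⟩ := formMat_entries a b c
  have hz' : 0 < z.im := hz
  have ha' : (0 : ℝ) < a := by exact_mod_cast ha
  rw [cmPointC, div_eq_iff (by rw [h1]; exact_mod_cast ha.ne')] at hQ
  have him := congrArg Complex.im hQ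
  simp [h1] at him
  have hpos : 0 < (formMat a b c).det := Real.sqrt_pos.1 (by rw [him]; positivity)
  rw [Matrix.det_fin_two, h1, h2, h3, h4] at hpos
  have : (0 : ℝ) < 4 * a * c - b ^ 2 := by nlinarith
  have : 0 < 4 * a * c - b ^ 2 := by exact_mod_cast this
  linarith

/-- The number of admissible traces of matrices of determinant `m` fixing `z`. -/
noncomputable def traceCount (p m : ℕ) (R : ℤ → Prop) (z : ℂ) : ℕ :=
  {r : ℤ | R r ∧ HasForm p (4 * m - r ^ 2) z}.ncard

lemma finite_traces {p m : ℕ} {R : ℤ → Prop} {z : ℂ} (hz : z ∈ UH) :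
    {r : ℤ | R r ∧ HasForm p (4 * m - r ^ 2) z}.Finite := by
  refine (Set.finite_Icc (-(4 * m : ℤ)) (4 * m)).subset ?_
  rintro r ⟨-, hr⟩
  have := hr.pos hz
  constructor <;> nlinarith

/-- Nontrivial integral matrices of determinant `m` with lower left entry divisible by `p` and
admissible trace fixing `z`. -/
def fixSet (p m : ℕ) (R : ℤ → Prop) (z : ℂ) : Set SL2R :=
  {X | (∃ a b c d : ℤ, Rep m X a b c d ∧ (p : ℤ) ∣ c ∧ R (a + d)) ∧ moebius X z = z ∧
    X ≠ 1 ∧ X ≠ -1}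

lemma Rep.moebius_eq_self_iff {m : ℕ} (hm : 0 < m) {X : SL2R} {a b c d : ℤ} (hX : Rep m X a b c d)
    {z : ℂ} (hz : z ∈ UH) : _root_.moebius X z = z ↔ (c : ℂ) * z ^ 2 + (d - a) * z - b = 0 := by
  have h0 : (c : ℂ) * z + d ≠ 0 := by
    rw [← hX.den]
    refine mul_ne_zero ?_ (den_ne_zero X hz)
    exact_mod_cast (Real.sqrt_pos.2 (by exact_mod_cast hm : (0 : ℝ) < m)).ne'
  rw [hX.moebius hm, div_eq_iff h0]
  constructor <;> intro h <;> linear_combination -h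

lemma Rep.eq_one_or_neg_one {m : ℕ} (hm : 0 < m) {X : SL2R} {a : ℤ} (hX : Rep m X a 0 0 a) :
    X = 1 ∨ X = -1 := by
  have hd := hX.det
  have h1 : Rep m (1 : SL2R) |a| 0 0 |a| := by
    have : Real.sqrt m = ((|a| : ℤ) : ℝ) := by
      rw [Int.cast_abs, ← Real.sqrt_sq_eq_abs]
      congr 1
      have : (m : ℤ) = a ^ 2 := by linarith
      exact_mod_cast this
    refine ⟨?_, ?_, ?_, ?_⟩ <;> simp [this]
  rcases abs_choice a with h | h <;> rw [h] at h1
  · exact Or.inl (hX.unique hm h1)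
  · right
    have := hX.neg
    rw [neg_zero] at this
    rw [← this.unique hm h1, neg_neg]

lemma Rep.lower_ne_zero {m : ℕ} (hm : 0 < m) {X : SL2R} {a b c d : ℤ} (hX : Rep m X a b c d)
    {z : ℂ} (hz : z ∈ UH) (h : _root_.moebius X z = z) (h1 : X ≠ 1) (h2 : X ≠ -1) : c ≠ 0 := by
  rintro rfl
  have h3 := (hX.moebius_eq_self_iff hm hz).1 h
  obtain ⟨h4, h5⟩ := ofReal_quad_eq_zero (a := d - a) (b := -b) hz (by
    push_cast
    linear_combination h3)
  obtain rfl : d = a := by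
    have : (d : ℝ) = a := by linarith
    exact_mod_cast this
  obtain rfl : b = 0 := by
    have : (b : ℝ) = 0 := by linarith
    exact_mod_cast this
  exact (hX.eq_one_or_neg_one hm).elim h1 h2

lemma ncard_fixSet {p m : ℕ} (hm : 0 < m) {R : ℤ → Prop} (hR : ∀ r, R (-r) ↔ R r) {z : ℂ} (hz : z ∈ UH) :
    (fixSet p m R z).Finite ∧ (fixSet p m R z).ncard = 2 * traceCount p m R z := by
  set T : Set SL2R := {X | (∃ a b c d : ℤ, Rep m X a b c d ∧ (p : ℤ) ∣ c ∧ R (a + d) ∧ 0 < c) ∧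
    moebius X z = z} with hT
  let f : SL2R → ℤ := fun X => ⌊Real.sqrt m * (X.1 0 0 + X.1 1 1)⌋
  have hf : ∀ {X : SL2R} {a b c d : ℤ}, Rep m X a b c d → f X = a + d := by
    intro X a b c d hX
    change ⌊_⌋ = _
    rw [mul_add, hX.1, hX.2.2.2, ← Int.cast_add, Int.floor_intCast]
  have himg : f '' T = {r : ℤ | R r ∧ HasForm p (4 * m - r ^ 2) z} := by
    ext r
    constructor
    · rintro ⟨X, ⟨⟨a, b, c, d, hX, hp, hr, hc⟩, hfix⟩, rfl⟩
      rw [hf hX]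
      refine ⟨hr, (hasForm_iff hz).2 ⟨c, d - a, -b, hc, ?_, hp, ?_⟩⟩
      · linear_combination -4 * hX.det
      · rw [hX.moebius_eq_self_iff hm hz] at hfix
        push_cast
        linear_combination hfix
    · rintro ⟨hr, hF⟩
      obtain ⟨a, b, c, ha, hd, hp, hroot⟩ := (hasForm_iff hz).1 hF
      have hpar : (2 : ℤ) ∣ r - b := by
        have h1 : Even ((r - b) * (r + b)) := ⟨2 * (m - a * c), by linear_combination -hd⟩
        rcases Int.even_mul.1 h1 with h | h
        · exact h.two_dvd
        · have := h.two_dvd; omega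
      obtain ⟨k, hk⟩ := hpar
      obtain rfl : r = b + 2 * k := by linarith
      obtain ⟨X, hX⟩ := exists_rep (a := k) (b := -c) (c := a) (d := k + b) hm (by
        have : 4 * (k * (k + b) - -c * a) = 4 * (m : ℤ) := by linear_combination -hd
        linarith)
      have e : k + (k + b) = b + 2 * k := by ring
      refine ⟨X, ⟨⟨_, _, _, _, hX, hp, ?_, ha⟩, ?_⟩, ?_⟩
      · rw [e]; exact hr
      · rw [hX.moebius_eq_self_iff hm hz]
        push_cast
        linear_combination hroot
      · rw [hf hX, e]
  have hinj : Set.InjOn f T := by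
    rintro X ⟨⟨a, b, c, d, hX, -, -, hc⟩, hfix⟩ Y ⟨⟨a', b', c', d', hY, -, -, hc'⟩, hfix'⟩ hXY
    rw [hf hX, hf hY] at hXY
    rw [hX.moebius_eq_self_iff hm hz] at hfix
    rw [hY.moebius_eq_self_iff hm hz] at hfix'
    have hdisc : (d - a) ^ 2 - 4 * c * -b = (d' - a') ^ 2 - 4 * c' * -b' := by
      linear_combination (a + d + (a' + d')) * hXY - 4 * hX.det + 4 * hY.det
    obtain ⟨h1, h2, h3⟩ := form_unique (a := c) (b := (d - a : ℤ)) (c := (-b : ℤ)) (a' := c')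
      (b' := (d' - a' : ℤ)) (c' := (-b' : ℤ)) (by exact_mod_cast hc) (by exact_mod_cast hc') hz
      (by exact_mod_cast hdisc) (by push_cast; linear_combination hfix)
      (by push_cast; linear_combination hfix')
    have h1 : c = c' := by exact_mod_cast h1
    have h2 : d - a = d' - a' := by exact_mod_cast h2
    have h3 : -b = -b' := by exact_mod_cast h3
    obtain rfl : a = a' := by linarith
    obtain rfl : d = d' := by linarith
    obtain rfl : b = b' := by linarith
    subst h1
    exact hX.unique hm hY
  have hfin : T.Finite := Set.Finite.of_finite_image (by rw [himg]; exact finite_traces hz) hinj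
  have hcard : T.ncard = traceCount p m R z := by
    rw [← hinj.ncard_image, himg, traceCount]
  have hneg : (Neg.neg '' T : Set SL2R).ncard = T.ncard := Set.ncard_image_of_injective _ neg_injective
  have hunion : fixSet p m R z = T ∪ Neg.neg '' T := by
    ext X
    constructor
    · rintro ⟨⟨a, b, c, d, hX, hp, hr⟩, hfix, h1, h2⟩
      rcases (hX.lower_ne_zero hm hz hfix h1 h2).lt_or_gt with h | h
      · refine Or.inr ⟨-X, ⟨⟨_, _, _, _, hX.neg, hp.neg_right, ?_, by linarith⟩, ?_⟩, neg_neg X⟩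
        · rw [← neg_add]; exact (hR _).2 hr
        · rw [moebius_neg]; exact hfix
      · exact Or.inl ⟨⟨_, _, _, _, hX, hp, hr, h⟩, hfix⟩
    · have key : ∀ {a b c d : ℤ} {X}, Rep m X a b c d → c ≠ 0 → X ≠ 1 ∧ X ≠ -1 := by
        intro a b c d X hX hc
        have h3 := hX.2.2.1
        constructor
        · rintro rfl
          apply hc
          simp at h3
          exact_mod_cast h3.symm
        · rintro rfl
          apply hc
          simp at h3
          exact_mod_cast h3.symm
      rintro (⟨⟨a, b, c, d, hX, hp, hr, hc⟩, hfix⟩ | ⟨X, ⟨⟨a, b, c, d, hX, hp, hr, hc⟩, hfix⟩, rfl⟩)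
      · exact ⟨⟨_, _, _, _, hX, hp, hr⟩, hfix, key hX hc.ne'⟩
      · refine ⟨⟨_, _, _, _, hX.neg, hp.neg_right, ?_⟩, ?_, key hX.neg (by simpa using hc.ne')⟩
        · rw [← neg_add]; exact (hR _).2 hr
        · rw [moebius_neg]; exact hfix
  have hdisj : Disjoint T (Neg.neg '' T) := by
    rw [Set.disjoint_left]
    rintro X ⟨⟨a, b, c, d, hX, -, -, hc⟩, -⟩ ⟨Y, ⟨⟨a', b', c', d', hY, -, -, hc'⟩, -⟩, rfl⟩
    have := (hX.entries_unique hY.neg).2.2.1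
    linarith
  rw [hunion]
  refine ⟨hfin.union (hfin.image _), ?_⟩
  rw [Set.ncard_union_eq hdisj hfin (hfin.image _), hneg, hcard]
  ring

end FrickeTrace

namespace FrickeTrace
open Filter Topology

section
variable {p h n : ℕ}

lemma dvd_add_iff_of_dvd_mul (hp : p.Prime) {a d : ℤ} (h : (p : ℤ) ∣ a * d) :
    (p : ℤ) ∣ a + d ↔ (p : ℤ) ∣ a ∧ (p : ℤ) ∣ d := by
  constructor
  · intro hs
    rcases (Nat.prime_iff_prime_int.1 hp).dvd_or_dvd h with h1 | h1
    · exact ⟨h1, (Int.dvd_add_right h1).1 hs⟩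
    · exact ⟨(Int.dvd_add_left h1).1 hs, h1⟩
  · exact fun h => dvd_add h.1 h.2

lemma Rep.dvd_mul_diag {X : SL2R} {a b c d : ℤ} (hX : Rep (p * n) X a b c d)
    (hc : (p : ℤ) ∣ c) : (p : ℤ) ∣ a * d := by
  have h1 : a * d = b * c + p * n := by
    have := hX.det
    push_cast at this
    linarith
  rw [h1]
  exact dvd_add (hc.mul_left _) (dvd_mul_right _ _)

lemma Rep.not_rep_mul_prime (hp : p.Prime) (hn : 0 < n) {X : SL2R} {a b c d a' b' c' d' : ℤ}
    (hX : Rep n X a b c d) (hY : Rep (p * n) X a' b' c' d') : False := by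
  have key : ∀ {x y : ℤ} {t : ℝ}, Real.sqrt n * t = x → Real.sqrt (p * n : ℕ) * t = y → x = 0 := by
    intro x y t hx hy
    by_contra h0
    have e : Real.sqrt (p * n : ℕ) = Real.sqrt p * Real.sqrt n := by
      rw [Nat.cast_mul, Real.sqrt_mul (by positivity)]
    have h1 : (p : ℝ) * (x * x) = y * y := by
      rw [← hy, e, ← hx]
      linear_combination -(Real.sqrt n * t) ^ 2 * sqrt_nat_sq p
    have h2 : (p : ℤ) * (x * x) = y * y := by exact_mod_cast h1
    rw [← Int.natAbs_mul_self' x, ← Int.natAbs_mul_self' y] at h2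
    exact not_sq_of_prime hp (Int.natAbs_pos.2 h0) (by exact_mod_cast h2)
  rcases hX.col_ne_zero hn with h | h
  · exact h (key hX.1 hY.1)
  · exact h (key hX.2.2.1 hY.2.2.1)

lemma order_famProd_fricke (hp : p.Prime) (hh : h * (p - 1) = 12) (hn : 0 < n) {z : ℂ} (hz : z ∈ UH) :
    analyticOrderAt
      (famProd (FrickeGroup p) (jnStar p) (upM 1 1 0) (pairIdx (frickePairs p n)) pairM) z =
      (traceCount p n (fun _ => True) z + traceCount p (p * n) (fun r => (p : ℤ) ∣ r) z : ℕ) := by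
  obtain ⟨m, hm, -, hcard⟩ := (isHaupt_fricke hp hh).order_famProd (upM 1 1 0) pairM hz _
    (famDisjoint_fricke hp hh hn)
  rw [hm]
  congr 1
  have hset : {X ∈ famSet (FrickeGroup p) (pairIdx (frickePairs p n)) pairM |
      moebius X z = moebius (upM 1 1 0) z ∧ X ≠ upM 1 1 0 ∧ X ≠ -upM 1 1 0} =
      fixSet p n (fun _ => True) z ∪ fixSet p (p * n) (fun r => (p : ℤ) ∣ r) z := by
    rw [famSet_fricke hp hh hn, upM_one, moebius_one]
    ext X
    constructor
    · rintro ⟨⟨a, b, c, d, hX, hc⟩ | ⟨a, b, c, d, hX, ha, hc, hd⟩, hfix⟩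
      · exact Or.inl ⟨⟨a, b, c, d, hX, hc, trivial⟩, hfix⟩
      · exact Or.inr ⟨⟨a, b, c, d, hX, hc, dvd_add ha hd⟩, hfix⟩
    · rintro (⟨⟨a, b, c, d, hX, hc, -⟩, hfix⟩ | ⟨⟨a, b, c, d, hX, hc, hs⟩, hfix⟩)
      · exact ⟨Or.inl ⟨a, b, c, d, hX, hc⟩, hfix⟩
      · obtain ⟨ha, hd⟩ := (dvd_add_iff_of_dvd_mul hp (hX.dvd_mul_diag hc)).1 hs
        exact ⟨Or.inr ⟨a, b, c, d, hX, ha, hc, hd⟩, hfix⟩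
  have hdisj : Disjoint (fixSet p n (fun _ => True) z)
      (fixSet p (p * n) (fun r => (p : ℤ) ∣ r) z) := by
    rw [Set.disjoint_left]
    rintro X ⟨⟨a, b, c, d, hX, -, -⟩, -⟩ ⟨⟨a', b', c', d', hY, -, -⟩, -⟩
    exact hX.not_rep_mul_prime hp hn hY
  obtain ⟨f1, c1⟩ := ncard_fixSet (p := p) hn (R := fun _ => True) (fun _ => Iff.rfl) hz
  obtain ⟨f2, c2⟩ := ncard_fixSet (p := p) (Nat.mul_pos hp.pos hn) (R := fun r => (p : ℤ) ∣ r)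
    (fun _ => dvd_neg) hz
  rw [hset, Set.ncard_union_eq hdisj f1 f2, c1, c2] at hcard
  linarith

lemma order_colProd (hp : p.Prime) (hn : 0 < n) {z : ℂ} (hz : z ∈ UH) :
    analyticOrderAt (colProd p n) z =
      (traceCount p (p * n) (fun _ => True) z +
        traceCount p (p * n) (fun r => (p : ℤ) ∣ r) z : ℕ) := by
  have hpn : 0 < p * n := Nat.mul_pos hp.pos hn
  obtain ⟨m1, hm1, g1, hcard1⟩ := isHaupt_jOne.order_famProd (upM p 1 0) pairM hz
    (pairIdx (colPairs 1 n)) famDisjoint_col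
  obtain ⟨m2, hm2, g2, hcard2⟩ := isHaupt_jOne.order_famProd (upM 1 1 0) pairM hz
    (pairIdx (colPairs p (p * n))) famDisjoint_col
  have hord : analyticOrderAt (colProd p n) z = (m1 + m2 : ℕ) := by
    have : colProd p n = famProd SLZ jOne (upM p 1 0) (pairIdx (colPairs 1 n)) pairM *
      famProd SLZ jOne (upM 1 1 0) (pairIdx (colPairs p (p * n))) pairM := rfl
    rw [this, analyticOrderAt_mul (isHaupt_jOne.analyticAt_famProd _ _ _ hz)
      (isHaupt_jOne.analyticAt_famProd _ _ _ hz), hm1, hm2]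
    push_cast
    rfl
  rw [hord]
  congr 1
  rw [famSet_col hpn, upM_one, moebius_one] at g2 hcard2
  rw [famSet_col hn] at g1 hcard1
  have hα := rep_diag hp.pos
  set S1 : Set SL2R := {X | (∃ a b c d : ℤ, Rep (p * n) X a b c d ∧ (p : ℤ) ∣ c ∧ (p : ℤ) ∣ d) ∧
    moebius X z = z ∧ X ≠ 1 ∧ X ≠ -1} with hS1
  have himg : (fun X => (upM p 1 0)⁻¹ * X) '' {X ∈ colSet 1 n | moebius X z = moebius (upM p 1 0) z ∧
      X ≠ upM p 1 0 ∧ X ≠ -upM p 1 0} = S1 := by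
    ext X
    constructor
    · rintro ⟨Y, ⟨⟨a, b, c, d, hY, -, -⟩, h1, h2, h3⟩, rfl⟩
      refine ⟨⟨_, _, _, _, hα.inv.mul hY, ?_, ?_⟩, ?_, ?_, ?_⟩
      · exact ⟨c, by ring⟩
      · exact ⟨d, by ring⟩
      · rw [moebius_mul _ _ hz, h1]
        exact moebius_inv_eq _ hz rfl
      · rwa [Ne, inv_mul_eq_one, eq_comm]
      · intro h; exact h3 (by rw [inv_mul_eq_iff_eq_mul] at h; simpa using h)
    · rintro ⟨⟨a, b, _, _, hX, ⟨c, rfl⟩, ⟨d, rfl⟩⟩, h1, h2, h3⟩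
      refine ⟨upM p 1 0 * X, ⟨⟨a, b, c, d, Rep.scale hp.pos ?_, by simp, by simp⟩, ?_, ?_, ?_⟩, ?_⟩
      · convert hα.mul hX using 1 <;> ring
      · rw [moebius_mul _ _ hz, h1]
      · rwa [Ne, mul_eq_left]
      · intro h; exact h3 (mul_left_cancel (a := upM p 1 0) (by simpa using h))
      · simp
  have g1' : S1.Finite := himg ▸ g1.image _
  have hcard1' : S1.ncard = 2 * m1 := by
    rw [← himg, Set.ncard_image_of_injective _ (mul_right_injective _), hcard1]
  set S2 : Set SL2R := {X ∈ colSet p (p * n) | moebius X z = z ∧ X ≠ 1 ∧ X ≠ -1} with hS2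
  have hU : S1 ∪ S2 = fixSet p (p * n) (fun _ => True) z := by
    ext X
    constructor
    · rintro (⟨⟨a, b, c, d, hX, hc, hd⟩, hfix⟩ | ⟨⟨a, b, c, d, hX, ha, hc⟩, hfix⟩)
      · exact ⟨⟨a, b, c, d, hX, hc, trivial⟩, hfix⟩
      · exact ⟨⟨a, b, c, d, hX, hc, trivial⟩, hfix⟩
    · rintro ⟨⟨a, b, c, d, hX, hc, -⟩, hfix⟩
      rcases (Nat.prime_iff_prime_int.1 hp).dvd_or_dvd (hX.dvd_mul_diag hc) with h1 | h1
      · exact Or.inr ⟨⟨a, b, c, d, hX, h1, hc⟩, hfix⟩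
      · exact Or.inl ⟨⟨a, b, c, d, hX, hc, h1⟩, hfix⟩
  have hI : S1 ∩ S2 = fixSet p (p * n) (fun r => (p : ℤ) ∣ r) z := by
    ext X
    constructor
    · rintro ⟨⟨⟨a, b, c, d, hX, hc, hd⟩, hfix⟩, ⟨⟨a', b', c', d', hX', ha', -⟩, -⟩⟩
      obtain ⟨rfl, rfl, rfl, rfl⟩ := hX.entries_unique hX'
      exact ⟨⟨a, b, c, d, hX, hc, dvd_add ha' hd⟩, hfix⟩
    · rintro ⟨⟨a, b, c, d, hX, hc, hs⟩, hfix⟩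
      obtain ⟨ha, hd⟩ := (dvd_add_iff_of_dvd_mul hp (hX.dvd_mul_diag hc)).1 hs
      exact ⟨⟨⟨a, b, c, d, hX, hc, hd⟩, hfix⟩, ⟨⟨a, b, c, d, hX, ha, hc⟩, hfix⟩⟩
  have hsum := Set.ncard_union_add_ncard_inter S1 S2 g1' g2
  rw [hU, hI, (ncard_fixSet (p := p) hpn (R := fun _ => True) (fun _ => Iff.rfl) hz).2,
    (ncard_fixSet (p := p) hpn (R := fun r => (p : ℤ) ∣ r) (fun _ => dvd_neg) hz).2, hcard1',
    hcard2] at hsum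
  linarith

end
end FrickeTrace

namespace FrickeTrace
open Filter Topology

lemma conj_entries (g : SL2R) {M : Matrix (Fin 2) (Fin 2) ℝ} (hs : M 1 0 = M 0 1) :
    ((g.1)ᵀ * M * g.1) 0 0 = g.1 0 0 ^ 2 * M 0 0 + 2 * g.1 0 0 * g.1 1 0 * M 0 1 +
      g.1 1 0 ^ 2 * M 1 1 ∧
    ((g.1)ᵀ * M * g.1) 0 1 = g.1 0 0 * g.1 0 1 * M 0 0 +
      (g.1 0 0 * g.1 1 1 + g.1 1 0 * g.1 0 1) * M 0 1 + g.1 1 0 * g.1 1 1 * M 1 1 ∧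
    ((g.1)ᵀ * M * g.1) 1 0 = g.1 0 0 * g.1 0 1 * M 0 0 +
      (g.1 0 0 * g.1 1 1 + g.1 1 0 * g.1 0 1) * M 0 1 + g.1 1 0 * g.1 1 1 * M 1 1 ∧
    ((g.1)ᵀ * M * g.1) 1 1 = g.1 0 1 ^ 2 * M 0 0 + 2 * g.1 0 1 * g.1 1 1 * M 0 1 +
      g.1 1 1 ^ 2 * M 1 1 := by
  refine ⟨?_, ?_, ?_, ?_⟩ <;>
    simp only [Matrix.mul_apply, Fin.sum_univ_two, Matrix.transpose_apply, hs] <;> ring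

lemma conj_pos (g : SL2R) {M : Matrix (Fin 2) (Fin 2) ℝ} (hs : M 1 0 = M 0 1) (h0 : 0 < M 0 0)
    (hd : 0 < M 0 0 * M 1 1 - M 0 1 ^ 2) : 0 < ((g.1)ᵀ * M * g.1) 0 0 := by
  rw [(conj_entries g hs).1]
  refine pos_of_mul_pos_right (a := M 0 0) ?_ h0.le
  have e : M 0 0 * (g.1 0 0 ^ 2 * M 0 0 + 2 * g.1 0 0 * g.1 1 0 * M 0 1 + g.1 1 0 ^ 2 * M 1 1) =
      (M 0 0 * g.1 0 0 + M 0 1 * g.1 1 0) ^ 2 + (M 0 0 * M 1 1 - M 0 1 ^ 2) * g.1 1 0 ^ 2 := by ring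
  rw [e]
  by_cases h : g.1 1 0 = 0
  · have h1 : g.1 0 0 ≠ 0 := by
      intro h1
      have := det_entries g
      rw [h, h1] at this
      norm_num at this
    rw [h]
    have : M 0 0 * g.1 0 0 ≠ 0 := mul_ne_zero h0.ne' h1
    have : 0 < (M 0 0 * g.1 0 0) ^ 2 := by positivity
    linarith [this]
  · have : 0 < g.1 1 0 ^ 2 := by positivity
    have := mul_pos hd this
    have := sq_nonneg (M 0 0 * g.1 0 0 + M 0 1 * g.1 1 0)
    linarith

lemma cmPointC_conj_iff (g : SL2R) {M : Matrix (Fin 2) (Fin 2) ℝ} (hs : M 1 0 = M 0 1)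
    (h0 : 0 < M 0 0) (hd : 0 < M 0 0 * M 1 1 - M 0 1 ^ 2) {z : ℂ} (hz : z ∈ UH) :
    cmPointC ((g.1)ᵀ * M * g.1) = z ↔ cmPointC M = moebius g z := by
  obtain ⟨e1, e2, e3, e4⟩ := conj_entries g hs
  rw [cmPointC_eq_iff (by rw [e2, e3]) (conj_pos g hs h0 hd) hz,
    cmPointC_eq_iff hs h0 (moebius_mem g hz), e1, e2, e4]
  have hden := den_ne_zero g hz
  rw [moebius_eq]
  have h2 : den g z ^ 2 ≠ 0 := pow_ne_zero 2 hden
  rw [← mul_right_inj' h2 (b := _ + _ + ((M 1 1 : ℝ) : ℂ)), mul_zero]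
  have e : den g z ^ 2 * (((M 0 0 : ℝ) : ℂ) * (num g z / den g z) ^ 2 +
      ((2 * M 0 1 : ℝ) : ℂ) * (num g z / den g z) + ((M 1 1 : ℝ) : ℂ)) =
      ((M 0 0 : ℝ) : ℂ) * num g z ^ 2 + ((2 * M 0 1 : ℝ) : ℂ) * (num g z * den g z) +
        ((M 1 1 : ℝ) : ℂ) * den g z ^ 2 := by
    field_simp
  rw [e, den, num]
  push_cast
  constructor <;> intro h <;> linear_combination h

section
variable {p h : ℕ} {d : ℤ}

lemma QdN_props (hd : 0 < d) {M : Matrix (Fin 2) (Fin 2) ℝ} (hM : M ∈ QdN d p) :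
    M 1 0 = M 0 1 ∧ 0 < M 0 0 ∧ 4 * (M 0 0 * M 1 1 - M 0 1 ^ 2) = d ∧
      0 < M 0 0 * M 1 1 - M 0 1 ^ 2 := by
  obtain ⟨a, b, c, rfl, ha, hdisc, -⟩ := hM
  obtain ⟨h1, h2, h3, h4⟩ := formMat_entries a b c
  rw [h1, h2, h3, h4]
  have h5 : (b : ℝ) ^ 2 - 4 * a * c = -d := by exact_mod_cast hdisc
  have hd' : (0 : ℝ) < d := by exact_mod_cast hd
  have h6 : 4 * ((a : ℝ) * c - (b / 2) ^ 2) = d := by linear_combination -h5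
  exact ⟨rfl, by exact_mod_cast ha, h6, by linarith⟩

lemma cmPointC_mem (hd : 0 < d) {M : Matrix (Fin 2) (Fin 2) ℝ} (hM : M ∈ QdN d p) :
    cmPointC M ∈ UH := by
  obtain ⟨h1, h2, h3, h4⟩ := QdN_props hd hM
  rw [mem_UH, cmPointC, Complex.div_ofReal_im]
  have hdet : 0 < M.det := by rw [Matrix.det_fin_two, h1]; linarith [sq (M 0 1)]
  have : 0 < Real.sqrt M.det := Real.sqrt_pos.2 hdet
  simp
  positivity

lemma QdN_conj (hp : p.Prime) (hd : 0 < d) {M : Matrix (Fin 2) (Fin 2) ℝ} (hM : M ∈ QdN d p) {g : SL2R}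
    (hg : g ∈ FrickeGroup p) : (g.1)ᵀ * M * g.1 ∈ QdN d p := by
  obtain ⟨q1, q2, q3, q4⟩ := QdN_props hd hM
  have hpos := conj_pos g q1 q2 q4
  obtain ⟨e1, e2, e3, e4⟩ := conj_entries g q1
  obtain ⟨_, b, c, rfl, ha, hdisc, ⟨a, rfl⟩⟩ := hM
  obtain ⟨h1, h2, h3, h4⟩ := formMat_entries (p * a) b c
  have build : ∀ A B C : ℤ, ((g.1)ᵀ * formMat (p * a) b c * g.1) 0 0 = A →
      ((g.1)ᵀ * formMat (p * a) b c * g.1) 0 1 = B / 2 →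
      ((g.1)ᵀ * formMat (p * a) b c * g.1) 1 1 = C → B ^ 2 - 4 * A * C = -d → (p : ℤ) ∣ A →
      (g.1)ᵀ * formMat (p * a) b c * g.1 ∈ QdN d p := by
    intro A B C hA hB hC hD hpA
    refine ⟨A, B, C, ?_, ?_, hD, hpA⟩
    · obtain ⟨k1, k2, k3, k4⟩ := formMat_entries A B C
      ext i j
      fin_cases i <;> fin_cases j
      · exact hA.trans k1.symm
      · exact hB.trans k2.symm
      · exact (e3.trans (e2.symm.trans hB)).trans k3.symm
      · exact hC.trans k4.symm
    · rw [hA] at hpos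
      exact_mod_cast hpos
  rw [h1, h2, h4] at e1 e2 e4
  rcases (mem_fricke_iff hp g).1 hg with ⟨u, v, w, x, hR⟩ | ⟨u, v, w, x, hR⟩
  · have hdet := hR.det
    obtain ⟨r1, r2, r3, r4⟩ := hR
    rw [Nat.cast_one, Real.sqrt_one, one_mul] at r1 r2 r3 r4
    rw [r1, r2, r3, r4] at e2
    rw [r1, r3] at e1
    rw [r2, r4] at e4
    refine build (u ^ 2 * (p * a) + u * (p * w) * b + (p * w) ^ 2 * c)
      (2 * u * v * (p * a) + (u * x + (p * w) * v) * b + 2 * (p * w) * x * c)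
      (v ^ 2 * (p * a) + v * x * b + x ^ 2 * c) ?_ ?_ ?_ ?_ ?_
    · rw [e1]; push_cast; ring
    · rw [e2]; push_cast; ring
    · rw [e4]; push_cast; ring
    · rw [← hdisc]
      push_cast at hdet
      linear_combination (b ^ 2 - 4 * (p * a) * c) * (u * x - v * (p * w) + 1) * hdet
    · exact ⟨u ^ 2 * a + u * w * b + p * w ^ 2 * c, by ring⟩
  · have hdet := hR.det
    have hp0 : (p : ℝ) ≠ 0 := by exact_mod_cast hp.ne_zero
    have hpz : (p : ℤ) ≠ 0 := by exact_mod_cast hp.ne_zero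
    have hdet' : (p : ℤ) * u * x - v * w = 1 := by
      apply mul_left_cancel₀ hpz
      linear_combination hdet
    have key : ∀ {s t : ℝ} {i j : ℤ}, Real.sqrt p * s = i → Real.sqrt p * t = j →
        p * (s * t) = i * j := by
      intro s t i j hs ht
      rw [← hs, ← ht]
      linear_combination -(s * t) * sqrt_nat_sq p
    obtain ⟨r1, r2, r3, r4⟩ := hR
    refine build (p * (u ^ 2 * (p * a) + u * w * b + w ^ 2 * c))
      (2 * u * v * (p * a) + (p * u * x + w * v) * b + 2 * p * w * x * c)
      (v ^ 2 * a + v * x * b + p * x ^ 2 * c) ?_ ?_ ?_ ?_ ?_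
    · rw [e1]
      apply mul_left_cancel₀ hp0
      have k1 := key r1 r1
      have k2 := key r1 r3
      have k3 := key r3 r3
      push_cast at k1 k2 k3 ⊢
      linear_combination p * a * k1 + b * k2 + c * k3
    · rw [e2]
      apply mul_left_cancel₀ hp0
      have k1 := key r1 r2
      have k2 := key r1 r4
      have k3 := key r3 r2
      have k4 := key r3 r4
      push_cast at k1 k2 k3 k4 ⊢
      linear_combination p * a * k1 + b / 2 * (k2 + k3) + c * k4
    · rw [e4]
      apply mul_left_cancel₀ hp0
      have k1 := key r2 r2
      have k2 := key r2 r4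
      have k3 := key r4 r4
      push_cast at k1 k2 k3 ⊢
      linear_combination p * a * k1 + b * k2 + c * k3
    · rw [← hdisc]
      linear_combination (b ^ 2 - 4 * (p * a) * c) * (p * u * x - v * w + 1) * hdet'
    · exact dvd_mul_right _ _

lemma QdN_eq_of_cmPointC (hd : 0 < d) {M M' : Matrix (Fin 2) (Fin 2) ℝ} (hM : M ∈ QdN d p)
    (hM' : M' ∈ QdN d p) (hcm : cmPointC M = cmPointC M') : M = M' := by
  have hz := cmPointC_mem hd hM
  obtain ⟨q1, q2, q3, q4⟩ := QdN_props hd hM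
  obtain ⟨q1', q2', q3', q4'⟩ := QdN_props hd hM'
  obtain ⟨h1, h2, h3⟩ := form_unique q2 q2' hz (by linear_combination q3' - q3)
    ((cmPointC_eq_iff q1 q2 hz).1 rfl) ((cmPointC_eq_iff q1' q2' hz).1 hcm.symm)
  ext i j
  fin_cases i <;> fin_cases j
  · exact h1
  · exact (by linarith : M 0 1 = M' 0 1)
  · exact (by linarith : M 1 0 = M' 1 0)
  · exact h3

lemma cmPointC_conj (hd : 0 < d) {M : Matrix (Fin 2) (Fin 2) ℝ} (hM : M ∈ QdN d p)
    (g : SL2R) : cmPointC ((g.1)ᵀ * M * g.1) = moebius g⁻¹ (cmPointC M) := by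
  obtain ⟨q1, q2, q3, q4⟩ := QdN_props hd hM
  have hz := cmPointC_mem hd hM
  rw [cmPointC_conj_iff g q1 q2 q4 (moebius_mem _ hz), ← moebius_mul _ _ hz]
  simp

lemma HasForm.moebius (hp : p.Prime) {z : ℂ} (hz : z ∈ UH) (hF : HasForm p d z) {γ : SL2R}
    (hγ : γ ∈ FrickeGroup p) : HasForm p d (_root_.moebius γ z) := by
  have hd := hF.pos hz
  obtain ⟨Q, hQ, rfl⟩ := hF
  refine ⟨_, QdN_conj hp hd hQ (inv_mem hγ), ?_⟩
  rw [cmPointC_conj hd hQ, inv_inv]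

variable {J g : ℂ → ℂ}

lemma stabOrder_eq_ram (hp : p.Prime) (H : IsHaupt (FrickeGroup p) J g) (hd : 0 < d)
    {M : Matrix (Fin 2) (Fin 2) ℝ} (hM : M ∈ QdN d p) :
    stabOrder (FrickeGroup p) M = ram J (cmPointC M) := by
  have hz := cmPointC_mem hd hM
  have hset : {γ : SL2R | γ ∈ FrickeGroup p ∧ (γ.1)ᵀ * M * γ.1 = M} =
      stabSet (FrickeGroup p) (cmPointC M) := by
    ext γ
    constructor
    · rintro ⟨hγ, h⟩
      refine ⟨hγ, ?_⟩
      have h1 := cmPointC_conj hd hM γ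
      rw [h] at h1
      simpa using moebius_inv_eq γ⁻¹ hz h1.symm
    · rintro ⟨hγ, h⟩
      refine ⟨hγ, QdN_eq_of_cmPointC hd (QdN_conj hp hd hM hγ) hM ?_⟩
      rw [cmPointC_conj hd hM]
      exact moebius_inv_eq γ hz h
  have hcard : Nat.card {γ : SL2R // γ ∈ FrickeGroup p ∧ (γ.1)ᵀ * M * γ.1 = M} =
      2 * ram J (cmPointC M) := by
    rw [← (H.stab_card hz).2, ← hset]
    exact Nat.card_coe_set_eq _
  rw [stabOrder, hcard, Nat.mul_div_cancel_left _ two_pos]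

lemma OrbitEquiv.ram_eq {Γ : Subgroup SL2R} (H : IsHaupt Γ J g) {z w : ℂ} (hz : z ∈ UH)
    (h : OrbitEquiv Γ z w) : ram J w = ram J z := by
  obtain ⟨γ, hγ, rfl⟩ := h
  have hw := moebius_mem γ hz
  have himg : (fun X => γ * X * γ⁻¹) '' stabSet Γ z = stabSet Γ (moebius γ z) := by
    have hinv : moebius γ⁻¹ (moebius γ z) = z := moebius_inv_eq γ hz rfl
    ext X
    constructor
    · rintro ⟨Y, ⟨hY, hfix⟩, rfl⟩
      refine ⟨mul_mem (mul_mem hγ hY) (inv_mem hγ), ?_⟩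
      rw [moebius_mul _ _ hw, hinv, moebius_mul _ _ hz, hfix]
    · rintro ⟨hX, hfix⟩
      refine ⟨γ⁻¹ * X * γ, ⟨mul_mem (mul_mem (inv_mem hγ) hX) hγ, ?_⟩, by group⟩
      rw [moebius_mul _ _ hz, moebius_mul _ _ hw, hfix, hinv]
  have hinj : Function.Injective fun X : SL2R => γ * X * γ⁻¹ := fun X Y hXY => by simpa using hXY
  have := (H.stab_card hw).2
  rw [← himg, Set.ncard_image_of_injective _ hinj, (H.stab_card hz).2] at this
  linarith

open Classical in
/-- The class trace as a sum over values of the hauptmodul. -/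
lemma t2Star_eq_finsum (hp : p.Prime) (H : IsHaupt (FrickeGroup p) (jnStar p) g) (P : Polynomial ℂ)
    (hd : 0 < d) {sec : ℂ → ℂ} (hsec : ∀ x, sec x ∈ UH ∧ jnStar p (sec x) = x) :
    t2Star p P d = ∑ᶠ x, if HasForm p d (sec x) then P.eval x / (ram (jnStar p) (sec x) : ℂ) else 0 := by
  rw [t2Star, if_pos hd, classTrace]
  have hinv : ∀ Q Q' : QdN d p, formRel (FrickeGroup p) (QdN d p) Q Q' →
      jnStar p (cmPointC Q.1) = jnStar p (cmPointC Q'.1) := by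
    rintro Q Q' ⟨γ, hγ, h⟩
    rw [h, cmPointC_conj hd Q.2]
    exact (OrbitEquiv.apply_eq H (cmPointC_mem hd Q.2) ⟨γ⁻¹, inv_mem hγ, rfl⟩).symm
  let φ : Quot (formRel (FrickeGroup p) (QdN d p)) → ℂ :=
    Quot.lift (fun Q => jnStar p (cmPointC Q.1)) hinv
  have hφ : ∀ O, jnStar p (cmPointC (Quot.out O).1) = φ O := fun O => by
    conv_rhs => rw [← Quot.out_eq O]
  have hφinj : Function.Injective φ := by
    intro O O' h
    rw [← hφ, ← hφ] at h
    obtain ⟨γ, hγ, hγz⟩ := H.orbitEquiv_of_eq (cmPointC_mem hd (Quot.out O).2)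
      (cmPointC_mem hd (Quot.out O').2) h
    rw [← Quot.out_eq O, ← Quot.out_eq O']
    refine Quot.sound ⟨γ⁻¹, inv_mem hγ, ?_⟩
    refine QdN_eq_of_cmPointC hd (Quot.out O').2 (QdN_conj hp hd (Quot.out O).2 (inv_mem hγ)) ?_
    rw [cmPointC_conj hd (Quot.out O).2, inv_inv, hγz]
  have hrange : Set.range φ = {x | HasForm p d (sec x)} := by
    ext x
    constructor
    · rintro ⟨O, rfl⟩
      have hz := cmPointC_mem hd (Quot.out O).2
      obtain ⟨γ, hγ, hγz⟩ := H.orbitEquiv_of_eq hz (hsec (φ O)).1 (by rw [hφ, (hsec (φ O)).2])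
      change HasForm p d (sec (φ O))
      rw [← hγz]
      exact HasForm.moebius hp hz ⟨_, (Quot.out O).2, rfl⟩ hγ
    · rintro ⟨Q, hQ, hcm⟩
      refine ⟨Quot.mk _ ⟨Q, hQ⟩, ?_⟩
      change jnStar p (cmPointC Q) = x
      rw [hcm, (hsec x).2]
  have hterm : ∀ O : Quot (formRel (FrickeGroup p) (QdN d p)),
      P.eval (jnStar p (cmPointC (Quot.out O).1)) / (stabOrder (FrickeGroup p) (Quot.out O).1 : ℂ) =
        (fun x => P.eval x / (ram (jnStar p) (sec x) : ℂ)) (φ O) := by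
    intro O
    have hz := cmPointC_mem hd (Quot.out O).2
    rw [stabOrder_eq_ram hp H hd (Quot.out O).2, hφ]
    simp only
    rw [OrbitEquiv.ram_eq H hz
      (H.orbitEquiv_of_eq hz (hsec (φ O)).1 (by rw [hφ, (hsec (φ O)).2]))]
  rw [finsum_congr hterm,
    ← finsum_mem_range (f := fun x => P.eval x / (ram (jnStar p) (sec x) : ℂ)) hφinj, hrange]
  refine finsum_congr fun x => ?_
  rw [finsum_eq_if]
  rfl

end
end FrickeTrace

namespace FrickeTrace
open Filter Topology Asymptotics

lemma hasFPowerSeriesAt_tsum {a : ℕ → ℂ} (h : ∀ z ∈ UH, Summable fun m => a m * qc z ^ m) :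
    HasFPowerSeriesAt (fun q => ∑' m, a m * q ^ m) (FormalMultilinearSeries.ofScalars ℂ a) 0 := by
  rw [hasFPowerSeriesAt_iff]
  filter_upwards [Metric.ball_mem_nhds (0 : ℂ) one_pos] with q hq
  have hs : Summable fun m => a m * q ^ m := by
    rcases eq_or_ne q 0 with rfl | hq0
    · exact summable_of_ne_finset_zero (s := {0}) fun m hm => by
        simp [zero_pow (by simpa using hm : m ≠ 0)]
    · obtain ⟨z, hz, rfl⟩ := exists_qc_eq hq0 (by simpa using hq)
      exact h z hz
  simpa [FormalMultilinearSeries.coeff_ofScalars, mul_comm] using hs.hasSum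

lemma coeff_eq_iteratedDeriv {a : ℕ → ℂ} {f : ℂ → ℂ} (hf : AnalyticAt ℂ f 0)
    (h : ∀ z ∈ UH, HasSum (fun m => a m * qc z ^ m) (f (qc z))) (m : ℕ) :
    a m = iteratedDeriv m f 0 / m.factorial := by
  have hT := hasFPowerSeriesAt_tsum fun z hz => (h z hz).summable
  have hev : (fun q => ∑' m, a m * q ^ m) =ᶠ[𝓝 0] f := by
    refine (hT.analyticAt.frequently_eq_iff_eventually_eq hf).1 (Eventually.frequently ?_)
    filter_upwards [self_mem_nhdsWithin,
      mem_nhdsWithin_of_mem_nhds (Metric.ball_mem_nhds (0 : ℂ) one_pos)] with q hq0 hq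
    obtain ⟨z, hz, rfl⟩ := exists_qc_eq hq0 (by simpa using hq)
    exact (h z hz).tsum_eq
  have := (hT.congr hev).eq_formalMultilinearSeries hf.hasFPowerSeriesAt
  have := congrArg (fun s => s.coeff m) this
  simpa [FormalMultilinearSeries.coeff_ofScalars] using this

variable {Γ : Subgroup SL2R} {J g : ℂ → ℂ}

lemma HasQExp.shift {f : ℂ → ℂ} {a : ℤ → ℂ} {k : ℕ} (h : HasQExp f a (-k)) {z : ℂ} (hz : z ∈ UH) :
    HasSum (fun m : ℕ => a (m - k) * qc z ^ m) (f z * qc z ^ k) := by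
  refine ((h.2 z hz).mul_right (qc z ^ k)).congr_fun fun m => ?_
  rw [zpow_add₀ (qc_ne_zero z), _root_.zpow_neg, zpow_natCast, zpow_natCast,
    neg_add_eq_sub]
  field_simp [qc_ne_zero z]

lemma IsHaupt.coeff_eq (H : IsHaupt Γ J g) {c : ℤ → ℂ} (hc : HasQExp J c (-1)) :
    c (-1) = 1 ∧ ∀ n : ℕ, c n = iteratedDeriv n g 0 / n.factorial := by
  have han : AnalyticAt ℂ (fun q => 1 + q * g q) 0 := by
    have := H.analyticAt_g_zero
    fun_prop
  have hsum : ∀ z ∈ UH, HasSum (fun m : ℕ => c (m - (1 : ℕ)) * qc z ^ m) (1 + qc z * g (qc z)) := by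
    intro z hz
    have := HasQExp.shift (k := 1) (by simpa using hc) hz
    rw [H.qexp z hz] at this
    convert this using 1
    field_simp [qc_ne_zero z]
  have h0 : c (-1) = 1 := by simpa using coeff_eq_iteratedDeriv han hsum 0
  refine ⟨h0, fun n => coeff_eq_iteratedDeriv (a := fun n : ℕ => c n) H.analyticAt_g_zero ?_ n⟩
  intro z hz
  have h1 := ((hasSum_nat_add_iff' 1).2 (hsum z hz)).mul_left (qc z)⁻¹
  have hq := qc_ne_zero z
  have h2 : (qc z)⁻¹ * (1 + qc z * g (qc z) -
      ∑ i ∈ Finset.range 1, c (i - (1 : ℕ)) * qc z ^ i) = g (qc z) := by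
    simp [h0, hq]
  rw [h2] at h1
  refine h1.congr_fun fun m => ?_
  push_cast
  rw [add_sub_cancel_right, pow_succ]
  field_simp

lemma tendsto_sub_of_hasQExp {f : ℂ → ℂ} {e : ℤ → ℂ} (hf : HasQExp f e (-2)) (he2 : e (-2) = 1)
    (he1 : e (-1) = 0) (he0 : e 0 = 0) : Tendsto (fun z => f z - (qc z ^ 2)⁻¹) imInf (𝓝 0) := by
  have hs : ∀ z ∈ UH, HasSum (fun m : ℕ => e (m - (2 : ℕ)) * qc z ^ m) (f z * qc z ^ 2) :=
    fun z hz => HasQExp.shift (k := 2) (by simpa using hf) hz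
  have hT := (hasFPowerSeriesAt_tsum fun z hz => (hs z hz).summable).analyticAt
  obtain ⟨a, -, -, ha, hO⟩ := taylor_isBigO hT
  have hae : ∀ m : ℕ, a m = e (m - (2 : ℕ)) := fun m => by
    rw [ha, coeff_eq_iteratedDeriv hT fun z hz => (hs z hz).summable.hasSum]
  have h3 := ((hO 3).comp_tendsto qc_tendsto_zero).mul
    (isBigO_refl (fun z => (qc z ^ 2)⁻¹) imInf)
  refine (h3.trans_tendsto ?_).congr' ?_
  · refine qc_tendsto_zero.congr fun z => ?_
    have := qc_ne_zero z
    simp only [Function.comp]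
    field_simp
  · filter_upwards [eventually_imInf_UH] with z hz
    have := qc_ne_zero z
    simp only [Function.comp, Finset.sum_range_succ, Finset.sum_range_zero, hae, (hs z hz).tsum_eq]
    norm_num [he2, he1, he0]
    field_simp

lemma IsHaupt.tendsto_sq_sub (H : IsHaupt Γ J g) :
    Tendsto (fun z => J z ^ 2 - (qc z ^ 2)⁻¹) imInf (𝓝 (2 * deriv g 0)) := by
  have hd : HasDerivAt g (deriv g 0) 0 := H.analyticAt_g_zero.differentiableAt.hasDerivAt
  have h1 : Tendsto (fun z => (qc z)⁻¹ * g (qc z)) imInf (𝓝 (deriv g 0)) := by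
    have := hd.tendsto_slope_zero.comp qc_tendsto
    simpa [Function.comp_def, H.g_zero] using this
  have h2 : Tendsto (fun z => g (qc z)) imInf (𝓝 0) := by
    simpa [H.g_zero, Function.comp_def] using
      H.continuousAt_g_zero.tendsto.comp qc_tendsto_zero
  have h3 := (h1.const_mul 2).add (h2.pow 2)
  rw [zero_pow two_ne_zero, add_zero] at h3
  refine h3.congr' ?_
  filter_upwards [eventually_imInf_UH] with z hz
  rw [H.qexp z hz]
  ring

lemma IsHaupt.poly_eq_zero (H : IsHaupt Γ J g) {P : Polynomial ℂ}
    (h : Tendsto (fun z => P.eval (J z)) imInf (𝓝 0)) : P = 0 := by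
  by_cases hd : 0 < P.degree
  · have := P.tendsto_norm_atTop hd H.tendsto_norm
    exact absurd h.norm (not_tendsto_nhds_of_tendsto_atTop this _)
  · rw [Polynomial.eq_C_of_degree_le_zero (not_lt.1 hd)] at h ⊢
    simp only [Polynomial.eval_C] at h
    rw [tendsto_nhds_unique tendsto_const_nhds h, Polynomial.C_0]

lemma IsHaupt.poly_eval (H : IsHaupt Γ J g) {P : Polynomial ℂ} {e : ℤ → ℂ}
    (hP : HasQExp (fun z => P.eval (J z)) e (-2)) (he2 : e (-2) = 1)
    (he1 : e (-1) = 0) (he0 : e 0 = 0) (x : ℂ) : P.eval x = x ^ 2 - 2 * deriv g 0 := by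
  have h := (tendsto_sub_of_hasQExp hP he2 he1 he0).sub (H.tendsto_sq_sub.sub_const (2 * deriv g 0))
  have h0 := H.poly_eq_zero (P := P - (Polynomial.X ^ 2 - Polynomial.C (2 * deriv g 0))) (by
    rw [sub_self, sub_zero] at h
    refine h.congr fun z => ?_
    simp
    ring)
  rw [sub_eq_zero.1 h0]
  simp

end FrickeTrace

namespace FrickeTrace
open Filter Topology

/-- The values of the trace function at nonpositive discriminants, with `K` its value at `0`. -/
noncomputable def cuspTerm (K : ℂ) (d : ℤ) : ℂ :=
  if d = 0 then K else if d = -1 then -1 else if d = -4 then -2 else 0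

/-- The contribution of a factorization `x.1 * x.2` to a sum of values of `cuspTerm`. -/
noncomputable def pairTerm (K : ℂ) (x : ℕ × ℕ) : ℂ :=
  (if x.1 = x.2 then 2 * K else 0) - kap ((x.2 : ℤ) - x.1)

lemma cuspTerm_neg_sq (K : ℂ) (δ : ℤ) :
    cuspTerm K (-δ ^ 2) = (if δ = 0 then K else 0) - kap δ := by
  have h0 : -δ ^ 2 = 0 ↔ δ = 0 := by simp
  have h1 : -δ ^ 2 = -1 ↔ δ = 1 ∨ δ = -1 := by rw [neg_inj, ← sq_eq_sq_iff_eq_or_eq_neg, one_pow]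
  have h2 : -δ ^ 2 = -4 ↔ δ = 2 ∨ δ = -2 := by
    rw [neg_inj, show (4 : ℤ) = 2 ^ 2 by norm_num, sq_eq_sq_iff_eq_or_eq_neg]
  simp only [cuspTerm, kap, h0, h1, h2]
  by_cases h : δ = 0
  · simp [h]
  · simp only [h, if_false, zero_sub]
    split_ifs <;> simp

lemma pairTerm_swap (K : ℂ) (x : ℕ × ℕ) : pairTerm K x.swap = pairTerm K x := by
  simp only [pairTerm, Prod.fst_swap, Prod.snd_swap, eq_comm (a := x.2)]
  rw [← kap_neg, neg_sub]

lemma eq_or_swap_of_sum_eq {m : ℕ} {x y : ℕ × ℕ} (hx : x.1 * x.2 = m) (hy : y.1 * y.2 = m)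
    (h : x.1 + x.2 = y.1 + y.2) : y = x ∨ y = x.swap := by
  have h0 : ((y.1 : ℤ) - x.1) * (y.1 - x.2) = 0 := by
    zify at hx hy h
    linear_combination hx - hy - (y.1 : ℤ) * h
  rcases mul_eq_zero.1 h0 with h1 | h1
  · left; ext <;> omega
  · right; ext <;> simp only [Prod.fst_swap, Prod.snd_swap] <;> omega

lemma exists_pair_of_cuspTerm_ne_zero {K : ℂ} {m k : ℕ} (hm : 0 < m)
    (h : cuspTerm K (4 * m - k ^ 2) ≠ 0) : ∃ x : ℕ × ℕ, x.1 * x.2 = m ∧ x.1 + x.2 = k := by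
  have hk : (k : ℤ) ^ 2 = 4 * m ∨ (k : ℤ) ^ 2 = 4 * m + 1 ∨ (k : ℤ) ^ 2 = 4 * m + 4 := by
    by_contra hcon
    refine h ?_
    unfold cuspTerm
    rw [if_neg (by omega), if_neg (by omega), if_neg (by omega)]
  norm_cast at hk
  obtain ⟨a, rfl | rfl⟩ := Nat.even_or_odd' k
  · rcases hk with hk | hk | hk
    · exact ⟨(a, a), by simp only; nlinarith, by simp only; omega⟩
    · exfalso
      have : 4 * (a * a) = 4 * m + 1 := by linarith
      omega
    · obtain ⟨b, rfl⟩ : ∃ b, a = b + 1 := Nat.exists_eq_succ_of_ne_zero (by rintro rfl; omega)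
      exact ⟨(b, b + 2), by simp only; nlinarith, by simp only; omega⟩
  · have h4 : 4 * (a * (a + 1)) + 1 = (2 * a + 1) ^ 2 := by ring
    exact ⟨(a, a + 1), by simp only; omega, by simp only; omega⟩

lemma sum_pairTerm_fiber (K : ℂ) {m : ℕ} (hm : 0 < m) (k : ℕ) :
    ∑ x ∈ m.divisorsAntidiagonal with x.1 + x.2 = k, pairTerm K x =
      2 * cuspTerm K (4 * m - k ^ 2) := by
  by_cases hx : ∃ x : ℕ × ℕ, x.1 * x.2 = m ∧ x.1 + x.2 = k
  · obtain ⟨x, rfl, rfl⟩ := hx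
    have hset : {y ∈ (x.1 * x.2).divisorsAntidiagonal | y.1 + y.2 = x.1 + x.2} = {x, x.swap} := by
      ext y
      simp only [Finset.mem_filter, Nat.mem_divisorsAntidiagonal, Finset.mem_insert,
        Finset.mem_singleton]
      constructor
      · rintro ⟨⟨h1, -⟩, h2⟩
        exact eq_or_swap_of_sum_eq rfl h1 h2.symm
      · rintro (rfl | rfl)
        · exact ⟨⟨rfl, hm.ne'⟩, rfl⟩
        · exact ⟨⟨mul_comm _ _, hm.ne'⟩, add_comm _ _⟩
    rw [hset]
    have hd : (4 * (x.1 * x.2 : ℕ) - ((x.1 + x.2 : ℕ) : ℤ) ^ 2 : ℤ) = -((x.2 : ℤ) - x.1) ^ 2 := by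
      push_cast; ring
    rw [hd, cuspTerm_neg_sq]
    by_cases he : x.1 = x.2
    · have : x.swap = x := by ext <;> simp [he]
      rw [this]
      simp [pairTerm, he, kap]
    · rw [Finset.sum_pair (fun h => he (by simpa using congrArg Prod.fst h)), pairTerm_swap,
        pairTerm, if_neg he, if_neg (by omega)]
      ring
  · rw [Finset.sum_eq_zero]
    · by_contra hne
      exact hx (exists_pair_of_cuspTerm_ne_zero hm fun h0 => hne (by rw [h0, mul_zero]))
    · intro x hx'
      simp only [Finset.mem_filter, Nat.mem_divisorsAntidiagonal] at hx'
      exact absurd ⟨x, hx'.1.1, hx'.2⟩ hx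

open Classical in
lemma sum_cuspTerm (K : ℂ) {m N : ℕ} (hm : 0 < m) (hN : m + 1 ≤ N) {R : ℤ → Prop}
    (hR : ∀ r, R (-r) ↔ R r) :
    ∑ r ∈ Finset.Icc (-N : ℤ) N, (if R r then cuspTerm K (4 * m - r ^ 2) else 0) =
      ∑ x ∈ m.divisorsAntidiagonal, if R (x.1 + x.2) then pairTerm K x else 0 := by
  have hev : Function.Even fun r : ℤ => if R r then cuspTerm K (4 * m - r ^ 2) else 0 := by
    intro r
    simp only [hR, neg_sq]
  have h0 : cuspTerm K (4 * m) = 0 := by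
    unfold cuspTerm
    rw [if_neg (by omega), if_neg (by omega), if_neg (by omega)]
  rw [Finset.sum_Icc_of_even_eq_range hev]
  have hmaps : ∀ x ∈ m.divisorsAntidiagonal, x.1 + x.2 ∈ Finset.range (N + 1) := by
    intro x hx
    obtain ⟨h1, h2⟩ := pos_of_mem_antidiagonal hx
    have := (Nat.mem_divisorsAntidiagonal.1 hx).1
    rw [Finset.mem_range]
    nlinarith
  rw [← Finset.sum_fiberwise_of_maps_to hmaps]
  simp only [zero_pow two_ne_zero, sub_zero, h0, ite_self, two_nsmul]
  rw [← Finset.sum_add_distrib]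
  refine Finset.sum_congr rfl fun k _ => ?_
  have : ∀ x ∈ {x ∈ m.divisorsAntidiagonal | x.1 + x.2 = k},
      (if R (x.1 + x.2) then pairTerm K x else 0) = if R k then pairTerm K x else 0 := by
    intro x hx
    rw [← (Finset.mem_filter.1 hx).2, Nat.cast_add]
  rw [Finset.sum_congr rfl this]
  split_ifs
  · rw [sum_pairTerm_fiber K hm]; ring
  · simp

end FrickeTrace

namespace FrickeTrace
open Filter Topology

lemma traceCount_eq_card {p m N : ℕ} {R : ℤ → Prop} {z : ℂ} (hz : z ∈ UH) (hN : 4 * m ≤ N)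
    [DecidablePred fun r : ℤ => R r ∧ HasForm p (4 * m - r ^ 2) z] :
    traceCount p m R z =
      {r ∈ Finset.Icc (-N : ℤ) N | R r ∧ HasForm p (4 * m - r ^ 2) z}.card := by
  rw [traceCount, ← Set.ncard_coe_finset]
  congr 1
  ext r
  simp only [Finset.coe_filter, Finset.mem_Icc]
  refine ⟨fun h => ⟨?_, h⟩, fun h => h.2⟩
  have := h.2.pos hz
  constructor <;> nlinarith

section

variable {p : ℕ} {g : ℂ → ℂ} {sec : ℂ → ℂ}

open Classical in
lemma sum_t2Star_pos (hp : p.Prime) (H : IsHaupt (FrickeGroup p) (jnStar p) g) (P : Polynomial ℂ)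
    (hsec : ∀ x, sec x ∈ UH ∧ jnStar p (sec x) = x) {m N : ℕ} (hN : 4 * m ≤ N) {R : ℤ → Prop}
    (hfin : {x | traceCount p m R (sec x) ≠ 0}.Finite) :
    ∑ r ∈ Finset.Icc (-N : ℤ) N,
        (if R r then if 0 < 4 * m - r ^ 2 then t2Star p P (4 * m - r ^ 2) else 0 else 0) =
      ∑ᶠ x, P.eval x * ((traceCount p m R (sec x) : ℂ) / ram (jnStar p) (sec x)) := by
  have hterm : ∀ r : ℤ,
      (if R r then if 0 < 4 * m - r ^ 2 then t2Star p P (4 * m - r ^ 2) else 0 else 0) =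
        ∑ᶠ x, if R r ∧ HasForm p (4 * m - r ^ 2) (sec x) then
          P.eval x / (ram (jnStar p) (sec x) : ℂ) else 0 := by
    intro r
    by_cases hR : R r
    · by_cases h0 : 0 < 4 * (m : ℤ) - r ^ 2
      · simp only [hR, h0, if_true, true_and]
        exact t2Star_eq_finsum hp H P h0 hsec
      · have : ∀ x, ¬ HasForm p (4 * m - r ^ 2) (sec x) := fun x h => h0 (h.pos (hsec x).1)
        simp only [h0, this, if_false, and_false, ite_self, finsum_zero]
    · simp [hR]
  rw [Finset.sum_congr rfl fun r _ => hterm r, ← finsum_sum_comm]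
  · refine finsum_congr fun x => ?_
    rw [← Finset.sum_filter, Finset.sum_const, ← traceCount_eq_card (hsec x).1 hN, nsmul_eq_mul]
    ring
  · refine fun r _ => hfin.subset fun x hx => ?_
    rw [Function.mem_support, ite_ne_right_iff] at hx
    change traceCount p m R (sec x) ≠ 0
    exact Set.ncard_ne_zero_of_mem hx.1 (finite_traces (hsec x).1)

lemma t2Star_eq_add (hp : p.Prime) (P : Polynomial ℂ) (d : ℤ) :
    t2Star p P d = (if 0 < d then t2Star p P d else 0) +
      cuspTerm (if p = 2 then 5 else 3) d := by
  have h6 : p ≠ 6 := by rintro rfl; norm_num at hp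
  have h10 : p ≠ 10 := by rintro rfl; norm_num at hp
  by_cases hd : 0 < d
  · have : cuspTerm (if p = 2 then 5 else 3) d = 0 := by
      unfold cuspTerm
      rw [if_neg (by omega), if_neg (by omega), if_neg (by omega)]
    rw [if_pos hd, this, add_zero]
  · simp [t2Star, cuspTerm, hd, h6, h10]

/-- The weighted valence formula expressed through traces. -/
lemma sum_t2Star_add (hp : p.Prime) (H : IsHaupt (FrickeGroup p) (jnStar p) g) {P : Polynomial ℂ}
    (hP : ∀ x, P.eval x = x ^ 2 - 2 * deriv g 0)
    {F : ℂ → ℂ} {k : ℤ} {κ : ℂ} {w : ℕ} (hF : DifferentiableOn ℂ F UH)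
    (hFw : ∀ γ ∈ FrickeGroup p, ∀ z ∈ UH, F (moebius γ z) = den γ z ^ (2 * w) * F z)
    (hFj : HasJet F k κ) {m m' N : ℕ} (hm : 0 < m) (hm' : 0 < m') (hN : 4 * m ≤ N)
    (hN' : 4 * m' ≤ N) {R R' : ℤ → Prop} (hR : ∀ r, R (-r) ↔ R r) (hR' : ∀ r, R' (-r) ↔ R' r)
    [iR : DecidablePred R] [iR' : DecidablePred R']
    (ho : ∀ z ∈ UH, analyticOrderAt F z = (traceCount p m R z + traceCount p m' R' z : ℕ)) :
    ∑ r ∈ Finset.Icc (-N : ℤ) N, (if R r then t2Star p P (4 * m - r ^ 2) else 0) +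
        ∑ r ∈ Finset.Icc (-N : ℤ) N, (if R' r then t2Star p P (4 * m' - r ^ 2) else 0) =
      κ - w * (2 * if p = 2 then 5 else 3) +
        ((∑ x ∈ m.divisorsAntidiagonal,
            if R (x.1 + x.2) then pairTerm (if p = 2 then 5 else 3) x else 0) +
          ∑ x ∈ m'.divisorsAntidiagonal,
            if R' (x.1 + x.2) then pairTerm (if p = 2 then 5 else 3) x else 0) := by
  classical
  obtain rfl : iR = fun r => Classical.propDecidable (R r) := Subsingleton.elim _ _
  obtain rfl : iR' = fun r => Classical.propDecidable (R' r) := Subsingleton.elim _ _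
  choose sec hsec using fun x => H.surjective x
  obtain ⟨mD, hDj⟩ := hasJet_frickeDisc hp.two_le
  obtain ⟨hfin, hval⟩ := H.weighted_valence (differentiableOn_frickeDisc hp.pos)
    (fun z hz => frickeDisc_ne_zero hp.pos hz) (fun γ hγ z hz => frickeDisc_transform hp hγ hz) hDj
    hF hFw hFj ho hsec
  have hf : {x | traceCount p m R (sec x) ≠ 0}.Finite :=
    hfin.subset fun x (hx : traceCount p m R (sec x) ≠ 0) => by
      change _ + _ ≠ 0
      omega
  have hf' : {x | traceCount p m' R' (sec x) ≠ 0}.Finite :=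
    hfin.subset fun x (hx : traceCount p m' R' (sec x) ≠ 0) => by
      change _ + _ ≠ 0
      omega
  have hsplit : ∀ (n : ℕ) (S : ℤ → Prop), 0 < n → 4 * n ≤ N → (∀ r, S (-r) ↔ S r) →
      {x | traceCount p n S (sec x) ≠ 0}.Finite →
      ∑ r ∈ Finset.Icc (-N : ℤ) N, (if S r then t2Star p P (4 * n - r ^ 2) else 0) =
        ∑ᶠ x, P.eval x * ((traceCount p n S (sec x) : ℂ) / ram (jnStar p) (sec x)) +
          ∑ x ∈ n.divisorsAntidiagonal,
            if S (x.1 + x.2) then pairTerm (if p = 2 then 5 else 3) x else 0 := by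
    intro n S hn hnN hS hfn
    rw [← sum_t2Star_pos hp H P hsec hnN hfn, ← sum_cuspTerm _ hn (by omega : n + 1 ≤ N) hS,
      ← Finset.sum_add_distrib]
    refine Finset.sum_congr rfl fun r _ => ?_
    by_cases h : S r
    · simp only [h, if_true]
      exact t2Star_eq_add hp P _
    · simp [h]
  rw [hsplit m R hm hN hR hf, hsplit m' R' hm' hN' hR' hf']
  have hadd : ∑ᶠ x, P.eval x * ((traceCount p m R (sec x) : ℂ) / ram (jnStar p) (sec x)) +
      ∑ᶠ x, P.eval x * ((traceCount p m' R' (sec x) : ℂ) / ram (jnStar p) (sec x)) =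
      κ - w * (2 * if p = 2 then 5 else 3) := by
    rw [← finsum_add_distrib]
    · trans κ - w / 12 * (24 * if p = 2 then 5 else 3)
      · rw [← hval]
        refine finsum_congr fun x => ?_
        rw [hP]
        push_cast
        ring
      · ring
    · refine hf.subset fun x hx => ?_
      contrapose! hx
      have : traceCount p m R (sec x) = 0 := by simpa using hx
      simp [this]
    · refine hf'.subset fun x hx => ?_
      contrapose! hx
      have : traceCount p m' R' (sec x) = 0 := by simpa using hx
      simp [this]
  linear_combination hadd

end

end FrickeTrace

namespace FrickeTrace
open Filter Topology

lemma sum_kap_sub_card (K : ℂ) (S : Finset (ℕ × ℕ)) (s : ℕ) :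
    ∑ x ∈ S, kap ((s * x.2 : ℕ) - (x.1 : ℤ)) - ({x ∈ S | x.1 = s * x.2}.card : ℂ) * (2 * K) =
      -∑ x ∈ S, pairTerm K (x.1, s * x.2) := by
  rw [← nsmul_eq_mul, ← Finset.sum_const, Finset.sum_filter, ← Finset.sum_sub_distrib,
    ← Finset.sum_neg_distrib]
  refine Finset.sum_congr rfl fun x _ => ?_
  simp only [pairTerm]
  ring

section

variable {p h n N : ℕ}

lemma disjoint_frickePairs (hp : p.Prime) (hn : 0 < n) :
    Disjoint n.divisorsAntidiagonal
      ((p * n).divisorsAntidiagonal.filter fun x => p ∣ x.1 ∧ p ∣ x.2) := by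
  rw [Finset.disjoint_left]
  intro x hx hx'
  have h1 := (Nat.mem_divisorsAntidiagonal.1 hx).1
  have h2 := (Nat.mem_divisorsAntidiagonal.1 (Finset.mem_filter.1 hx').1).1
  have h3 := hp.two_le
  rw [h1] at h2
  nlinarith

lemma dvd_add_iff_of_mem (hp : p.Prime) {x : ℕ × ℕ} (hx : x ∈ (p * n).divisorsAntidiagonal) :
    (p : ℤ) ∣ x.1 + x.2 ↔ p ∣ x.1 ∧ p ∣ x.2 := by
  rw [dvd_add_iff_of_dvd_mul hp, Int.natCast_dvd_natCast, Int.natCast_dvd_natCast]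
  rw [← Nat.cast_mul, (Nat.mem_divisorsAntidiagonal.1 hx).1]
  exact_mod_cast dvd_mul_right p n

lemma sum_frickePairs (hp : p.Prime) (hn : 0 < n) (f : ℕ × ℕ → ℂ) :
    ∑ x ∈ frickePairs p n, f x = ∑ x ∈ n.divisorsAntidiagonal, f x +
      ∑ x ∈ (p * n).divisorsAntidiagonal, if (p : ℤ) ∣ x.1 + x.2 then f x else 0 := by
  rw [frickePairs, Finset.sum_union (disjoint_frickePairs hp hn), Finset.sum_filter]
  congr 1
  refine Finset.sum_congr rfl fun x hx => ?_
  simp only [dvd_add_iff_of_mem hp hx]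

lemma sum_antidiagonal_mul (hp : p.Prime) (f : ℕ × ℕ → ℂ) :
    ∑ x ∈ n.divisorsAntidiagonal, f (x.1, p * x.2) =
      ∑ x ∈ (p * n).divisorsAntidiagonal, if p ∣ x.2 then f x else 0 := by
  rw [← Finset.sum_filter]
  refine Finset.sum_nbij' (fun x => (x.1, p * x.2)) (fun x => (x.1, x.2 / p)) ?_ ?_ ?_ ?_ ?_
  · intro x hx
    simp only [Finset.mem_filter, Nat.mem_divisorsAntidiagonal] at hx ⊢
    refine ⟨⟨by rw [← hx.1]; ring, mul_ne_zero hp.ne_zero hx.2⟩, dvd_mul_right _ _⟩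
  · rintro ⟨a, d⟩ hx
    simp only [Finset.mem_filter, Nat.mem_divisorsAntidiagonal] at hx ⊢
    obtain ⟨⟨h1, h2⟩, k, rfl⟩ := hx
    rw [Nat.mul_div_cancel_left _ hp.pos]
    refine ⟨Nat.eq_of_mul_eq_mul_left hp.pos ?_, right_ne_zero_of_mul h2⟩
    rw [← h1]; ring
  · intro x _
    simp [Nat.mul_div_cancel_left _ hp.pos]
  · intro x hx
    simp only [Finset.mem_filter] at hx
    simp [Nat.mul_div_cancel' hx.2]
  · intro x _
    rfl

lemma sum_first_one (hp : p.Prime) (hn : 0 < n) (f : ℕ → ℂ) :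
    ∑ x ∈ frickePairs p n, (if x.1 = 1 then f x.2 else 0) = f n := by
  rw [Finset.sum_eq_single (1, n)]
  · simp
  · rintro ⟨a, d⟩ hx hne
    rw [if_neg]
    rintro rfl
    simp only [frickePairs, Finset.mem_union, Finset.mem_filter, Nat.mem_divisorsAntidiagonal,
      one_mul, Nat.dvd_one] at hx
    rcases hx with hx | hx
    · exact hne (by rw [hx.1])
    · exact hp.one_lt.ne' hx.2.1
  · intro hx
    refine absurd ?_ hx
    simp [frickePairs, hn.ne']

variable {P : Polynomial ℂ}

lemma trace_relation_fricke (hp : p.Prime) (hh : h * (p - 1) = 12) (hn : 0 < n)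
    (hP : ∀ x, P.eval x = x ^ 2 - 2 * deriv (frickeReg p h) 0) (hN : 4 * (p * n) ≤ N) :
    ∑ r ∈ Finset.Icc (-N : ℤ) N, t2Star p P (4 * n - r ^ 2) +
        ∑ r ∈ Finset.Icc (-N : ℤ) N,
          (if (p : ℤ) ∣ r then t2Star p P (4 * (p * n : ℕ) - r ^ 2) else 0) =
      2 * n * (iteratedDeriv n (frickeReg p h) 0 / n.factorial) := by
  have H := isHaupt_fricke hp hh
  obtain ⟨k, hj⟩ := H.hasJet_pairs one_pos (pos_of_mem_frickePairs (p := p) (n := n))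
  have hpn : 0 < p * n := Nat.mul_pos hp.pos hn
  have key := sum_t2Star_add hp H hP
    (fun z hz => (H.analyticAt_famProd _ _ _ hz).differentiableAt.differentiableWithinAt)
    (fun γ hγ z hz => famProd_fricke_moebius hp hh hn hγ hz) hj hn hpn
    ((Nat.mul_le_mul_left 4 (Nat.le_mul_of_pos_left n hp.pos)).trans hN) hN
    (R := fun _ => True) (R' := fun r => (p : ℤ) ∣ r) (fun _ => Iff.rfl) (fun _ => Int.dvd_neg)
    (fun z hz => order_famProd_fricke hp hh hn hz)
  have hsum := sum_kap_sub_card (if p = 2 then 5 else 3) (frickePairs p n) 1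
  rw [H.famWeight_pairs one_pos (pos_of_mem_frickePairs (p := p) (n := n)), Finset.sum_add_distrib]
    at key
  simp only [true_and, if_true, one_mul, Prod.mk.eta] at key hsum
  rw [sum_frickePairs hp hn (pairTerm _)] at hsum
  rw [sum_first_one hp hn fun d =>
    2 * d * (iteratedDeriv d (frickeReg p h) 0 / d.factorial)] at key
  refine key.trans ?_
  linear_combination hsum

lemma trace_relation_col (hp : p.Prime) (hh : h * (p - 1) = 12) (hn : 0 < n)
    (hP : ∀ x, P.eval x = x ^ 2 - 2 * deriv (frickeReg p h) 0) (hN : 4 * (p * n) ≤ N) :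
    ∑ r ∈ Finset.Icc (-N : ℤ) N, t2Star p P (4 * (p * n : ℕ) - r ^ 2) +
        ∑ r ∈ Finset.Icc (-N : ℤ) N,
          (if (p : ℤ) ∣ r then t2Star p P (4 * (p * n : ℕ) - r ^ 2) else 0) = 0 := by
  have H := isHaupt_fricke hp hh
  obtain ⟨k, hj⟩ := isHaupt_jOne.hasJet_pairs hp.pos (pos_of_mem_colPairs (t := 1) (m := n))
  obtain ⟨l, hl⟩ := isHaupt_jOne.hasJet_pairs one_pos (pos_of_mem_colPairs (t := p) (m := p * n))
  have hpn : 0 < p * n := Nat.mul_pos hp.pos hn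
  have key := sum_t2Star_add hp H hP (F := colProd p n)
    (fun z hz => ((isHaupt_jOne.analyticAt_famProd _ _ _ hz).mul
      (isHaupt_jOne.analyticAt_famProd _ _ _ hz)).differentiableAt.differentiableWithinAt)
    (fun γ hγ z hz => colProd_moebius hp hn hγ hz) (hj.mul hl) hpn hpn hN hN
    (R := fun _ => True) (R' := fun r => (p : ℤ) ∣ r) (fun _ => Iff.rfl) (fun _ => Int.dvd_neg)
    (fun z hz => order_colProd hp hn hz)
  have hsum := sum_kap_sub_card (if p = 2 then 5 else 3) (colPairs 1 n) p
  have hsum' := sum_kap_sub_card (if p = 2 then 5 else 3) (colPairs p (p * n)) 1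
  rw [isHaupt_jOne.famWeight_pairs one_pos (pos_of_mem_colPairs (t := p) (m := p * n)),
    isHaupt_jOne.famWeight_pairs hp.pos (pos_of_mem_colPairs (t := 1) (m := n)),
    Finset.sum_add_distrib, Finset.sum_add_distrib] at key
  have hz : ∑ x ∈ colPairs p (p * n), (if (1 : ℕ) = 1 ∧ x.1 = 1 then
      2 * (x.2 : ℂ) * (iteratedDeriv x.2 jOneReg 0 / x.2.factorial) else 0) = 0 := by
    refine Finset.sum_eq_zero fun x hx => if_neg ?_
    rintro ⟨-, h1⟩
    have := (Finset.mem_filter.1 hx).2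
    rw [h1, Nat.dvd_one] at this
    exact hp.one_lt.ne' this
  have hcol : colPairs 1 n = n.divisorsAntidiagonal := by simp [colPairs]
  rw [hz] at key
  rw [hcol, sum_antidiagonal_mul hp (pairTerm _)] at hsum
  simp only [hcol, hp.one_lt.ne', false_and, if_false, if_true, one_mul, Prod.mk.eta,
    Finset.sum_const_zero, add_zero] at key hsum hsum'
  have hcol' : ∑ x ∈ colPairs p (p * n), pairTerm (if p = 2 then 5 else 3) x =
      ∑ x ∈ (p * n).divisorsAntidiagonal,
        if p ∣ x.1 then pairTerm (if p = 2 then 5 else 3) x else 0 := by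
    rw [colPairs, Finset.sum_filter]
  rw [hcol'] at hsum'
  have hw : ∑ x ∈ (p * n).divisorsAntidiagonal, pairTerm (if p = 2 then 5 else 3) x +
      (∑ x ∈ (p * n).divisorsAntidiagonal,
        if (p : ℤ) ∣ x.1 + x.2 then pairTerm (if p = 2 then 5 else 3) x else 0) =
      (∑ x ∈ (p * n).divisorsAntidiagonal,
        if p ∣ x.2 then pairTerm (if p = 2 then 5 else 3) x else 0) +
      ∑ x ∈ (p * n).divisorsAntidiagonal,
        if p ∣ x.1 then pairTerm (if p = 2 then 5 else 3) x else 0 := by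
    rw [← Finset.sum_add_distrib, ← Finset.sum_add_distrib]
    refine Finset.sum_congr rfl fun x hx => ?_
    simp only [dvd_add_iff_of_mem hp hx]
    have hor : p ∣ x.1 ∨ p ∣ x.2 := hp.dvd_mul.1 (by
      rw [(Nat.mem_divisorsAntidiagonal.1 hx).1]
      exact dvd_mul_right p n)
    by_cases h1 : p ∣ x.1 <;> by_cases h2 : p ∣ x.2 <;> simp_all
  refine key.trans ?_
  rw [Nat.cast_add]
  linear_combination hsum + hsum' + hw

end

end FrickeTrace

namespace FrickeTrace

lemma t2Star_of_lt {p : ℕ} {P : Polynomial ℂ} {d : ℤ} (hd : d < -4) : t2Star p P d = 0 := by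
  unfold t2Star
  rw [if_neg (by omega), if_neg (by omega), if_neg (by omega), if_neg (by omega)]

lemma finsum_t2Star_neg_one {p : ℕ} (hp : p.Prime) (P : Polynomial ℂ) :
    ∑ᶠ r : ℤ, (t2Star p P (4 * (-1) - r ^ 2) - t2Star p P (4 * p * (-1) - r ^ 2)) = -2 := by
  have h2 := hp.two_le
  have hz : ∀ r : ℤ, t2Star p P (4 * p * (-1) - r ^ 2) = 0 := fun r =>
    t2Star_of_lt (by nlinarith [sq_nonneg r])
  rw [finsum_eq_single _ 0]
  · rw [hz]
    simp [t2Star]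
  · intro r hr
    rw [hz, t2Star_of_lt, sub_zero]
    have := sq_pos_of_ne_zero hr
    linarith

lemma finsum_t2Star_of_pos {p h n : ℕ} (hp : p.Prime) (hh : h * (p - 1) = 12) (hn : 0 < n)
    {P : Polynomial ℂ} (hP : ∀ x, P.eval x = x ^ 2 - 2 * deriv (frickeReg p h) 0) :
    ∑ᶠ r : ℤ, (t2Star p P (4 * n - r ^ 2) - t2Star p P (4 * p * n - r ^ 2)) =
      2 * n * (iteratedDeriv n (frickeReg p h) 0 / n.factorial) := by
  have hA := trace_relation_fricke hp hh hn hP (Nat.le_add_right (4 * (p * n)) 4)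
  have hB := trace_relation_col hp hh hn hP (Nat.le_add_right (4 * (p * n)) 4)
  rw [finsum_eq_sum_of_support_subset
    (s := Finset.Icc (-(4 * (p * n) + 4 : ℕ) : ℤ) (4 * (p * n) + 4 : ℕ)), Finset.sum_sub_distrib]
  · have : ∀ r : ℤ, t2Star p P (4 * p * n - r ^ 2) = t2Star p P (4 * (p * n : ℕ) - r ^ 2) := by
      intro r
      push_cast
      rw [mul_assoc]
    simp only [this]
    linear_combination hA - hB
  · intro r hr
    by_contra hr'
    refine hr ?_
    have hnp : (n : ℤ) ≤ p * n := by exact_mod_cast Nat.le_mul_of_pos_left n hp.pos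
    have hn0 : (0 : ℤ) ≤ n := by positivity
    have hbig : 4 * (p * n : ℤ) + 4 < r ^ 2 := by
      simp only [Finset.coe_Icc, Set.mem_Icc, not_and_or, not_le] at hr'
      push_cast at hr'
      rcases hr' with h1 | h1 <;> nlinarith
    change _ - _ = _
    rw [t2Star_of_lt (by linarith), t2Star_of_lt (by linarith), sub_zero]

end FrickeTrace

/-- **Theorem 1.1, prime levels, part 2.**
For prime `p ∈ {2,3,5,7,13}` and any `n ≥ -1`,
`2n c_n^{(p*)} = Σ_{r ∈ ℤ} { t₂^{(p*)}(4n - r²) - t₂^{(p*)}(4pn - r²) }`. -/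
theorem trace_formula_jnStar_prime (p : ℕ) (hp : p ∈ ({2, 3, 5, 7, 13} : Set ℕ)) (hp' : p.Prime)
    (c : ℤ → ℂ) (hc : HasQExp (jnStar p) c (-1))
    (P : Polynomial ℂ) (e : ℤ → ℂ)
    (hP : HasQExp (fun z => Polynomial.eval (jnStar p z) P) e (-2))
    (he2 : e (-2) = 1) (he1 : e (-1) = 0) (he0 : e 0 = 0)
    (n : ℤ) (hn : -1 ≤ n) :
    2 * (n : ℂ) * c n =
      ∑ᶠ r : ℤ, (t2Star p P (4 * n - r ^ 2) - t2Star p P (4 * p * n - r ^ 2)) := by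
  obtain ⟨h, hh⟩ : ∃ h : ℕ, h * (p - 1) = 12 := by
    rcases hp with rfl | rfl | rfl | rfl | rfl
    exacts [⟨12, rfl⟩, ⟨6, rfl⟩, ⟨3, rfl⟩, ⟨2, rfl⟩, ⟨1, rfl⟩]
  have H := FrickeTrace.isHaupt_fricke hp' hh
  obtain ⟨hc1, hcn⟩ := H.coeff_eq hc
  have hPe := H.poly_eval hP he2 he1 he0
  obtain rfl | rfl | hn0 : n = -1 ∨ n = 0 ∨ 0 < n := by omega
  · rw [FrickeTrace.finsum_t2Star_neg_one hp', hc1]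
    norm_num
  · simp
  · lift n to ℕ using hn0.le
    rw [FrickeTrace.finsum_t2Star_of_pos hp' hh (by exact_mod_cast hn0) hPe, hcn]
    norm_cast
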